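/- There is an absolute constant c > 0 such that for every function d = d(n) and all large enough n, with high probability over G drawn from G(n,1/2) the degree-d Sum-of-Squares relaxation of the maximum clique problem on G has objective value at least n^{1/2 - c(d/\log n)^{1/2}}; that is, there exists a degree-d pseudo-distribution for the clique problem whose value \tilde{E}[\sum_{i=1}^n x_i] is at least n^{1/2 - c(d/\log n)^{1/2}}. -/

import Mathlib

open Finset
section
attribute [local instance] Classical.propDecidable
namespace PlantedClique
/-- The set of potential edges of a graph on vertex set `Fin n`:
unordered pairs of distinct vertices. -/
abbrev Edge (n : ℕ) := {e : Sym2 (Fin n) // ¬ e.IsDiag}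

/-- A graph on vertex set `Fin n`, identified with its Boolean edge indicators. -/
abbrev Graph (n : ℕ) := Edge n → Bool

/-- `i` and `j` are joined by an edge of `G`. -/
def hasEdge {n : ℕ} (G : Graph n) (i j : Fin n) : Prop :=
  ∃ e : Edge n, (e : Sym2 (Fin n)) = s(i, j) ∧ G e = true

/-- `S` is a clique in `G`: every pair of distinct vertices of `S` is joined by an edge. -/
def IsClique {n : ℕ} (G : Graph n) (S : Finset (Fin n)) : Prop :=
  ∀ i ∈ S, ∀ j ∈ S, i ≠ j → hasEdge G i j

/-- The probability, over a uniformly random graph `G ∼ G(n,1/2)`, of the event `P`. -/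
noncomputable def probGraph (n : ℕ) (P : Graph n → Prop) : ℝ :=
  (Finset.univ.filter P).card / (Fintype.card (Graph n))

/-- A degree-`d` pseudo-distribution for the clique problem on `G` (constraints
(1)–(4) and (6)): a linear functional on polynomials that is normalized, satisfies the
Booleanity constraints `Ẽ[xᵢ²p] = Ẽ[xᵢp]`, the clique constraints `Ẽ[xᵢxⱼp] = 0` for
non-edges `(i,j)`, and positivity `Ẽ[p²] ≥ 0` for `deg p ≤ d/2`. -/
def IsCliquePseudoDist (n d : ℕ) (G : Graph n) (L : MvPolynomial (Fin n) ℝ →ₗ[ℝ] ℝ) : Prop :=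
  L 1 = 1 ∧
  (∀ (i : Fin n) (p : MvPolynomial (Fin n) ℝ), p.totalDegree ≤ d - 2 →
      L (MvPolynomial.X i ^ 2 * p) = L (MvPolynomial.X i * p)) ∧
  (∀ i j : Fin n, i ≠ j → ¬ hasEdge G i j →
      ∀ p : MvPolynomial (Fin n) ℝ, p.totalDegree ≤ d - 2 →
        L (MvPolynomial.X i * MvPolynomial.X j * p) = 0) ∧
  (∀ p : MvPolynomial (Fin n) ℝ, p.totalDegree ≤ d / 2 → 0 ≤ L (p ^ 2))
end PlantedClique
end

section
open scoped Classical

section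
namespace PlantedClique
variable {n : ℕ}

/-- The two endpoints of an edge. -/
noncomputable def supp (e : Edge n) : Finset (Fin n) := univ.filter (fun v => v ∈ e.1)

/-- A ribbon: left side, right side, vertex set, edge set. -/
structure Rib (n : ℕ) where
  l : Finset (Fin n)
  r : Finset (Fin n)
  V : Finset (Fin n)
  T : Finset (Edge n)

@[ext] theorem Rib.ext' {a b : Rib n} (h1 : a.l = b.l) (h2 : a.r = b.r) (h3 : a.V = b.V)
    (h4 : a.T = b.T) : a = b := by
  cases a; cases b; simp_all

noncomputable instance : Fintype (Rib n) :=
  Fintype.ofInjective (fun ρ : Rib n => (ρ.l, ρ.r, ρ.V, ρ.T)) (by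
    intro a b h
    simp only [Prod.mk.injEq] at h
    exact Rib.ext' h.1 h.2.1 h.2.2.1 h.2.2.2)

/-- Well-formed ribbons: no isolated vertices outside the sides. -/
structure Rib.Valid (ρ : Rib n) : Prop where
  l_sub : ρ.l ⊆ ρ.V
  r_sub : ρ.r ⊆ ρ.V
  T_sub : ∀ e ∈ ρ.T, supp e ⊆ ρ.V
  cov : ∀ v ∈ ρ.V, v ∉ ρ.l → v ∉ ρ.r → ∃ e ∈ ρ.T, v ∈ supp e

/-- Separations of a ribbon. -/
structure Rib.Sep (ρ : Rib n) (X Y : Finset (Fin n)) : Prop where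
  un : X ∪ Y = ρ.V
  l_sub : ρ.l ⊆ X
  r_sub : ρ.r ⊆ Y
  edge : ∀ e ∈ ρ.T, supp e ⊆ X ∨ supp e ⊆ Y

/-- Left ribbons: the right side is the unique minimum separator. -/
structure Rib.Left (ρ : Rib n) : Prop where
  valid : ρ.Valid
  noedge : ∀ e ∈ ρ.T, ¬ supp e ⊆ ρ.r
  min : ∀ X Y, ρ.Sep X Y → ρ.r.card ≤ (X ∩ Y).card
  uniq : ∀ X Y, ρ.Sep X Y → (X ∩ Y).card = ρ.r.card → Y = ρ.r

/-- `Z`-irreducibility: the left side is a minimum separator from the right side and `Z`. -/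
def Rib.Irr (ρ : Rib n) (Z : Finset (Fin n)) : Prop :=
  ∀ X Y, ρ.Sep X Y → ρ.V ∩ Z ⊆ Y → ρ.l.card ≤ (X ∩ Y).card

/-- Transposed ribbon. -/
def Rib.tr (ρ : Rib n) : Rib n := ⟨ρ.r, ρ.l, ρ.V, ρ.T⟩

/-- Composition of ribbons. -/
noncomputable def Rib.comp (γ ρ : Rib n) : Rib n := ⟨γ.l, ρ.r, γ.V ∪ ρ.V, γ.T ∪ ρ.T⟩

/-- Admissible pairs for the splitting of a ribbon relative to the set `Z`. -/
structure Pair (Z : Finset (Fin n)) (γ ρ : Rib n) : Prop where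
  left : γ.Left
  valid : ρ.Valid
  side : γ.r = ρ.l
  irr : ρ.Irr Z
  int : γ.V ∩ (ρ.V ∪ Z) ⊆ ρ.l

theorem card_modular {α : Type*} [DecidableEq α] {P R X Y : Finset α} (h : P ∪ R = X ∪ Y) :
    ((P ∩ X) ∩ (R ∪ Y)).card + ((P ∪ X) ∩ (Y ∩ R)).card = (P ∩ R).card + (X ∩ Y).card := by
  have h1 := card_union_add_card_inter (P ∩ X) (R ∪ Y)
  have h2 := card_union_add_card_inter (P ∪ X) (Y ∩ R)
  have h3 := card_union_add_card_inter P R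
  have h4 := card_union_add_card_inter X Y
  have h5 := card_union_add_card_inter P X
  have h6 := card_union_add_card_inter R Y
  have e1 : (P ∩ X) ∪ (R ∪ Y) = X ∪ Y := by
    ext v
    have := Finset.ext_iff.1 h v
    simp only [mem_union, mem_inter] at *
    tauto
  have e2 : (P ∪ X) ∪ (Y ∩ R) = X ∪ Y := by
    ext v
    have := Finset.ext_iff.1 h v
    simp only [mem_union, mem_inter] at *
    tauto
  rw [e1] at h1
  rw [e2] at h2
  rw [h] at h3
  have h7 := inter_comm R Y
  rw [h7] at h6
  omega

theorem Pair.inter_eq {Z : Finset (Fin n)} {γ ρ : Rib n} (h : Pair Z γ ρ) : γ.V ∩ ρ.V = γ.r := by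
  have h1 := h.int
  have h2 := h.left.valid.r_sub
  have h3 := h.valid.l_sub
  have h4 := h.side
  ext v
  grind

theorem Rib.Left.cov_r {γ : Rib n} (h : γ.Left) {v : Fin n} (hv : v ∈ γ.r) (hl : v ∉ γ.l) :
    ∃ e ∈ γ.T, v ∈ supp e := by
  by_contra hc
  push Not at hc
  have hr := h.valid.r_sub
  have hls := h.valid.l_sub
  have hs : γ.Sep (γ.V.erase v) γ.r := by
    refine ⟨?_, ?_, subset_rfl, ?_⟩
    · ext x; grind
    · intro x hx; grind
    · intro e he
      left
      intro x hx
      have := h.valid.T_sub e he hx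
      have := hc e he
      grind
  have h1 := h.min _ _ hs
  have h2 : γ.V.erase v ∩ γ.r ⊂ γ.r := by
    refine (ssubset_iff_of_subset inter_subset_right).2 ⟨v, hv, by simp⟩
  have := card_lt_card h2
  omega

theorem Pair.comp_valid {Z : Finset (Fin n)} {γ ρ : Rib n} (h : Pair Z γ ρ) :
    (γ.comp ρ).Valid := by
  refine ⟨?_, ?_, ?_, ?_⟩
  · exact h.left.valid.l_sub.trans subset_union_left
  · exact h.valid.r_sub.trans subset_union_right
  · intro e he
    rcases mem_union.1 he with he | he
    · exact (h.left.valid.T_sub e he).trans subset_union_left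
    · exact (h.valid.T_sub e he).trans subset_union_right
  · intro v hv hl hr
    simp only [Rib.comp] at *
    have hs := h.side
    by_cases hv2 : v ∈ ρ.V
    · by_cases hvl : v ∈ ρ.l
      · obtain ⟨e, he, hve⟩ := h.left.cov_r (hs ▸ hvl) hl
        exact ⟨e, mem_union_left _ he, hve⟩
      · obtain ⟨e, he, hve⟩ := h.valid.cov v hv2 hvl hr
        exact ⟨e, mem_union_right _ he, hve⟩
    · have hv1 : v ∈ γ.V := by
        rcases mem_union.1 hv with h | h
        · exact h
        · exact absurd h hv2
      have : v ∉ γ.r := fun hh => hv2 (h.valid.l_sub (hs ▸ hh))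
      obtain ⟨e, he, hve⟩ := h.left.valid.cov v hv1 hl this
      exact ⟨e, mem_union_left _ he, hve⟩

/-- The canonical separation of a composition. -/
theorem Pair.sep {Z : Finset (Fin n)} {γ ρ : Rib n} (h : Pair Z γ ρ) :
    (γ.comp ρ).Sep γ.V ρ.V := by
  refine ⟨rfl, h.left.valid.l_sub, h.valid.r_sub, ?_⟩
  intro e he
  rcases mem_union.1 he with he | he
  · exact Or.inl (h.left.valid.T_sub e he)
  · exact Or.inr (h.valid.T_sub e he)

/-- Restriction of a separation of the composition to the left part. -/
theorem Rib.Sep.restrict_left {γ ρ : Rib n} (hγ : γ.Valid) (hρ : ρ.Valid) (hs : γ.r = ρ.l)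
    {P R : Finset (Fin n)} (h : (γ.comp ρ).Sep P R) :
    γ.Sep (P ∩ γ.V) ((R ∪ ρ.V) ∩ γ.V) := by
  have h1 := h.un
  have h2 := h.l_sub
  have h3 := h.edge
  have h4 := hγ.l_sub
  have h5 := hγ.r_sub
  have h6 := hρ.l_sub
  simp only [Rib.comp] at *
  refine ⟨?_, ?_, ?_, ?_⟩
  · ext x; have := Finset.ext_iff.1 h1 x; grind
  · intro x hx; grind
  · intro x hx; grind
  · intro e he
    have h7 := hγ.T_sub e he
    rcases h3 e (mem_union_left _ he) with h | h
    · left; exact subset_inter h h7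
    · right; exact subset_inter (h.trans subset_union_left) h7

theorem Rib.Sep.restrict_right {γ ρ : Rib n} (hγ : γ.Valid) (hρ : ρ.Valid) (hs : γ.r = ρ.l)
    {P R : Finset (Fin n)} (h : (γ.comp ρ).Sep P R) :
    ρ.Sep ((P ∪ γ.V) ∩ ρ.V) (ρ.V ∩ R) := by
  have h1 := h.un
  have h2 := h.r_sub
  have h3 := h.edge
  have h4 := hρ.r_sub
  have h5 := hγ.r_sub
  have h6 := hρ.l_sub
  simp only [Rib.comp] at *
  refine ⟨?_, ?_, ?_, ?_⟩
  · ext x; have := Finset.ext_iff.1 h1 x; grind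
  · intro x hx; grind
  · intro x hx; grind
  · intro e he
    have h7 := hρ.T_sub e he
    rcases h3 e (mem_union_right _ he) with h | h
    · left; exact subset_inter (h.trans subset_union_left) h7
    · right; exact subset_inter h7 h

theorem sep_card {γ ρ : Rib n} {P R : Finset (Fin n)} (h : P ∪ R = γ.V ∪ ρ.V) :
    ((P ∩ γ.V) ∩ ((R ∪ ρ.V) ∩ γ.V)).card + (((P ∪ γ.V) ∩ ρ.V) ∩ (ρ.V ∩ R)).card
      = (P ∩ R).card + (γ.V ∩ ρ.V).card := by
  rw [← card_modular h]
  congr 2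
  · ext x; grind
  · ext x; grind

theorem Pair.key {Z : Finset (Fin n)} {γ ρ : Rib n} (h : Pair Z γ ρ) {P R : Finset (Fin n)}
    (hs : (γ.comp ρ).Sep P R) (hZ : (γ.V ∪ ρ.V) ∩ Z ⊆ R) :
    γ.r.card ≤ (P ∩ R).card ∧ ((P ∩ R).card = γ.r.card → γ.V ⊆ P ∧ R ⊆ ρ.V) := by
  have s1 := hs.restrict_left h.left.valid h.valid h.side
  have s2 := hs.restrict_right h.left.valid h.valid h.side
  have m1 := h.left.min _ _ s1
  have m2 := h.irr _ _ s2 (by intro x hx; grind)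
  have hc := sep_card (γ := γ) (ρ := ρ) hs.un
  rw [h.inter_eq] at hc
  rw [← h.side] at m2
  refine ⟨by omega, fun he => ?_⟩
  have e1 := h.left.uniq _ _ s1 (by omega)
  have e2 : P ∩ γ.V ∩ ((R ∪ ρ.V) ∩ γ.V) = γ.r := by
    apply eq_of_subset_of_card_le
    · rw [e1]; exact inter_subset_right
    · omega
  have hu := hs.un
  have h5 := h.inter_eq
  simp only [Rib.comp] at hu
  constructor
  · intro x hx
    have := Finset.ext_iff.1 hu x
    have := Finset.ext_iff.1 e1 x
    have := Finset.ext_iff.1 e2 x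
    have := Finset.ext_iff.1 h5 x
    grind
  · intro x hx
    have := Finset.ext_iff.1 hu x
    have := Finset.ext_iff.1 e1 x
    have := Finset.ext_iff.1 h5 x
    grind

theorem Pair.zsub {Z : Finset (Fin n)} {γ ρ : Rib n} (h : Pair Z γ ρ) :
    (γ.V ∪ ρ.V) ∩ Z ⊆ ρ.V := by
  intro x hx
  have := @h.int x
  have := @h.valid.l_sub x
  grind

theorem Pair.unique {Z : Finset (Fin n)} {γ ρ γ' ρ' : Rib n} (h : Pair Z γ ρ) (h' : Pair Z γ' ρ')
    (he : γ.comp ρ = γ'.comp ρ') : γ = γ' ∧ ρ = ρ' := by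
  have hV : γ.V ∪ ρ.V = γ'.V ∪ ρ'.V := congrArg Rib.V he
  have hl : γ.l = γ'.l := by
    have := congrArg Rib.l he
    exact this
  have hr : ρ.r = ρ'.r := by
    have := congrArg Rib.r he
    exact this
  have hT : γ.T ∪ ρ.T = γ'.T ∪ ρ'.T := congrArg Rib.T he
  have k1 := h.key (P := γ'.V) (R := ρ'.V) (he ▸ h'.sep) (by rw [hV]; exact h'.zsub)
  have k2 := h'.key (P := γ.V) (R := ρ.V) (he ▸ h.sep) (by rw [← hV]; exact h.zsub)
  rw [h'.inter_eq] at k1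
  rw [h.inter_eq] at k2
  have hc : γ'.r.card = γ.r.card := le_antisymm k2.1 k1.1
  obtain ⟨a1, a2⟩ := k1.2 hc
  obtain ⟨b1, b2⟩ := k2.2 hc.symm
  have e1 : γ.V = γ'.V := subset_antisymm a1 b1
  have e2 : ρ.V = ρ'.V := subset_antisymm b2 a2
  have e3 : γ.r = γ'.r := by rw [← h.inter_eq, ← h'.inter_eq, e1, e2]
  have key : ∀ {γ ρ : Rib n}, Pair Z γ ρ → ∀ e, (e ∈ γ.T ↔ e ∈ γ.T ∪ ρ.T ∧ ¬ supp e ⊆ ρ.V) ∧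
      (e ∈ ρ.T ↔ e ∈ γ.T ∪ ρ.T ∧ supp e ⊆ ρ.V) := by
    intro γ ρ h e
    have t1 : e ∈ γ.T → ¬ supp e ⊆ ρ.V := by
      intro he hs
      apply h.left.noedge e he
      rw [← h.inter_eq]
      exact subset_inter (h.left.valid.T_sub e he) hs
    have t2 := h.valid.T_sub e
    rw [mem_union]
    tauto
  constructor
  · refine Rib.ext' hl e3 e1 ?_
    ext e
    rw [(key h e).1, (key h' e).1, hT, e2]
  · refine Rib.ext' (by rw [← h.side, ← h'.side, e3]) hr e2 ?_
    ext e
    rw [(key h e).2, (key h' e).2, hT, e2]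

theorem Pair.exists {Z : Finset (Fin n)} {ρ : Rib n} (hρ : ρ.Valid) :
    ∃ γ σ, Pair Z γ σ ∧ γ.comp σ = ρ := by
  let S : Finset (Finset (Fin n) × Finset (Fin n)) :=
    univ.filter (fun p => ρ.Sep p.1 p.2 ∧ ρ.V ∩ Z ⊆ p.2)
  have hS : S.Nonempty := by
    refine ⟨(ρ.l, ρ.V), ?_⟩
    simp only [S, mem_filter, mem_univ, true_and]
    refine ⟨⟨?_, subset_rfl, hρ.r_sub, fun e he => Or.inr (hρ.T_sub e he)⟩, inter_subset_left⟩
    exact union_eq_right.2 hρ.l_sub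
  obtain ⟨⟨X, Y⟩, hXY, hmin⟩ := exists_min_image S
    (fun p => (n + 1) * (p.1 ∩ p.2).card + p.1.card) hS
  simp only [S, mem_filter, mem_univ, true_and] at hXY
  obtain ⟨hsep, hZ⟩ := hXY
  have hmin' : ∀ P R, ρ.Sep P R → ρ.V ∩ Z ⊆ R → (X ∩ Y).card ≤ (P ∩ R).card ∧
      ((P ∩ R).card = (X ∩ Y).card → X.card ≤ P.card) := by
    intro P R h1 h2
    have := hmin (P, R) (by simp only [S, mem_filter, mem_univ, true_and]; exact ⟨h1, h2⟩)
    simp only at this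
    have hP : P.card ≤ n := by simpa using card_le_univ P
    constructor
    · by_contra hc
      push Not at hc
      have : (n + 1) * ((P ∩ R).card + 1) ≤ (n + 1) * (X ∩ Y).card := Nat.mul_le_mul_left _ hc
      nlinarith
    · intro he
      rw [he] at this
      omega
  have hu := hsep.un
  have hl := hsep.l_sub
  have hr := hsep.r_sub
  refine ⟨⟨ρ.l, X ∩ Y, X, ρ.T.filter (fun e => ¬ supp e ⊆ Y)⟩,
    ⟨X ∩ Y, ρ.r, Y, ρ.T.filter (fun e => supp e ⊆ Y)⟩, ?_, ?_⟩
  · refine ⟨⟨⟨hl, inter_subset_left, ?_, ?_⟩, ?_, ?_, ?_⟩, ⟨inter_subset_right, hr, ?_, ?_⟩,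
      rfl, ?_, ?_⟩
    · intro e he
      rw [mem_filter] at he
      exact (hsep.edge e he.1).resolve_right he.2
    · intro v hv hvl hvr
      simp only [mem_inter, not_and] at hv hvl hvr
      have hvY := hvr hv
      obtain ⟨e, he, hve⟩ := hρ.cov v (hu ▸ mem_union_left _ hv) hvl (fun h => hvY (hr h))
      exact ⟨e, mem_filter.2 ⟨he, fun h => hvY (h hve)⟩, hve⟩
    · intro e he hs
      rw [mem_filter] at he
      exact he.2 (hs.trans inter_subset_right)
    all_goals try
      intro P R hPR
      have g1 := hPR.un
      have g2 := hPR.l_sub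
      have g3 := hPR.r_sub
      simp only at g1 g2 g3
      have hs : ρ.Sep P (R ∪ Y) := by
        refine ⟨?_, g2, hr.trans subset_union_right, ?_⟩
        · rw [← union_assoc, g1, hu]
        · intro e he
          by_cases hY : supp e ⊆ Y
          · exact Or.inr (hY.trans subset_union_right)
          · rcases hPR.edge e (mem_filter.2 ⟨he, hY⟩) with h | h
            · exact Or.inl h
            · exact Or.inr (h.trans subset_union_left)
      have hi : P ∩ (R ∪ Y) = P ∩ R := by
        ext x
        have := Finset.ext_iff.1 g1 x
        have := @g3 x
        grind
      have hm := hmin' P (R ∪ Y) hs (hZ.trans subset_union_right)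
      rw [hi] at hm
    · exact hm.1
    · intro hc
      have h1 := hm.2 hc
      have hPX : P = X := eq_of_subset_of_card_le (g1 ▸ subset_union_left) h1
      have hR : P ∩ R = R := by
        rw [hPX]; exact inter_eq_right.2 (g1 ▸ subset_union_right)
      rw [hR] at hc
      exact (eq_of_subset_of_card_le g3 hc.le).symm
    · intro e he
      exact (mem_filter.1 he).2
    · intro v hv hvl hvr
      simp only [mem_inter, not_and] at hv hvl hvr
      have hvX : v ∉ X := fun h => hvl h hv
      obtain ⟨e, he, hve⟩ := hρ.cov v (hu ▸ mem_union_right _ hv) (fun h => hvX (hl h)) hvr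
      refine ⟨e, mem_filter.2 ⟨he, ?_⟩, hve⟩
      exact (hsep.edge e he).resolve_left (fun h => hvX (h hve))
    · intro P R hPR hZR
      have g1 := hPR.un
      have g2 := hPR.l_sub
      have g3 := hPR.r_sub
      simp only at g1 g2 g3 hZR
      have hs : ρ.Sep (P ∪ X) R := by
        refine ⟨?_, hl.trans subset_union_right, g3, ?_⟩
        · rw [union_comm P X, union_assoc, g1, hu]
        · intro e he
          by_cases hY : supp e ⊆ Y
          · rcases hPR.edge e (mem_filter.2 ⟨he, hY⟩) with h | h
            · exact Or.inl (h.trans subset_union_left)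
            · exact Or.inr h
          · exact Or.inl (((hsep.edge e he).resolve_right hY).trans subset_union_right)
      have hi : (P ∪ X) ∩ R = P ∩ R := by
        ext x
        have := Finset.ext_iff.1 g1 x
        have := @g2 x
        grind
      have hm := hmin' (P ∪ X) R hs (by intro x hx; have := @hZ x; have := @hZR x; grind)
      rw [hi] at hm
      exact hm.1
    · intro x hx
      have := @hZ x
      have := Finset.ext_iff.1 hu x
      simp only at hx
      grind
  · refine Rib.ext' rfl rfl hu ?_
    simp only [Rib.comp]
    rw [union_comm, filter_union_filter_not_eq]

/-- `comp` is left iff the second factor is. -/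
theorem Pair.left_iff {Z : Finset (Fin n)} {γ ρ : Rib n} (h : Pair Z γ ρ) :
    (γ.comp ρ).Left ↔ ρ.Left := by
  have hi := h.inter_eq
  have hside := h.side
  have q1 := h.left.valid.r_sub
  have q2 := h.valid.r_sub
  constructor
  · intro hL
    have ext : ∀ P R, ρ.Sep P R → (γ.comp ρ).Sep (γ.V ∪ P) R ∧ (γ.V ∪ P) ∩ R = P ∩ R := by
      intro P R hs
      have g1 := hs.un
      have g2 := hs.l_sub
      refine ⟨⟨?_, h.left.valid.l_sub.trans subset_union_left, hs.r_sub, ?_⟩, ?_⟩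
      · simp only [Rib.comp]; rw [union_assoc, g1]
      · intro e he
        rcases mem_union.1 he with he | he
        · exact Or.inl ((h.left.valid.T_sub e he).trans subset_union_left)
        · rcases hs.edge e he with h | h
          · exact Or.inl (h.trans subset_union_right)
          · exact Or.inr h
      · ext x
        have := Finset.ext_iff.1 g1 x
        have := @g2 x
        have := Finset.ext_iff.1 hi x
        grind
    refine ⟨h.valid, fun e he => hL.noedge e (mem_union_right _ he), ?_, ?_⟩
    · intro P R hs
      have := hL.min _ _ (ext P R hs).1
      rw [(ext P R hs).2] at this
      exact this
    · intro P R hs hc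
      exact hL.uniq _ _ (ext P R hs).1 (by rw [(ext P R hs).2]; exact hc)
  · intro hL
    have hval := h.comp_valid
    have res : ∀ P R, (γ.comp ρ).Sep P R →
        ((((P ∪ γ.V) ∩ ρ.V) ∩ (ρ.V ∩ R)).card ≤ (P ∩ R).card ∧
        (((P ∩ R).card = (((P ∪ γ.V) ∩ ρ.V) ∩ (ρ.V ∩ R)).card) → R ⊆ ρ.V)) := by
      intro P R hs
      have s1 := hs.restrict_left h.left.valid h.valid h.side
      have m1 := h.left.min _ _ s1
      have hc := sep_card (γ := γ) (ρ := ρ) hs.un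
      rw [h.inter_eq] at hc
      refine ⟨by omega, fun he => ?_⟩
      have e1 := h.left.uniq _ _ s1 (by omega)
      have hu := hs.un
      simp only [Rib.comp] at hu
      intro x hx
      have := Finset.ext_iff.1 hu x
      have := Finset.ext_iff.1 e1 x
      have := Finset.ext_iff.1 hi x
      grind
    refine ⟨hval, ?_, ?_, ?_⟩
    · intro e he hs
      simp only [Rib.comp] at hs he
      rcases mem_union.1 he with he | he
      · apply h.left.noedge e he
        rw [← hi]
        exact subset_inter (h.left.valid.T_sub e he) (hs.trans q2)
      · exact hL.noedge e he hs
    · intro P R hs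
      have s2 := hs.restrict_right h.left.valid h.valid h.side
      have := hL.min _ _ s2
      exact this.trans (res P R hs).1
    · intro P R hs hc
      have s2 := hs.restrict_right h.left.valid h.valid h.side
      have m2 := hL.min _ _ s2
      have := (res P R hs).1
      simp only [Rib.comp] at hc ⊢
      have h3 := (res P R hs).2 (by omega)
      have h4 := hL.uniq _ _ s2 (by omega)
      rw [← h4]
      exact (inter_eq_right.2 h3).symm

end PlantedClique
end

section
namespace PlantedClique
variable {n : ℕ}

/-- The `±1` character of a set of edges. -/
noncomputable def chi (G : Graph n) (T : Finset (Edge n)) : ℝ := ∏ e ∈ T, (if G e then 1 else -1)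

/-- The trivial ribbon. -/
noncomputable def triv (A : Finset (Fin n)) : Rib n := ⟨A, A, A, ∅⟩

theorem Rib.Left.comp_triv {γ : Rib n} (h : γ.Left) : γ.comp (triv γ.r) = γ :=
  Rib.ext' rfl rfl (union_eq_left.2 h.valid.r_sub) (union_empty _)

theorem triv_left (A : Finset (Fin n)) : (triv A).Left := by
  refine ⟨⟨subset_rfl, subset_rfl, ?_, ?_⟩, ?_, ?_, ?_⟩
  · intro e he; simp [triv] at he
  · intro v hv h; exact absurd hv h
  · intro e he; simp [triv] at he
  · intro X Y h; exact card_le_card (subset_inter h.l_sub h.r_sub)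
  · intro X Y h _
    exact subset_antisymm (subset_union_right.trans h.un.subset) h.r_sub

theorem triv_irr (A Z : Finset (Fin n)) : (triv A).Irr Z := fun _ _ h _ =>
  card_le_card (subset_inter h.l_sub h.r_sub)

theorem Rib.Left.pair_triv {γ : Rib n} (h : γ.Left) {Z : Finset (Fin n)} (hZ : γ.V ∩ Z ⊆ γ.r) :
    Pair Z γ (triv γ.r) := by
  refine ⟨h, (triv_left _).valid, rfl, triv_irr _ _, ?_⟩
  intro x hx
  have := @hZ x
  simp only [triv] at *
  grind

theorem Rib.Left.card_le {γ : Rib n} (h : γ.Left) : γ.r.card ≤ γ.l.card := by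
  have := h.min γ.l γ.V ⟨union_eq_right.2 h.valid.l_sub, subset_rfl, h.valid.r_sub,
    fun e he => Or.inr (h.valid.T_sub e he)⟩
  rwa [inter_eq_left.2 h.valid.l_sub] at this

theorem Rib.Left.eq_triv {γ : Rib n} (h : γ.Left) (hc : γ.l.card ≤ γ.r.card) :
    γ = triv γ.r := by
  have h1 := h.uniq γ.l γ.V ⟨union_eq_right.2 h.valid.l_sub, subset_rfl, h.valid.r_sub,
    fun e he => Or.inr (h.valid.T_sub e he)⟩
  rw [inter_eq_left.2 h.valid.l_sub] at h1
  have h2 := h1 (le_antisymm hc h.card_le)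
  refine Rib.ext' ?_ rfl h2 ?_
  · exact eq_of_subset_of_card_le (h2 ▸ h.valid.l_sub) h.card_le
  · refine eq_empty_of_forall_notMem fun e he => h.noedge e he (h2 ▸ h.valid.T_sub e he)

theorem Rib.Left.eq_triv_l {γ : Rib n} (h : γ.Left) (hc : γ.l.card ≤ γ.r.card) :
    γ = triv γ.l := by
  have h1 := h.eq_triv hc
  have : γ.l = γ.r := by rw [h1]; rfl
  rw [this]; exact h1

/-- weight of a left ribbon -/
def Rib.lw (γ : Rib n) : ℕ := γ.V.card - γ.r.card

theorem Pair.card_V {Z : Finset (Fin n)} {γ ρ : Rib n} (h : Pair Z γ ρ) :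
    (γ.comp ρ).V.card = γ.lw + ρ.V.card := by
  have h1 := card_union_add_card_inter γ.V ρ.V
  rw [h.inter_eq] at h1
  have h2 := card_le_card h.left.valid.r_sub
  simp only [Rib.comp, Rib.lw]
  omega

theorem Pair.lw_comp {Z : Finset (Fin n)} {γ ρ : Rib n} (h : Pair Z γ ρ) :
    (γ.comp ρ).lw = γ.lw + ρ.lw := by
  have h1 := h.card_V
  have h2 := card_le_card h.valid.r_sub
  simp only [Rib.lw] at *
  simp only [Rib.comp] at *
  omega

theorem Pair.disj {Z : Finset (Fin n)} {γ ρ : Rib n} (h : Pair Z γ ρ) : Disjoint γ.T ρ.T := by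
  rw [Finset.disjoint_left]
  intro e h1 h2
  apply h.left.noedge e h1
  rw [← h.inter_eq]
  exact subset_inter (h.left.valid.T_sub e h1) (h.valid.T_sub e h2)

theorem Pair.chi_comp {Z : Finset (Fin n)} {γ ρ : Rib n} (h : Pair Z γ ρ) (G : Graph n) :
    chi G (γ.comp ρ).T = chi G γ.T * chi G ρ.T := prod_union h.disj

theorem Rib.Valid.trans {ρ : Rib n} (h : ρ.Valid) : ρ.tr.Valid :=
  ⟨h.r_sub, h.l_sub, h.T_sub, fun v hv h1 h2 => h.cov v hv h2 h1⟩

theorem Rib.Sep.trans {ρ : Rib n} {X Y : Finset (Fin n)} (h : ρ.Sep X Y) : ρ.tr.Sep Y X :=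
  ⟨by rw [union_comm]; exact h.un, h.r_sub, h.l_sub, fun e he => (h.edge e he).symm⟩

theorem Rib.tr_tr (ρ : Rib n) : ρ.tr.tr = ρ := rfl

/-- Middle ribbons. -/
structure Rib.Middle (μ : Rib n) : Prop where
  valid : μ.Valid
  irr : μ.Irr ∅
  irr' : μ.tr.Irr ∅

/-- Composite ribbons. -/
inductive Comp (n : ℕ) where
  | mid : Rib n → Comp n
  | ext : Rib n → Comp n → Rib n → Comp n

namespace Comp
def l : Comp n → Finset (Fin n)
  | mid μ => μ.l
  | ext γ _ _ => γ.l
def r : Comp n → Finset (Fin n)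
  | mid μ => μ.r
  | ext _ _ γ' => γ'.l
noncomputable def W : Comp n → Finset (Fin n)
  | mid μ => μ.V
  | ext γ c γ' => γ.V ∪ c.W ∪ γ'.V
def w : Comp n → ℕ
  | mid μ => μ.V.card
  | ext γ c γ' => γ.lw + c.w + γ'.lw
noncomputable def ch (G : Graph n) : Comp n → ℝ
  | mid μ => chi G μ.T
  | ext γ c γ' => chi G γ.T * c.ch G * chi G γ'.T
def tr : Comp n → Comp n
  | mid μ => mid μ.tr
  | ext γ c γ' => ext γ' c.tr γ
end Comp

/-- Admissible extensions of a composite. -/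
structure ExtOK (D : ℕ) (γ : Rib n) (c : Comp n) (γ' : Rib n) : Prop where
  left : γ.Left
  left' : γ'.Left
  side : γ.r = c.l
  side' : γ'.r = c.r
  irr : γ.Irr (c.W ∪ γ'.V)
  irr' : γ'.Irr (c.W ∪ γ.V)
  card : γ.l.card ≤ D
  card' : γ'.l.card ≤ D
  nontriv : ¬ (γ = triv γ.r ∧ γ' = triv γ'.r)

def InC (D : ℕ) : ℕ → Comp n → Prop
  | 0, .mid μ => μ.Middle ∧ μ.l.card ≤ D
  | 0, .ext _ _ _ => False
  | _ + 1, .mid _ => False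
  | i + 1, .ext γ c γ' => InC D i c ∧ ExtOK D γ c γ'

noncomputable def CC (n D : ℕ) : ℕ → Finset (Comp n)
  | 0 => (univ.filter (fun μ : Rib n => μ.Middle ∧ μ.l.card ≤ D)).image Comp.mid
  | i + 1 => ((univ ×ˢ CC n D i ×ˢ univ).filter
      (fun t : Rib n × Comp n × Rib n => ExtOK D t.1 t.2.1 t.2.2)).image
      (fun t => Comp.ext t.1 t.2.1 t.2.2)

theorem mem_CC {D i : ℕ} {c : Comp n} : c ∈ CC n D i ↔ InC D i c := by
  induction i generalizing c with
  | zero => cases c <;> simp [CC, InC]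
  | succ i ih => cases c <;> simp [CC, InC, ih]

/-- Conditions for triples. -/
structure Tri (γ : Rib n) (c : Comp n) (γ' : Rib n) : Prop where
  left : γ.Left
  left' : γ'.Left
  side : γ.r = c.l
  side' : γ'.r = c.r

structure Good (γ : Rib n) (c : Comp n) (γ' : Rib n) : Prop where
  g : γ.V ∩ (c.W ∪ γ'.V) ⊆ γ.r
  g' : γ'.V ∩ (c.W ∪ γ.V) ⊆ γ'.r

noncomputable def tval (θ : ℕ → ℝ) (G : Graph n) (t : Rib n × Comp n × Rib n) : ℝ :=
  θ (t.1.lw + t.2.1.w + t.2.2.lw) * (chi G t.1.T * t.2.1.ch G * chi G t.2.2.T)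

noncomputable def Hset (D i : ℕ) (I J : Finset (Fin n)) : Finset (Rib n × Comp n × Rib n) :=
  (univ ×ˢ CC n D i ×ˢ univ).filter (fun t => Tri t.1 t.2.1 t.2.2 ∧ t.1.l = I ∧ t.2.2.l = J)

noncomputable def Gset (D i : ℕ) (I J : Finset (Fin n)) : Finset (Rib n × Comp n × Rib n) :=
  (Hset D i I J).filter (fun t => Good t.1 t.2.1 t.2.2)

theorem mem_Hset {D i : ℕ} {I J : Finset (Fin n)} {γ : Rib n} {c : Comp n} {γ' : Rib n} :
    (γ, c, γ') ∈ Hset D i I J ↔ InC D i c ∧ Tri γ c γ' ∧ γ.l = I ∧ γ'.l = J := by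
  simp [Hset, mem_CC]

theorem mem_Gset {D i : ℕ} {I J : Finset (Fin n)} {γ : Rib n} {c : Comp n} {γ' : Rib n} :
    (γ, c, γ') ∈ Gset D i I J ↔ (InC D i c ∧ Tri γ c γ' ∧ γ.l = I ∧ γ'.l = J) ∧ Good γ c γ' := by
  simp [Gset, mem_Hset]

theorem irr_congr {ρ : Rib n} {Z Z' : Finset (Fin n)} (h : ρ.V ∩ Z = ρ.V ∩ Z') :
    ρ.Irr Z ↔ ρ.Irr Z' := by
  simp only [Rib.Irr, h]

/-- from good quintuple to pairs -/
theorem pairs_of_good {γ₁ γ₂ γ₁' γ₂' : Rib n} {c : Comp n}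
    (t : Tri γ₁ (.ext γ₂ c γ₂') γ₁') (g : Good γ₁ (.ext γ₂ c γ₂') γ₁')
    (hl : γ₂.Left) (hl' : γ₂'.Left)
    (hi : γ₂.Irr (c.W ∪ γ₂'.V)) (hi' : γ₂'.Irr (c.W ∪ γ₂.V)) :
    Pair (c.W ∪ (γ₁'.comp γ₂').V) γ₁ γ₂ ∧ Pair (c.W ∪ (γ₁.comp γ₂).V) γ₁' γ₂' := by
  have s := t.side
  have s' := t.side'
  have g1 := g.g
  have g2 := g.g'
  have a1 := hl.valid.l_sub
  have a2 := hl'.valid.l_sub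
  simp only [Comp.l, Comp.r, Comp.W] at s s' g1 g2
  refine ⟨⟨t.left, hl.valid, s, ?_, ?_⟩, ⟨t.left', hl'.valid, s', ?_, ?_⟩⟩
  · refine (irr_congr ?_).1 hi
    ext x
    have := @g1 x
    have := @g2 x
    have := @a2 x
    simp only [Rib.comp]
    grind
  · intro x hx
    have := @g1 x
    simp only [Rib.comp] at hx
    grind
  · refine (irr_congr ?_).1 hi'
    ext x
    have := @g1 x
    have := @g2 x
    have := @a1 x
    simp only [Rib.comp]
    grind
  · intro x hx
    have := @g2 x
    simp only [Rib.comp] at hx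
    grind

theorem good_of_pairs {γ₁ γ₂ γ₁' γ₂' : Rib n} {c : Comp n}
    (hl : γ₂.Left) (hl' : γ₂'.Left)
    (p : Pair (c.W ∪ (γ₁'.comp γ₂').V) γ₁ γ₂) (p' : Pair (c.W ∪ (γ₁.comp γ₂).V) γ₁' γ₂') :
    Tri γ₁ (.ext γ₂ c γ₂') γ₁' ∧ Good γ₁ (.ext γ₂ c γ₂') γ₁' ∧ γ₂.Irr (c.W ∪ γ₂'.V) ∧
      γ₂'.Irr (c.W ∪ γ₂.V) := by
  have s := p.side
  have s' := p'.side
  have g1 := p.int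
  have g2 := p'.int
  have a1 := hl.valid.l_sub
  have a2 := hl'.valid.l_sub
  have i1 := p.irr
  have i2 := p'.irr
  simp only [Rib.comp] at g1 g2
  refine ⟨⟨p.left, p'.left, s, s'⟩, ⟨?_, ?_⟩, ?_, ?_⟩
  · intro x hx
    have := @g1 x
    simp only [Comp.W] at hx
    grind
  · intro x hx
    have := @g2 x
    simp only [Comp.W] at hx
    grind
  · refine (irr_congr ?_).1 i1
    ext x
    have := @g1 x
    have := @g2 x
    have := @a2 x
    simp only [Rib.comp]
    grind
  · refine (irr_congr ?_).1 i2
    ext x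
    have := @g1 x
    have := @g2 x
    have := @a1 x
    simp only [Rib.comp]
    grind

theorem sum_H_eq (D i : ℕ) (θ : ℕ → ℝ) (G : Graph n) {I J : Finset (Fin n)}
    (hI : I.card ≤ D) (hJ : J.card ≤ D) :
    ∑ t ∈ Hset D i I J, tval θ G t =
      ∑ t ∈ Gset D i I J, tval θ G t + ∑ t ∈ Gset D (i + 1) I J, tval θ G t := by
  rw [← sum_filter_add_sum_filter_not (Hset D i I J) (fun t => Good t.1 t.2.1 t.2.2)]
  congr 1
  symm
  refine sum_bij (fun t _ => match t with
    | (γ₁, .ext γ₂ c γ₂', γ₁') => (γ₁.comp γ₂, c, γ₁'.comp γ₂')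
    | t => t) ?_ ?_ ?_ ?_
  · rintro ⟨γ₁, c, γ₁'⟩ ht
    rw [mem_Gset] at ht
    obtain ⟨⟨hc, t, h1, h2⟩, g⟩ := ht
    cases c with
    | mid μ => exact absurd hc (by simp [InC])
    | ext γ₂ c γ₂' =>
      obtain ⟨hc, e⟩ := hc
      obtain ⟨p, p'⟩ := pairs_of_good t g e.left e.left' e.irr e.irr'
      simp only [mem_filter]
      refine ⟨mem_Hset.2 ⟨hc, ⟨p.left_iff.2 e.left, p'.left_iff.2 e.left', e.side, e.side'⟩,
        h1, h2⟩, ?_⟩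
      intro gg
      apply e.nontriv
      have L1 := p.left_iff.2 e.left
      have L2 := p'.left_iff.2 e.left'
      have q := L1.pair_triv gg.g
      have q' := L2.pair_triv gg.g'
      have u := p.unique q (by rw [L1.comp_triv])
      have u' := p'.unique q' (by rw [L2.comp_triv])
      exact ⟨u.2, u'.2⟩
  · rintro ⟨γ₁, c, γ₁'⟩ ht ⟨η₁, d, η₁'⟩ ht' heq
    rw [mem_Gset] at ht ht'
    obtain ⟨⟨hc, t, h1, h2⟩, g⟩ := ht
    obtain ⟨⟨hd, s, k1, k2⟩, g'⟩ := ht'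
    cases c with
    | mid μ => exact absurd hc (by simp [InC])
    | ext γ₂ c γ₂' =>
    cases d with
    | mid μ => exact absurd hd (by simp [InC])
    | ext η₂ d η₂' =>
      obtain ⟨hc, e⟩ := hc
      obtain ⟨hd, e'⟩ := hd
      obtain ⟨p, p'⟩ := pairs_of_good t g e.left e.left' e.irr e.irr'
      obtain ⟨q, q'⟩ := pairs_of_good s g' e'.left e'.left' e'.irr e'.irr'
      simp only [Prod.mk.injEq] at heq
      obtain ⟨b1, b2, b3⟩ := heq
      subst b2
      rw [← b3] at q
      rw [← b1] at q'
      obtain ⟨rfl, rfl⟩ := p.unique q b1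
      obtain ⟨rfl, rfl⟩ := p'.unique q' b3
      rfl
  · rintro ⟨γ, c, γ'⟩ ht
    simp only [mem_filter, mem_Hset] at ht
    obtain ⟨⟨hc, t, h1, h2⟩, ng⟩ := ht
    obtain ⟨γ₁, γ₂, p, rfl⟩ := Pair.exists (Z := c.W ∪ γ'.V) t.left.valid
    obtain ⟨γ₁', γ₂', p', rfl⟩ := Pair.exists (Z := c.W ∪ (γ₁.comp γ₂).V) t.left'.valid
    have L1 := p.left_iff.1 t.left
    have L2 := p'.left_iff.1 t.left'
    obtain ⟨t', g', i1, i2⟩ := good_of_pairs L1 L2 p p'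
    have c1 : γ₁.l = I := h1
    have c2 : γ₁'.l = J := h2
    refine ⟨(γ₁, .ext γ₂ c γ₂', γ₁'), mem_Gset.2 ⟨⟨⟨hc, ⟨L1, L2, t.side, t.side', i1, i2, ?_, ?_,
      ?_⟩⟩, t', c1, c2⟩, g'⟩, rfl⟩
    · rw [← p.side]; exact p.left.card_le.trans (c1 ▸ hI)
    · rw [← p'.side]; exact p'.left.card_le.trans (c2 ▸ hJ)
    · rintro ⟨e1, e2⟩
      apply ng
      have s1 := p.side
      have s2 := p'.side
      rw [e1] at s1
      rw [e2] at s2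
      have e1' : γ₂ = triv γ₁.r := by rw [s1]; exact e1
      have e2' : γ₂' = triv γ₁'.r := by rw [s2]; exact e2
      have w1 : γ₁.comp γ₂ = γ₁ := by rw [e1', p.left.comp_triv]
      have w2 : γ₁'.comp γ₂' = γ₁' := by rw [e2', p'.left.comp_triv]
      have i1 := p.int
      have i2 := p'.int
      rw [w2, ← p.side] at i1
      rw [w1, ← p'.side] at i2
      simp only [w1, w2]
      exact ⟨fun x hx => i1 (by grind), fun x hx => i2 (by grind)⟩
  · rintro ⟨γ₁, c, γ₁'⟩ ht
    rw [mem_Gset] at ht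
    obtain ⟨⟨hc, t, h1, h2⟩, g⟩ := ht
    cases c with
    | mid μ => exact absurd hc (by simp [InC])
    | ext γ₂ c γ₂' =>
      obtain ⟨hc, e⟩ := hc
      obtain ⟨p, p'⟩ := pairs_of_good t g e.left e.left' e.irr e.irr'
      simp only [tval, Comp.w, Comp.ch, p.lw_comp, p'.lw_comp, p.chi_comp, p'.chi_comp]
      congr 1
      · congr 1; ring
      · ring

/-- Composition of a middle piece with two left ribbons. -/
theorem sum_G_zero (D : ℕ) (θ : ℕ → ℝ) (G : Graph n) {I J : Finset (Fin n)}
    (hI : I.card ≤ D) :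
    ∑ ρ ∈ univ.filter (fun ρ : Rib n => ρ.Valid ∧ ρ.l = I ∧ ρ.r = J), θ ρ.V.card * chi G ρ.T =
      ∑ t ∈ Gset D 0 I J, tval θ G t := by
  have key : ∀ {γ μ γ' : Rib n}, μ.Middle → Tri γ (.mid μ) γ' → Good γ (.mid μ) γ' →
      Pair ∅ γ' μ.tr ∧ Pair ∅ γ (γ'.comp μ.tr).tr := by
    intro γ μ γ' hm t g
    have s := t.side
    have s' := t.side'
    have g1 := g.g
    have g2 := g.g'
    simp only [Comp.l, Comp.r, Comp.W] at s s' g1 g2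
    have p : Pair ∅ γ' μ.tr := by
      refine ⟨t.left', hm.valid.trans, s', hm.irr', ?_⟩
      intro x hx
      have := @g2 x
      simp only [Rib.tr] at *
      grind
    refine ⟨p, t.left, p.comp_valid.trans, s, ?_, ?_⟩
    · intro P R hs _
      have hs' : (γ'.comp μ.tr).Sep R P := hs.trans
      have s1 := hs'.restrict_left p.left.valid p.valid p.side
      have s2 := hs'.restrict_right p.left.valid p.valid p.side
      have m1 := p.left.min _ _ s1
      have m2 := hm.irr _ _ s2.trans (by simp)
      have hc := sep_card (γ := γ') (ρ := μ.tr) hs'.un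
      rw [p.inter_eq, inter_comm R P] at hc
      rw [inter_comm] at m2
      simp only [Rib.tr, Rib.comp] at *
      omega
    · intro x hx
      have := @g1 x
      simp only [Rib.tr, Rib.comp] at *
      grind
  symm
  refine sum_bij (fun t _ => match t with
    | (γ, .mid μ, γ') => γ.comp (γ'.comp μ.tr).tr
    | (γ, _, _) => γ) ?_ ?_ ?_ ?_
  · rintro ⟨γ, c, γ'⟩ ht
    rw [mem_Gset] at ht
    obtain ⟨⟨hc, t, h1, h2⟩, g⟩ := ht
    cases c with
    | ext _ _ _ => exact absurd hc (by simp [InC])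
    | mid μ =>
      obtain ⟨p, q⟩ := key hc.1 t g
      simp only [mem_filter, mem_univ, true_and]
      exact ⟨q.comp_valid, h1, h2⟩
  · rintro ⟨γ, c, γ'⟩ ht ⟨η, d, η'⟩ ht' heq
    rw [mem_Gset] at ht ht'
    obtain ⟨⟨hc, t, h1, h2⟩, g⟩ := ht
    obtain ⟨⟨hd, s, k1, k2⟩, g'⟩ := ht'
    cases c with
    | ext _ _ _ => exact absurd hc (by simp [InC])
    | mid μ =>
    cases d with
    | ext _ _ _ => exact absurd hd (by simp [InC])
    | mid μ' =>
      obtain ⟨p, q⟩ := key hc.1 t g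
      obtain ⟨p', q'⟩ := key hd.1 s g'
      simp only at heq
      obtain ⟨rfl, e2⟩ := q.unique q' heq
      have e2' := congrArg Rib.tr e2
      simp only [Rib.tr_tr] at e2'
      obtain ⟨rfl, e3⟩ := p.unique p' e2'
      have e3' := congrArg Rib.tr e3
      simp only [Rib.tr_tr] at e3'
      rw [e3']
  · intro ρ hρ
    simp only [mem_filter, mem_univ, true_and] at hρ
    obtain ⟨hv, h1, h2⟩ := hρ
    obtain ⟨γ, ρ₂, p, rfl⟩ := Pair.exists (Z := ∅) hv
    obtain ⟨γ', μ', q, hq⟩ := Pair.exists (Z := ∅) p.valid.trans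
    have hρ₂ : ρ₂ = (γ'.comp μ').tr := by rw [hq]; rfl
    subst hρ₂
    have hr := p.left.card_le
    have c1 : γ.l = I := h1
    have hside : γ.r = μ'.r := p.side
    have irr' : μ'.tr.Irr ∅ := by
      intro P R hs _
      have hi := q.inter_eq
      have u := hs.un
      have ul := hs.l_sub
      have ur := hs.r_sub
      have sd := q.side
      simp only [Rib.tr] at u ul ur
      have hi2 : P ∩ (R ∪ γ'.V) = P ∩ R := by
        ext x
        have := Finset.ext_iff.1 u x
        have := Finset.ext_iff.1 hi x
        have := @ur x
        grind
      have hs2 : (γ'.comp μ').tr.Sep P (R ∪ γ'.V) := by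
        refine ⟨?_, hs.l_sub, q.left.valid.l_sub.trans subset_union_right, ?_⟩
        · simp only [Rib.comp, Rib.tr]
          rw [← union_assoc, u, union_comm]
        · intro e he
          rcases mem_union.1 he with he | he
          · exact Or.inr ((q.left.valid.T_sub e he).trans subset_union_right)
          · rcases hs.edge e he with h | h
            · exact Or.inl h
            · exact Or.inr (h.trans subset_union_left)
      have := p.irr _ _ hs2 (by simp)
      rw [hi2] at this
      exact this
    have i1 := p.int
    have i2 := q.int
    have sd := q.side
    have v1 := q.valid.r_sub
    simp only [Rib.comp, Rib.tr] at i1 i2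
    refine ⟨(γ, .mid μ'.tr, γ'), mem_Gset.2 ⟨⟨⟨⟨q.valid.trans, irr', q.irr⟩, ?_⟩,
      ⟨p.left, q.left, hside, q.side⟩, h1, h2⟩, ⟨?_, ?_⟩⟩, ?_⟩
    · simp only [Rib.tr]; rw [← hside]; exact hr.trans (c1 ▸ hI)
    · intro x hx
      have := @i1 x
      simp only [Comp.W, Rib.tr] at hx
      grind
    · intro x hx
      have := @i1 x
      have := @i2 x
      have := @v1 x
      simp only [Comp.W, Rib.tr] at hx
      grind
    · simp only [Rib.tr_tr]
  · rintro ⟨γ, c, γ'⟩ ht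
    rw [mem_Gset] at ht
    obtain ⟨⟨hc, t, h1, h2⟩, g⟩ := ht
    cases c with
    | ext _ _ _ => exact absurd hc (by simp [InC])
    | mid μ =>
      obtain ⟨p, q⟩ := key hc.1 t g
      simp only [tval, Comp.w, Comp.ch, q.card_V, q.chi_comp]
      have e1 : ((γ'.comp μ.tr).tr).V.card = γ'.lw + μ.V.card := p.card_V
      have e2 : chi G ((γ'.comp μ.tr).tr).T = chi G γ'.T * chi G μ.T := p.chi_comp G
      rw [e1, e2]
      congr 1
      · congr 1; ring
      · ring

end PlantedClique
end

section
namespace PlantedClique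
variable {n : ℕ}

def Comp.depth : Comp n → ℕ
  | .mid _ => 0
  | .ext _ c _ => c.depth + 1

theorem InC.depth {D i : ℕ} {c : Comp n} (h : InC D i c) : c.depth = i := by
  induction i generalizing c with
  | zero => cases c <;> simp_all [InC, Comp.depth]
  | succ i ih =>
    cases c with
    | mid _ => simp [InC] at h
    | ext γ c γ' => simp only [InC] at h; simp [Comp.depth, ih h.1]

theorem Rib.Middle.card_eq {μ : Rib n} (h : μ.Middle) : μ.l.card = μ.r.card := by
  have h1 := h.irr μ.V μ.r ⟨union_eq_left.2 h.valid.r_sub, h.valid.l_sub, subset_rfl,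
    fun e he => Or.inl (h.valid.T_sub e he)⟩ (by simp)
  have h2 := h.irr' μ.V μ.l ⟨union_eq_left.2 h.valid.l_sub, h.valid.r_sub, subset_rfl,
    fun e he => Or.inl (h.valid.T_sub e he)⟩ (by simp)
  rw [inter_eq_right.2 h.valid.r_sub] at h1
  rw [inter_eq_right.2 h.valid.l_sub] at h2
  exact le_antisymm h1 h2

theorem InC.card {D i : ℕ} {c : Comp n} (h : InC D i c) :
    i ≤ c.l.card + c.r.card ∧ c.l.card ≤ D ∧ c.r.card ≤ D := by
  induction i generalizing c with
  | zero =>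
    cases c with
    | ext _ _ _ => simp [InC] at h
    | mid μ =>
      simp only [InC] at h
      have := h.1.card_eq
      simp only [Comp.l, Comp.r]
      exact ⟨Nat.zero_le _, h.2, this ▸ h.2⟩
  | succ i ih =>
    cases c with
    | mid _ => simp [InC] at h
    | ext γ c γ' =>
      obtain ⟨hc, e⟩ := h
      have h1 := (ih hc).1
      have h2 := e.left.card_le
      have h3 := e.left'.card_le
      refine ⟨?_, e.card, e.card'⟩
      simp only [Comp.l, Comp.r]
      rw [← e.side, ← e.side'] at h1
      by_contra hlt
      exact e.nontriv ⟨e.left.eq_triv (by omega), e.left'.eq_triv (by omega)⟩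

noncomputable def Call (n D : ℕ) : Finset (Comp n) := (range (2 * D + 1)).biUnion (CC n D)

theorem mem_Call {D : ℕ} {c : Comp n} : c ∈ Call n D ↔ InC D c.depth c := by
  simp only [Call, mem_biUnion, mem_range, mem_CC]
  constructor
  · rintro ⟨i, _, h⟩; rw [h.depth]; exact h
  · intro h
    refine ⟨_, ?_, h⟩
    have := h.card
    omega

noncomputable def Comp.sgn (c : Comp n) : ℝ := (-1) ^ c.depth

/-- kernel of a family of composites -/
noncomputable def Ker (S : Finset (Comp n)) (q : ℝ) (G : Graph n) (A B : Finset (Fin n)) : ℝ :=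
  ∑ c ∈ S.filter (fun c => c.l = A ∧ c.r = B), c.sgn * q ^ c.w * c.ch G

noncomputable def Lset (n τ : ℕ) (I : Finset (Fin n)) : Finset (Rib n) :=
  univ.filter (fun γ => γ.Left ∧ γ.l = I ∧ γ.lw ≤ τ)

noncomputable def Lm (τ : ℕ) (q : ℝ) (G : Graph n) (I A : Finset (Fin n)) : ℝ :=
  ∑ γ ∈ (Lset n τ I).filter (fun γ => γ.r = A), q ^ γ.lw * chi G γ.T

noncomputable def CQ (n D τ : ℕ) : Finset (Comp n) := (Call n D).filter (fun c => c.w ≤ τ)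

/-- error triples -/
structure ErrOK (D τ : ℕ) (γ : Rib n) (c : Comp n) (γ' : Rib n) : Prop where
  tri : Tri γ c γ'
  card : γ.l.card ≤ D
  card' : γ'.l.card ≤ D
  w1 : γ.lw ≤ τ
  w2 : c.w ≤ τ
  w3 : γ'.lw ≤ τ
  tot : τ < γ.lw + c.w + γ'.lw

noncomputable def CErr (n D τ : ℕ) : Finset (Comp n) :=
  ((univ ×ˢ Call n D ×ˢ univ).filter
      (fun t : Rib n × Comp n × Rib n => ErrOK D τ t.1 t.2.1 t.2.2)).image
      (fun t => Comp.ext t.1 t.2.1 t.2.2)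

noncomputable def theta (τ : ℕ) (q : ℝ) (k : ℕ) : ℝ := if k ≤ τ then q ^ k else 0

noncomputable def Mf (τ : ℕ) (q : ℝ) (G : Graph n) (I J : Finset (Fin n)) : ℝ :=
  ∑ ρ ∈ univ.filter (fun ρ : Rib n => ρ.Valid ∧ ρ.l = I ∧ ρ.r = J), theta τ q ρ.V.card * chi G ρ.T

theorem sum_tri {α β γ δ : Type*} [Fintype δ] [DecidableEq δ] (S₁ : Finset α) (S₂ : Finset β)
    (S₃ : Finset γ) (p : α → δ) (l r : β → δ) (p' : γ → δ) (f : α → ℝ) (g : β → ℝ) (h : γ → ℝ) :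
    ∑ A, ∑ B, (∑ x ∈ S₁.filter (fun x => p x = A), f x) *
      (∑ y ∈ S₂.filter (fun y => l y = A ∧ r y = B), g y) *
      (∑ z ∈ S₃.filter (fun z => p' z = B), h z) =
    ∑ x ∈ S₁, ∑ y ∈ S₂, ∑ z ∈ S₃, if p x = l y ∧ p' z = r y then f x * g y * h z else 0 := by
  have e1 : ∀ x y z, (if p x = l y ∧ p' z = r y then f x * g y * h z else 0) =
      (if p x = l y then f x else 0) * g y * (if p' z = r y then h z else 0) := by
    intro x y z; split_ifs <;> simp_all
  simp only [e1]
  rw [sum_comm' (t' := S₂) (s' := fun _ => S₁) (by tauto)]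
  simp only [← mul_sum, ← sum_mul, ← sum_filter]
  have e2 : ∀ A B, (∑ y ∈ S₂.filter (fun y => l y = A ∧ r y = B), g y) =
      ∑ y ∈ S₂, if l y = A then (if r y = B then g y else 0) else 0 := by
    intro A B
    rw [sum_filter]
    refine sum_congr rfl fun y _ => ?_
    split_ifs <;> simp_all
  simp only [e2]
  simp only [mul_sum, sum_mul]
  simp only [← mul_sum, ← sum_mul]
  have e3 : ∀ A B, (∑ x ∈ S₁.filter (fun x => p x = A), f x) *
      (∑ y ∈ S₂, if l y = A then (if r y = B then g y else 0) else 0) *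
      (∑ z ∈ S₃.filter (fun z => p' z = B), h z) =
      ∑ y ∈ S₂, if l y = A then (if r y = B then 
        (∑ x ∈ S₁.filter (fun x => p x = A), f x) * g y *
          (∑ z ∈ S₃.filter (fun z => p' z = B), h z) else 0) else 0 := by
    intro A B
    generalize (∑ x ∈ S₁.filter (fun x => p x = A), f x) = a
    generalize (∑ z ∈ S₃.filter (fun z => p' z = B), h z) = b
    rw [mul_sum, sum_mul]
    apply sum_congr rfl
    intro y _
    split_ifs <;> simp
  simp only [e3]
  conv_lhs => enter [2, A]; rw [sum_comm]
  rw [sum_comm]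
  refine sum_congr rfl fun y _ => ?_
  have e4 : ∀ A, (∑ B, if l y = A then (if r y = B then
        (∑ x ∈ S₁.filter (fun x => p x = A), f x) * g y *
          (∑ z ∈ S₃.filter (fun z => p' z = B), h z) else 0) else 0) =
      if l y = A then (∑ x ∈ S₁.filter (fun x => p x = A), f x) * g y *
          (∑ z ∈ S₃.filter (fun z => p' z = r y), h z) else 0 := by
    intro A
    split_ifs
    · rw [sum_ite_eq]; simp
    · simp
  simp only [e4]
  rw [sum_ite_eq]; simp

theorem sum_signed (D : ℕ) (θ : ℕ → ℝ) (G : Graph n) {I J : Finset (Fin n)}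
    (hI : I.card ≤ D) (hJ : J.card ≤ D) (k : ℕ) :
    ∑ i ∈ range k, (-1 : ℝ) ^ i * ∑ t ∈ Hset D i I J, tval θ G t =
      ∑ t ∈ Gset D 0 I J, tval θ G t - (-1) ^ k * ∑ t ∈ Gset D k I J, tval θ G t := by
  induction k with
  | zero => simp
  | succ k ih =>
    rw [sum_range_succ, ih, sum_H_eq D k θ G hI hJ, pow_succ]
    ring

theorem Gset_empty (D : ℕ) (I J : Finset (Fin n)) : Gset D (2 * D + 1) I J = ∅ := by
  refine eq_empty_of_forall_notMem ?_
  rintro ⟨γ, c, γ'⟩ h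
  have := (mem_Gset.1 h).1.1.card
  omega

theorem Mf_eq (D τ : ℕ) (q : ℝ) (G : Graph n) {I J : Finset (Fin n)}
    (hI : I.card ≤ D) (hJ : J.card ≤ D) :
    Mf τ q G I J = ∑ γ ∈ univ, ∑ c ∈ Call n D, ∑ γ' ∈ univ,
      if Tri γ c γ' ∧ γ.l = I ∧ γ'.l = J then c.sgn * tval (theta τ q) G (γ, c, γ') else 0 := by
  have h := sum_signed D (theta τ q) G hI hJ (2 * D + 1)
  rw [Gset_empty, sum_empty, mul_zero, sub_zero, ← sum_G_zero D _ G hI] at h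
  rw [Mf, ← h]
  have e1 : ∀ i, (-1 : ℝ) ^ i * ∑ t ∈ Hset D i I J, tval (theta τ q) G t =
      ∑ c ∈ CC n D i, ∑ γ ∈ univ, ∑ γ' ∈ univ,
      if Tri γ c γ' ∧ γ.l = I ∧ γ'.l = J then c.sgn * tval (theta τ q) G (γ, c, γ') else 0 := by
    intro i
    rw [Hset, mul_sum, sum_filter, sum_product, sum_congr rfl (fun γ _ => sum_product _ _ _),
      sum_comm]
    refine sum_congr rfl fun c hc => sum_congr rfl fun γ _ => sum_congr rfl fun γ' _ => ?_
    rw [Comp.sgn, (mem_CC.1 hc).depth]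
  simp only [e1]
  rw [sum_comm (s := univ), Call, sum_biUnion]
  intro i _ j _ hij
  rw [Function.onFun, Finset.disjoint_left]
  intro c h1 h2
  exact hij ((mem_CC.1 h1).depth.symm.trans (mem_CC.1 h2).depth)

/-- The main decomposition. -/
theorem decomp (D τ : ℕ) (q : ℝ) (G : Graph n) {I J : Finset (Fin n)}
    (hI : I.card ≤ D) (hJ : J.card ≤ D) :
    Mf τ q G I J = ∑ A, ∑ B, Lm τ q G I A * Ker (CQ n D τ) q G A B * Lm τ q G J B
      + Ker (CErr n D τ) q G I J := by
  rw [Mf_eq D τ q G hI hJ]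
  simp only [Lm, Ker]
  rw [sum_tri]
  have e1 : ∑ c ∈ (CErr n D τ).filter (fun c => c.l = I ∧ c.r = J), c.sgn * q ^ c.w * c.ch G =
      ∑ γ ∈ univ, ∑ c ∈ Call n D, ∑ γ' ∈ univ,
      if ErrOK D τ γ c γ' ∧ γ.l = I ∧ γ'.l = J then
        -(c.sgn * (q ^ (γ.lw + c.w + γ'.lw) * (chi G γ.T * c.ch G * chi G γ'.T))) else 0 := by
    rw [sum_filter, CErr, sum_image]
    · rw [sum_filter, sum_product, sum_congr rfl (fun γ _ => sum_product _ _ _)]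
      refine sum_congr rfl fun γ _ => sum_congr rfl fun c _ => sum_congr rfl fun γ' _ => ?_
      rw [← ite_and]
      refine if_congr Iff.rfl ?_ rfl
      simp only [Comp.sgn, Comp.depth, Comp.w, Comp.ch]
      ring
    · rintro ⟨a, b, c⟩ _ ⟨a', b', c'⟩ _ h
      simpa using h
  rw [e1]
  have e2 : ∀ F : Rib n → Comp n → Rib n → ℝ,
      ∑ γ ∈ Lset n τ I, ∑ c ∈ CQ n D τ, ∑ γ' ∈ Lset n τ J, F γ c γ' =
      ∑ γ ∈ univ, ∑ c ∈ Call n D, ∑ γ' ∈ univ, 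
        if (γ.Left ∧ γ.l = I ∧ γ.lw ≤ τ) ∧ c.w ≤ τ ∧ (γ'.Left ∧ γ'.l = J ∧ γ'.lw ≤ τ) then
          F γ c γ' else 0 := by
    intro F
    rw [Lset, sum_filter]
    refine sum_congr rfl fun γ _ => ?_
    by_cases h : γ.Left ∧ γ.l = I ∧ γ.lw ≤ τ
    · rw [if_pos h, CQ, sum_filter]
      refine sum_congr rfl fun c _ => ?_
      by_cases h2 : c.w ≤ τ
      · rw [if_pos h2, Lset, sum_filter]
        refine sum_congr rfl fun γ' _ => ?_
        simp only [h, h2, true_and, and_self]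
      · simp [h2]
    · rw [if_neg h]
      simp only [h, false_and, if_false, sum_const_zero]
  rw [e2, ← sum_add_distrib]
  refine sum_congr rfl fun γ _ => ?_
  rw [← sum_add_distrib]
  refine sum_congr rfl fun c _ => ?_
  rw [← sum_add_distrib]
  refine sum_congr rfl fun γ' _ => ?_
  by_cases hT : Tri γ c γ' ∧ γ.l = I ∧ γ'.l = J
  · rw [if_pos hT]
    obtain ⟨t, rfl, rfl⟩ := hT
    have L1 := t.left
    have L2 := t.left'
    have s1 := t.side
    have s2 := t.side'
    have e3 : ErrOK D τ γ c γ' ↔ (γ.lw ≤ τ ∧ c.w ≤ τ ∧ γ'.lw ≤ τ) ∧ τ < γ.lw + c.w + γ'.lw :=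
      ⟨fun h => ⟨⟨h.w1, h.w2, h.w3⟩, h.tot⟩, fun h => ⟨t, hI, hJ, h.1.1, h.1.2.1, h.1.2.2, h.2⟩⟩
    simp only [L1, L2, s1, s2, e3, true_and, and_true, and_self, if_true, tval, theta]
    by_cases hw : γ.lw + c.w + γ'.lw ≤ τ
    · have h1 : γ.lw ≤ τ := by omega
      have h2 : c.w ≤ τ := by omega
      have h3 : γ'.lw ≤ τ := by omega
      have h4 : ¬ τ < γ.lw + c.w + γ'.lw := by omega
      simp only [hw, h1, h2, h3, h4, and_true, and_false, if_true, if_false]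
      ring
    · have h4 : τ < γ.lw + c.w + γ'.lw := by omega
      simp only [hw, h4, and_true, if_false]
      split_ifs
      · ring
      · ring
  · rw [if_neg hT]
    have e3 : ¬ (ErrOK D τ γ c γ' ∧ γ.l = I ∧ γ'.l = J) := fun h => hT ⟨h.1.tri, h.2⟩
    rw [if_neg e3]
    split_ifs with h1 h2
    · exact absurd ⟨⟨h1.1.1, h1.2.2.1, h2.1, h2.2⟩, h1.1.2.1, h1.2.2.2.1⟩ hT
    · simp
    · simp

end PlantedClique
end

section
namespace PlantedClique
variable {n : ℕ}

/-! ### Symmetry -/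

theorem Comp.tr_tr (c : Comp n) : c.tr.tr = c := by
  induction c with
  | mid μ => rfl
  | ext γ c γ' ih => simp [Comp.tr, ih]
theorem Comp.tr_l (c : Comp n) : c.tr.l = c.r := by cases c <;> rfl
theorem Comp.tr_r (c : Comp n) : c.tr.r = c.l := by cases c <;> rfl
theorem Comp.tr_W (c : Comp n) : c.tr.W = c.W := by
  induction c with
  | mid μ => rfl
  | ext γ c γ' ih =>
    simp only [Comp.tr, Comp.W, ih]
    ext x; simp only [mem_union]; tauto
theorem Comp.tr_w (c : Comp n) : c.tr.w = c.w := by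
  induction c with
  | mid μ => rfl
  | ext γ c γ' ih => simp only [Comp.tr, Comp.w, ih]; ring
theorem Comp.tr_depth (c : Comp n) : c.tr.depth = c.depth := by
  induction c with
  | mid μ => rfl
  | ext γ c γ' ih => simp only [Comp.tr, Comp.depth, ih]
theorem Comp.tr_ch (G : Graph n) (c : Comp n) : c.tr.ch G = c.ch G := by
  induction c with
  | mid μ => rfl
  | ext γ c γ' ih => simp only [Comp.tr, Comp.ch, ih]; ring

theorem ExtOK.trans {D : ℕ} {γ γ' : Rib n} {c : Comp n} (h : ExtOK D γ c γ') :
    ExtOK D γ' c.tr γ := by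
  refine ⟨h.left', h.left, ?_, ?_, ?_, ?_, h.card', h.card, fun hh => h.nontriv hh.symm⟩
  · rw [Comp.tr_l]; exact h.side'
  · rw [Comp.tr_r]; exact h.side
  · rw [Comp.tr_W]; exact h.irr'
  · rw [Comp.tr_W]; exact h.irr

theorem InC.trans {D i : ℕ} {c : Comp n} (h : InC D i c) : InC D i c.tr := by
  induction i generalizing c with
  | zero =>
    cases c with
    | ext _ _ _ => simp [InC] at h
    | mid μ =>
      simp only [InC] at h
      refine ⟨⟨h.1.valid.trans, h.1.irr', h.1.irr⟩, ?_⟩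
      have := h.1.card_eq
      simp only [Rib.tr]
      omega
  | succ i ih =>
    cases c with
    | mid _ => simp [InC] at h
    | ext γ c γ' => exact ⟨ih h.1, h.2.trans⟩

theorem Ker_symm {S : Finset (Comp n)} (hS : ∀ c ∈ S, c.tr ∈ S) (q : ℝ) (G : Graph n)
    (A B : Finset (Fin n)) : Ker S q G A B = Ker S q G B A := by
  simp only [Ker]
  refine sum_bij' (fun c _ => c.tr) (fun c _ => c.tr) ?_ ?_ ?_ ?_ ?_
  · intro c hc
    rw [mem_filter] at hc ⊢
    rw [Comp.tr_l, Comp.tr_r]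
    exact ⟨hS c hc.1, hc.2.2, hc.2.1⟩
  · intro c hc
    rw [mem_filter] at hc ⊢
    rw [Comp.tr_l, Comp.tr_r]
    exact ⟨hS c hc.1, hc.2.2, hc.2.1⟩
  · intro c _; exact c.tr_tr
  · intro c _; exact c.tr_tr
  · intro c _
    simp only [Comp.sgn, Comp.tr_depth, Comp.tr_w, Comp.tr_ch]

theorem Call_tr {D : ℕ} {c : Comp n} (h : c ∈ Call n D) : c.tr ∈ Call n D := by
  rw [mem_Call] at h ⊢
  rw [Comp.tr_depth]; exact h.trans

theorem mem_CErr {D τ : ℕ} {c : Comp n} : c ∈ CErr n D τ ↔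
    ∃ γ c' γ', c = .ext γ c' γ' ∧ c' ∈ Call n D ∧ ErrOK D τ γ c' γ' := by
  simp only [CErr, mem_image, mem_filter, mem_product, mem_univ, true_and, and_true, Prod.exists]
  constructor
  · rintro ⟨a, b, c, ⟨h1, h2⟩, rfl⟩; exact ⟨a, b, c, rfl, h1, h2⟩
  · rintro ⟨a, b, c, rfl, h1, h2⟩; exact ⟨a, b, c, ⟨h1, h2⟩, rfl⟩

theorem CErr_tr {D τ : ℕ} {c : Comp n} (h : c ∈ CErr n D τ) : c.tr ∈ CErr n D τ := by
  rw [mem_CErr] at h ⊢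
  obtain ⟨γ, c, γ', rfl, h1, h2⟩ := h
  refine ⟨γ', c.tr, γ, rfl, Call_tr h1, ⟨⟨h2.tri.left', h2.tri.left, ?_, ?_⟩, h2.card', h2.card,
    h2.w3, ?_, h2.w1, ?_⟩⟩
  · rw [Comp.tr_l]; exact h2.tri.side'
  · rw [Comp.tr_r]; exact h2.tri.side
  · rw [Comp.tr_w]; exact h2.w2
  · rw [Comp.tr_w]; have := h2.tot; omega

/-! ### Toggling an edge -/

noncomputable def tog (e : Edge n) (T : Finset (Edge n)) : Finset (Edge n) :=
  if e ∈ T then T.erase e else insert e T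

theorem mem_tog {e f : Edge n} {T : Finset (Edge n)} (h : f ≠ e) : f ∈ tog e T ↔ f ∈ T := by
  unfold tog; split_ifs <;> simp [h]

theorem mem_tog_self {e : Edge n} {T : Finset (Edge n)} : e ∈ tog e T ↔ e ∉ T := by
  unfold tog; split_ifs <;> simp [*]

theorem tog_tog (e : Edge n) (T : Finset (Edge n)) : tog e (tog e T) = T := by
  ext f
  by_cases h : f = e
  · subst h; rw [mem_tog_self, mem_tog_self, not_not]
  · rw [mem_tog h, mem_tog h]

theorem tog_ne (e : Edge n) (T : Finset (Edge n)) : tog e T ≠ T := by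
  intro h
  have := @mem_tog_self n e T
  rw [h] at this
  tauto

theorem chi_tog {G : Graph n} {e : Edge n} (he : G e = false) (T : Finset (Edge n)) :
    chi G (tog e T) = - chi G T := by
  unfold chi tog
  split_ifs with h
  · rw [← mul_prod_erase T _ h]; simp [he]
  · rw [prod_insert h]; simp [he]

noncomputable def Rib.tog (e : Edge n) (ρ : Rib n) : Rib n := { ρ with T := PlantedClique.tog e ρ.T }

theorem Rib.tog_tog (e : Edge n) (ρ : Rib n) : (ρ.tog e).tog e = ρ :=
  Rib.ext' rfl rfl rfl (PlantedClique.tog_tog e ρ.T)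

theorem Rib.Valid.tog {ρ : Rib n} (h : ρ.Valid) {e : Edge n} (he : supp e ⊆ ρ.l) :
    (ρ.tog e).Valid := by
  refine ⟨h.l_sub, h.r_sub, ?_, ?_⟩
  · intro f hf
    by_cases hfe : f = e
    · subst hfe; exact he.trans h.l_sub
    · exact h.T_sub f ((mem_tog hfe).1 hf)
  · intro v hv hl hr
    obtain ⟨f, hf, hvf⟩ := h.cov v hv hl hr
    refine ⟨f, (mem_tog ?_).2 hf, hvf⟩
    rintro rfl
    exact hl (he hvf)

theorem Rib.sep_tog {ρ : Rib n} {e : Edge n} (he : supp e ⊆ ρ.l) {X Y : Finset (Fin n)} :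
    (ρ.tog e).Sep X Y ↔ ρ.Sep X Y := by
  constructor
  · intro h
    refine ⟨h.un, h.l_sub, h.r_sub, fun f hf => ?_⟩
    by_cases hfe : f = e
    · subst hfe; exact Or.inl (he.trans h.l_sub)
    · exact h.edge f ((mem_tog hfe).2 hf)
  · intro h
    refine ⟨h.un, h.l_sub, h.r_sub, fun f hf => ?_⟩
    by_cases hfe : f = e
    · subst hfe; exact Or.inl (he.trans h.l_sub)
    · exact h.edge f ((mem_tog hfe).1 hf)

theorem Rib.irr_tog {ρ : Rib n} {e : Edge n} (he : supp e ⊆ ρ.l) {Z : Finset (Fin n)} :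
    (ρ.tog e).Irr Z ↔ ρ.Irr Z := by
  simp only [Rib.Irr, Rib.sep_tog he]; rfl

theorem Rib.irr_tr_tog {ρ : Rib n} {e : Edge n} (he : supp e ⊆ ρ.l) {Z : Finset (Fin n)} :
    (ρ.tog e).tr.Irr Z ↔ ρ.tr.Irr Z := by
  have : ∀ X Y, (ρ.tog e).tr.Sep X Y ↔ ρ.tr.Sep X Y := fun X Y =>
    ⟨fun h => ((sep_tog he).1 h.trans).trans, fun h => ((sep_tog he).2 h.trans).trans⟩
  simp only [Rib.Irr, this]; rfl

theorem Rib.Left.tog {ρ : Rib n} (h : ρ.Left) {e : Edge n} (he : supp e ⊆ ρ.l)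
    (hr : ¬ supp e ⊆ ρ.r) : (ρ.tog e).Left := by
  refine ⟨h.valid.tog he, ?_, ?_, ?_⟩
  · intro f hf
    by_cases hfe : f = e
    · subst hfe; exact hr
    · exact h.noedge f ((mem_tog hfe).1 hf)
  · intro X Y hs; exact h.min X Y ((sep_tog he).1 hs)
  · intro X Y hs; exact h.uniq X Y ((sep_tog he).1 hs)

noncomputable def Comp.tog (e : Edge n) : Comp n → Comp n
  | .mid μ => .mid (μ.tog e)
  | .ext γ c γ' => if supp e ⊆ γ.r then .ext γ (c.tog e) γ' else .ext (γ.tog e) c γ'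

theorem Comp.tog_props (e : Edge n) (c : Comp n) : (c.tog e).l = c.l ∧ (c.tog e).r = c.r ∧
    (c.tog e).W = c.W ∧ (c.tog e).w = c.w ∧ (c.tog e).depth = c.depth ∧ (c.tog e).tog e = c ∧
    c.tog e ≠ c := by
  induction c with
  | mid μ =>
    refine ⟨rfl, rfl, rfl, rfl, rfl, ?_, ?_⟩
    · simp only [Comp.tog, Rib.tog_tog]
    · intro h
      simp only [Comp.tog, Comp.mid.injEq] at h
      exact tog_ne _ _ (congrArg Rib.T h)
  | ext γ c γ' ih =>
    obtain ⟨h1, h2, h3, h4, h5, h6, h7⟩ := ih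
    by_cases h : supp e ⊆ γ.r
    · simp only [Comp.tog, if_pos h, Comp.l, Comp.r, Comp.W, Comp.w, Comp.depth, h3, h4, h5, h6]
      simp [h7]
    · have h' : ¬ supp e ⊆ (γ.tog e).r := h
      have h8 : γ.tog e ≠ γ := fun hh => tog_ne _ _ (congrArg Rib.T hh)
      simp only [Comp.tog, if_neg h, if_neg h', Comp.l, Comp.r, Comp.W, Comp.w, Comp.depth,
        Rib.tog_tog]
      refine ⟨rfl, trivial, rfl, rfl, trivial, trivial, ?_⟩
      intro hh
      exact h8 (Comp.ext.inj hh).1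

theorem Comp.tog_ch {G : Graph n} {e : Edge n} (he : G e = false) (c : Comp n) :
    (c.tog e).ch G = - c.ch G := by
  induction c with
  | mid μ => exact chi_tog he _
  | ext γ c γ' ih =>
    by_cases h : supp e ⊆ γ.r
    · simp only [Comp.tog, if_pos h, Comp.ch, ih]; ring
    · simp only [Comp.tog, if_neg h, Comp.ch, Rib.tog, chi_tog he]; ring

theorem InC.tog {D i : ℕ} {c : Comp n} (h : InC D i c) {e : Edge n} (he : supp e ⊆ c.l) :
    InC D i (c.tog e) := by
  induction i generalizing c with
  | zero =>
    cases c with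
    | ext _ _ _ => simp [InC] at h
    | mid μ =>
      exact ⟨⟨h.1.valid.tog he, (Rib.irr_tog he).2 h.1.irr, (Rib.irr_tr_tog he).2 h.1.irr'⟩, h.2⟩
  | succ i ih =>
    cases c with
    | mid _ => simp [InC] at h
    | ext γ c γ' =>
      obtain ⟨hc, x⟩ := h
      by_cases hr : supp e ⊆ γ.r
      · simp only [Comp.tog, if_pos hr]
        obtain ⟨h1, h2, h3, h4, h5, h6, h7⟩ := c.tog_props e
        refine ⟨ih hc (x.side ▸ hr), ⟨x.left, x.left', ?_, ?_, ?_, ?_, x.card, x.card', x.nontriv⟩⟩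
        · rw [h1]; exact x.side
        · rw [h2]; exact x.side'
        · rw [h3]; exact x.irr
        · rw [h3]; exact x.irr'
      · simp only [Comp.tog, if_neg hr]
        refine ⟨hc, ⟨x.left.tog he hr, x.left', x.side, x.side', (Rib.irr_tog he).2 x.irr, x.irr',
          x.card, x.card', ?_⟩⟩
        rintro ⟨h1, -⟩
        apply hr
        have : γ.l = γ.r := congrArg Rib.l h1
        rw [← this]; exact he

theorem exists_nonedge {G : Graph n} {A : Finset (Fin n)} (h : ¬ IsClique G A) :
    ∃ e : Edge n, supp e ⊆ A ∧ G e = false := by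
  unfold IsClique at h
  push Not at h
  obtain ⟨i, hi, j, hj, hij, hne⟩ := h
  refine ⟨⟨s(i, j), by simpa using hij⟩, ?_, ?_⟩
  · intro v hv
    simp only [supp, mem_filter, mem_univ, true_and, Sym2.mem_iff] at hv
    rcases hv with rfl | rfl <;> assumption
  · by_contra hc
    exact hne ⟨_, rfl, by simpa using hc⟩

theorem Ker_CQ_zero {D τ : ℕ} {q : ℝ} {G : Graph n} {A B : Finset (Fin n)}
    (h : ¬ IsClique G A) : Ker (CQ n D τ) q G A B = 0 := by
  obtain ⟨e, he, hG⟩ := exists_nonedge h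
  refine sum_involution (fun c _ => c.tog e) ?_ ?_ ?_ ?_
  · intro c _
    obtain ⟨h1, h2, h3, h4, h5, h6, h7⟩ := c.tog_props e
    simp only [Comp.sgn, h4, h5, Comp.tog_ch hG]
    ring
  · intro c _ _; exact (c.tog_props e).2.2.2.2.2.2
  · intro c hc
    obtain ⟨h1, h2, h3, h4, h5, h6, h7⟩ := c.tog_props e
    simp only [CQ, mem_filter, mem_Call, h1, h2, h4, h5] at hc ⊢
    exact ⟨⟨hc.1.1.tog (hc.2.1 ▸ he), hc.1.2⟩, hc.2⟩
  · intro c _; exact (c.tog_props e).2.2.2.2.2.1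

/-! ### The function f -/

noncomputable def VT (T : Finset (Edge n)) : Finset (Fin n) := T.biUnion supp

noncomputable def fS (τ : ℕ) (q : ℝ) (G : Graph n) (S : Finset (Fin n)) : ℝ :=
  ∑ T : Finset (Edge n), theta τ q (VT T ∪ S).card * chi G T

theorem fS_zero {τ : ℕ} {q : ℝ} {G : Graph n} {S : Finset (Fin n)} (h : ¬ IsClique G S) :
    fS τ q G S = 0 := by
  obtain ⟨e, he, hG⟩ := exists_nonedge h
  refine sum_involution (fun T _ => tog e T) ?_ ?_ ?_ ?_
  · intro T _
    have : VT (tog e T) ∪ S = VT T ∪ S := by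
      ext v
      simp only [VT, mem_union, mem_biUnion]
      by_cases hv : v ∈ S
      · simp [hv]
      · simp only [hv, or_false]
        have hve : v ∉ supp e := fun h => hv (he h)
        constructor
        · rintro ⟨f, hf, hvf⟩
          exact ⟨f, (mem_tog (by rintro rfl; exact hve hvf)).1 hf, hvf⟩
        · rintro ⟨f, hf, hvf⟩
          exact ⟨f, (mem_tog (by rintro rfl; exact hve hvf)).2 hf, hvf⟩
    rw [this, chi_tog hG]; ring
  · intro T _ _; exact tog_ne _ _
  · intro T _; exact mem_univ _
  · intro T _; exact tog_tog _ _

theorem Mf_eq_fS (τ : ℕ) (q : ℝ) (G : Graph n) (I J : Finset (Fin n)) :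
    Mf τ q G I J = fS τ q G (I ∪ J) := by
  have hV : ∀ ρ : Rib n, ρ.Valid → VT ρ.T ∪ (ρ.l ∪ ρ.r) = ρ.V := by
    intro ρ h
    ext v
    simp only [VT, mem_union, mem_biUnion]
    constructor
    · rintro (⟨e, he, hv⟩ | h1 | h1)
      · exact h.T_sub e he hv
      · exact h.l_sub h1
      · exact h.r_sub h1
    · intro hv
      have := h.cov v hv
      by_cases h1 : v ∈ ρ.l
      · exact Or.inr (Or.inl h1)
      · by_cases h2 : v ∈ ρ.r
        · exact Or.inr (Or.inr h2)
        · exact Or.inl (this h1 h2)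
  refine sum_bij' (fun ρ _ => ρ.T) (fun T _ => ⟨I, J, VT T ∪ (I ∪ J), T⟩) ?_ ?_ ?_ ?_ ?_
  · intro ρ _; exact mem_univ _
  · intro T _
    simp only [mem_filter, mem_univ, true_and, and_true]
    refine ⟨?_, ?_, ?_, ?_⟩
    · exact subset_union_left.trans subset_union_right
    · exact subset_union_right.trans subset_union_right
    · intro e he
      exact (subset_biUnion_of_mem supp he).trans subset_union_left
    · intro v hv h1 h2
      simp only [VT, mem_union, mem_biUnion] at hv h1 h2
      tauto
  · intro ρ hρ
    simp only [mem_filter, mem_univ, true_and] at hρ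
    obtain ⟨h, rfl, rfl⟩ := hρ
    exact Rib.ext' rfl rfl (hV ρ h) rfl
  · intro T _; rfl
  · intro ρ hρ
    simp only [mem_filter, mem_univ, true_and] at hρ
    obtain ⟨h, rfl, rfl⟩ := hρ
    rw [hV ρ h]

/-! ### The diagonal part -/

/-- edges inside a set -/
noncomputable def EE (A : Finset (Fin n)) : Finset (Edge n) := univ.filter (fun e => supp e ⊆ A)

def Comp.IsTriv (c : Comp n) : Prop := ∃ A T, c = .mid ⟨A, A, A, T⟩

noncomputable def CN (n D τ : ℕ) : Finset (Comp n) := (CQ n D τ).filter (fun c => ¬ c.IsTriv)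

theorem CN_tr {D τ : ℕ} {c : Comp n} (h : c ∈ CN n D τ) : c.tr ∈ CN n D τ := by
  simp only [CN, CQ, mem_filter] at h ⊢
  refine ⟨⟨Call_tr h.1.1, by rw [Comp.tr_w]; exact h.1.2⟩, ?_⟩
  rintro ⟨A, T, hA⟩
  apply h.2
  refine ⟨A, T, ?_⟩
  rw [← c.tr_tr, hA]; rfl

theorem mid_triv_middle (A : Finset (Fin n)) {T : Finset (Edge n)} (hT : T ⊆ EE A) :
    (⟨A, A, A, T⟩ : Rib n).Middle := by
  refine ⟨⟨subset_rfl, subset_rfl, ?_, ?_⟩, ?_, ?_⟩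
  · intro e he; exact (mem_filter.1 (hT he)).2
  · intro v hv h; exact absurd hv h
  · intro X Y h _; exact card_le_card (subset_inter h.l_sub h.r_sub)
  · intro X Y h _; exact card_le_card (subset_inter h.l_sub h.r_sub)

theorem chi_eq_one {G : Graph n} {A : Finset (Fin n)} (h : IsClique G A) {e : Edge n}
    (he : supp e ⊆ A) : G e = true := by
  obtain ⟨e, hd⟩ := e
  induction e using Sym2.ind with
  | _ i j =>
    have hi : i ∈ A := he (by simp [supp])
    have hj : j ∈ A := he (by simp [supp])
    obtain ⟨e', h1, h2⟩ := h i hi j hj (by simpa using hd)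
    rw [← h2]; congr 1; exact Subtype.ext h1.symm

theorem Ker_CQ_split (D τ : ℕ) (q : ℝ) (G : Graph n) (A B : Finset (Fin n)) :
    Ker (CQ n D τ) q G A B = (if A = B ∧ A.card ≤ D ∧ A.card ≤ τ ∧ IsClique G A then
      q ^ A.card * 2 ^ (EE A).card else 0) + 
      (if IsClique G A ∧ IsClique G B then Ker (CN n D τ) q G A B else 0) := by
  by_cases hA : IsClique G A
  swap
  · rw [Ker_CQ_zero hA]; simp [hA]
  by_cases hB : IsClique G B
  swap
  · rw [Ker_symm (fun c hc => ?_), Ker_CQ_zero hB]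
    · have : ¬ (A = B ∧ A.card ≤ D ∧ A.card ≤ τ ∧ IsClique G A) := by
        rintro ⟨rfl, _, _, h⟩; exact hB h
      rw [if_neg this]; simp [hB]
    · simp only [CQ, mem_filter] at hc ⊢
      exact ⟨Call_tr hc.1, by rw [Comp.tr_w]; exact hc.2⟩
  rw [if_pos (show IsClique G A ∧ IsClique G B from ⟨hA, hB⟩)]
  simp only [Ker]
  rw [← sum_filter_add_sum_filter_not ((CQ n D τ).filter _) (fun c => c.IsTriv)]
  congr 1
  · by_cases h : A = B ∧ A.card ≤ D ∧ A.card ≤ τ ∧ IsClique G A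
    · rw [if_pos h]
      obtain ⟨rfl, hD, hτ, _⟩ := h
      have : ∀ T ∈ (EE A).powerset, q ^ A.card * (1:ℝ) = (Comp.mid ⟨A, A, A, T⟩).sgn *
          q ^ (Comp.mid ⟨A, A, A, T⟩).w * (Comp.mid ⟨A, A, A, T⟩).ch G := by
        intro T hT
        have : chi G T = 1 := by
          refine prod_eq_one fun e he => ?_
          rw [chi_eq_one hA (mem_filter.1 (mem_powerset.1 hT he)).2]; simp
        simp [Comp.sgn, Comp.depth, Comp.w, Comp.ch, this]
      have h2 : q ^ A.card * 2 ^ (EE A).card = ∑ T ∈ (EE A).powerset, q ^ A.card * (1:ℝ) := by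
        rw [sum_const, card_powerset]; simp; ring
      rw [h2, sum_congr rfl this]
      symm
      refine sum_bij (fun T _ => Comp.mid ⟨A, A, A, T⟩) ?_ ?_ ?_ ?_
      · intro T hT
        simp only [CQ, mem_filter, mem_Call, Comp.depth, InC]
        exact ⟨⟨⟨⟨mid_triv_middle A (mem_powerset.1 hT), hD⟩, hτ⟩, rfl, rfl⟩, A, T, rfl⟩
      · intro T _ T' _ h
        simpa using h
      · rintro c hc
        simp only [CQ, mem_filter, mem_Call] at hc
        obtain ⟨⟨⟨h1, h2⟩, h3, h4⟩, B, T, rfl⟩ := hc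
        simp only [Comp.l] at h3
        subst h3
        refine ⟨T, ?_, rfl⟩
        rw [mem_powerset]
        intro e he
        exact mem_filter.2 ⟨mem_univ _, h1.1.valid.T_sub e he⟩
      · intro T _; rfl
    · rw [if_neg h]
      refine sum_eq_zero fun c hc => absurd ?_ h
      simp only [CQ, mem_filter, mem_Call] at hc
      obtain ⟨⟨⟨h1, h2⟩, h3, h4⟩, A', T, rfl⟩ := hc
      simp only [Comp.l, Comp.r] at h3 h4
      subst h3
      exact ⟨h4, h1.2, h2, hA⟩
  · refine sum_congr ?_ fun _ _ => rfl
    ext c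
    simp only [CN, mem_filter]
    tauto

/-! ### The matrix L -/

theorem triv_mem_Lset (τ : ℕ) (I : Finset (Fin n)) : triv I ∈ Lset n τ I := by
  refine mem_filter.2 ⟨mem_univ _, triv_left I, rfl, ?_⟩
  simp [triv, Rib.lw]

theorem Lm_of_card_le {τ : ℕ} {q : ℝ} {G : Graph n} {I A : Finset (Fin n)} (h : I.card ≤ A.card) :
    Lm τ q G I A = if A = I then 1 else 0 := by
  split_ifs with hA
  · subst hA
    have : (Lset n τ A).filter (fun γ => γ.r = A) = {triv A} := by
      ext γ
      simp only [mem_filter, mem_singleton]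
      constructor
      · rintro ⟨h1, h2⟩
        simp only [Lset, mem_filter, mem_univ, true_and] at h1
        obtain ⟨h1, h3, h4⟩ := h1
        have := h1.eq_triv (by rw [h2, h3])
        rw [h2] at this; exact this
      · rintro rfl
        exact ⟨triv_mem_Lset τ A, rfl⟩
    rw [Lm, this, sum_singleton]
    simp [triv, Rib.lw, chi]
  · refine sum_eq_zero fun γ hγ => absurd ?_ hA
    simp only [Lset, mem_filter, mem_univ, true_and] at hγ
    obtain ⟨⟨h1, h3, h4⟩, h2⟩ := hγ
    have := h1.eq_triv (by rw [h2, h3]; exact h)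
    rw [← h2, ← h3, this]; rfl

end PlantedClique
end

section
namespace PlantedClique
variable {n : ℕ}

def Rib.e2 (ρ : Rib n) : ℕ := (ρ.V.card - ρ.l.card) + (ρ.V.card - ρ.r.card)

namespace Comp
noncomputable def cnt (e : Edge n) : Comp n → ℕ
  | mid μ => if e ∈ μ.T then 1 else 0
  | ext γ c γ' => (if e ∈ γ.T then 1 else 0) + c.cnt e + (if e ∈ γ'.T then 1 else 0)
def e2 : Comp n → ℕ
  | mid μ => μ.e2
  | ext γ c γ' => γ.e2 + c.e2 + γ'.e2
end Comp

/-- Relaxed family of composites with bounded pieces. -/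
def InX (R : ℕ) : ℕ → Comp n → Prop
  | 0, .mid μ => μ.Valid ∧ μ.V.card ≤ R
  | 0, .ext _ _ _ => False
  | _ + 1, .mid _ => False
  | i + 1, .ext γ c γ' => InX R i c ∧ Tri γ c γ' ∧ γ.V.card ≤ R ∧ γ'.V.card ≤ R

/-- basic support facts -/
structure Comp.Basic (c : Comp n) : Prop where
  l_sub : c.l ⊆ c.W
  r_sub : c.r ⊆ c.W
  edge : ∀ e, c.cnt e ≠ 0 → supp e ⊆ c.W

theorem InX.basic {R i : ℕ} {c : Comp n} (h : InX R i c) : c.Basic := by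
  induction i generalizing c with
  | zero =>
    cases c with
    | ext _ _ _ => simp [InX] at h
    | mid μ =>
      refine ⟨h.1.l_sub, h.1.r_sub, ?_⟩
      intro e he
      simp only [Comp.cnt, ne_eq, ite_eq_right_iff, not_forall] at he
      exact h.1.T_sub e he.1
  | succ i ih =>
    cases c with
    | mid _ => simp [InX] at h
    | ext γ c γ' =>
      obtain ⟨hc, t, -, -⟩ := h
      have b := ih hc
      refine ⟨?_, ?_, ?_⟩
      · exact t.left.valid.l_sub.trans (subset_union_left.trans subset_union_left)
      · exact t.left'.valid.l_sub.trans subset_union_right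
      · intro e he
        simp only [Comp.cnt] at he
        by_cases h1 : e ∈ γ.T
        · exact (t.left.valid.T_sub e h1).trans (subset_union_left.trans subset_union_left)
        by_cases h2 : e ∈ γ'.T
        · exact (t.left'.valid.T_sub e h2).trans subset_union_right
        simp only [h1, h2, if_false] at he
        exact (b.edge e (by omega)).trans (subset_union_right.trans subset_union_left)

theorem InX.card_W {R i : ℕ} {c : Comp n} (h : InX R i c) : c.W.card ≤ (2 * i + 1) * R := by
  induction i generalizing c with
  | zero =>
    cases c with
    | ext _ _ _ => simp [InX] at h
    | mid μ => simpa [Comp.W] using h.2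
  | succ i ih =>
    cases c with
    | mid _ => simp [InX] at h
    | ext γ c γ' =>
      obtain ⟨hc, t, h1, h2⟩ := h
      have := ih hc
      simp only [Comp.W]
      have a := card_union_le (γ.V ∪ c.W) γ'.V
      have b := card_union_le γ.V c.W
      nlinarith

theorem InC.inX {D i τ : ℕ} {c : Comp n} (h : InC D i c) (hw : c.w ≤ τ) : InX (τ + D) i c := by
  induction i generalizing c with
  | zero =>
    cases c with
    | ext _ _ _ => simp [InC] at h
    | mid μ => 
      simp only [Comp.w] at hw
      exact ⟨h.1.valid, by omega⟩
  | succ i ih =>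
    cases c with
    | mid _ => simp [InC] at h
    | ext γ c γ' =>
      obtain ⟨hc, e⟩ := h
      simp only [Comp.w] at hw
      have h1 := e.left.card_le
      have h2 := e.left'.card_le
      have h3 := e.card
      have h4 := e.card'
      simp only [Rib.lw] at hw
      exact ⟨ih hc (by omega), ⟨e.left, e.left', e.side, e.side'⟩, by omega, by omega⟩

/-- The separation inequality. -/
def SepIneq (k : ℕ) (c : Comp n) : Prop :=
  ∀ P F : Finset (Fin n), c.l ⊆ P → c.r ⊆ F →
    (∀ e, c.cnt e = 1 → supp e ⊆ P ∨ supp e ⊆ F) →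
    2 * ((c.W \ P).card + (c.W \ F).card) ≤ c.e2 + k

theorem rib_sep {ρ : Rib n} (hρ : ρ.Valid) {P F : Finset (Fin n)} (hl : ρ.l ⊆ P) (hr : ρ.r ⊆ F)
    (he : ∀ e ∈ ρ.T, supp e ⊆ P ∨ supp e ⊆ F) :
    ρ.Sep (ρ.V ∩ P) (ρ.V ∩ F) ∧ (ρ.V \ P).card + (ρ.V \ F).card +
      ((ρ.V ∩ P) ∩ (ρ.V ∩ F)).card = ρ.V.card := by
  have hs : ρ.Sep (ρ.V ∩ P) (ρ.V ∩ F) := by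
    refine ⟨?_, subset_inter hρ.l_sub hl, subset_inter hρ.r_sub hr, ?_⟩
    · ext v
      simp only [mem_union, mem_inter]
      constructor
      · tauto
      · intro hv
        by_cases h1 : v ∈ ρ.l
        · exact Or.inl ⟨hv, hl h1⟩
        by_cases h2 : v ∈ ρ.r
        · exact Or.inr ⟨hv, hr h2⟩
        obtain ⟨e, h3, h4⟩ := hρ.cov v hv h1 h2
        rcases he e h3 with h | h
        · exact Or.inl ⟨hv, h h4⟩
        · exact Or.inr ⟨hv, h h4⟩
    · intro e h
      exact (he e h).imp (fun h' => subset_inter (hρ.T_sub e h) h')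
        (fun h' => subset_inter (hρ.T_sub e h) h')
  refine ⟨hs, ?_⟩
  have h1 := card_union_add_card_inter (ρ.V ∩ P) (ρ.V ∩ F)
  rw [hs.un] at h1
  have h2 := card_sdiff_add_card_inter ρ.V P
  have h3 := card_sdiff_add_card_inter ρ.V F
  omega

theorem left_irr_ineq {γ : Rib n} (h : γ.Left) {Z : Finset (Fin n)} (hi : γ.Irr Z)
    {P F : Finset (Fin n)} (hl : γ.l ⊆ P) (hr : γ.r ⊆ F) (hZ : Z ⊆ F)
    (he : ∀ e ∈ γ.T, supp e ⊆ P ∨ supp e ⊆ F) :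
    2 * ((γ.V \ P).card + (γ.V \ F).card) ≤ γ.e2 := by
  obtain ⟨hs, hc⟩ := rib_sep h.valid hl hr he
  have h1 := hi _ _ hs (inter_subset_inter_left hZ)
  have h2 := h.card_le
  simp only [Rib.e2]
  omega

theorem left_ineq {γ : Rib n} (h : γ.Left) {D : ℕ} (hD : γ.l.card ≤ D)
    {P F : Finset (Fin n)} (hl : γ.l ⊆ P) (hr : γ.r ⊆ F)
    (he : ∀ e ∈ γ.T, supp e ⊆ P ∨ supp e ⊆ F) :
    2 * ((γ.V \ P).card + (γ.V \ F).card) ≤ γ.e2 + D := by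
  obtain ⟨hs, hc⟩ := rib_sep h.valid hl hr he
  have h1 := h.min _ _ hs
  have h2 := h.card_le
  have := card_le_card h.valid.l_sub
  simp only [Rib.e2]
  omega

theorem mid_ineq {μ : Rib n} (h : μ.Middle)
    {P F : Finset (Fin n)} (hl : μ.l ⊆ P) (hr : μ.r ⊆ F)
    (he : ∀ e ∈ μ.T, supp e ⊆ P ∨ supp e ⊆ F) :
    2 * ((μ.V \ P).card + (μ.V \ F).card) ≤ μ.e2 := by
  obtain ⟨hs, hc⟩ := rib_sep h.valid hl hr he
  have h1 := h.irr _ _ hs (by simp)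
  have h2 := h.card_eq
  simp only [Rib.e2]
  omega

theorem card_three (P A B C : Finset (Fin n)) : ((A ∪ B ∪ C) \ P).card =
    (A \ P).card + (B \ (P ∪ A)).card + (C \ (P ∪ A ∪ B)).card := by
  rw [← card_union_of_disjoint, ← card_union_of_disjoint]
  · congr 1; ext x; simp only [mem_union, mem_sdiff]; tauto
  · rw [Finset.disjoint_left]; intro x; simp only [mem_union, mem_sdiff]; tauto
  · rw [Finset.disjoint_left]; intro x; simp only [mem_sdiff, mem_union]; tauto

theorem ext_ineq {γ γ' : Rib n} {c : Comp n} {k a a' : ℕ} (b : c.Basic) (t : Tri γ c γ')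
    (hc : SepIneq k c)
    (hγ : ∀ P F : Finset (Fin n), γ.l ⊆ P → γ.r ⊆ F → c.W ∪ γ'.V ⊆ F →
      (∀ e ∈ γ.T, supp e ⊆ P ∨ supp e ⊆ F) →
      2 * ((γ.V \ P).card + (γ.V \ F).card) ≤ γ.e2 + a)
    (hγ' : ∀ P F : Finset (Fin n), γ'.l ⊆ P → γ'.r ⊆ F → c.W ∪ γ.V ⊆ F →
      (∀ e ∈ γ'.T, supp e ⊆ P ∨ supp e ⊆ F) →
      2 * ((γ'.V \ P).card + (γ'.V \ F).card) ≤ γ'.e2 + a') :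
    SepIneq (a + k + a') (.ext γ c γ') := by
  intro P F hl hr he
  simp only [Comp.l, Comp.r, Comp.cnt] at hl hr he
  have T1 := t.left.valid.T_sub
  have T2 := t.left'.valid.T_sub
  have r1 := t.left.valid.r_sub
  have r2 := t.left'.valid.r_sub
  have s1 := t.side
  have s2 := t.side'
  have i1 := hγ P (F ∪ γ'.V ∪ c.W) hl (by
      rw [s1]; exact b.l_sub.trans subset_union_right) (by
      intro x; simp only [mem_union]; tauto) (by
      intro e h
      by_cases h1 : e ∈ γ'.T
      · right; exact (T2 e h1).trans (by intro x; simp only [mem_union]; tauto)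
      by_cases h2 : c.cnt e = 0
      · rcases he e (by simp [h, h1, h2]) with h3 | h3
        · exact Or.inl h3
        · right; exact h3.trans (by intro x; simp only [mem_union]; tauto)
      · right; exact (b.edge e h2).trans subset_union_right)
  have i2 := hγ' F (P ∪ γ.V ∪ c.W) hr (by
      rw [s2]; exact b.r_sub.trans subset_union_right) (by
      intro x; simp only [mem_union]; tauto) (by
      intro e h
      by_cases h1 : e ∈ γ.T
      · right; exact (T1 e h1).trans (by intro x; simp only [mem_union]; tauto)
      by_cases h2 : c.cnt e = 0
      · rcases he e (by simp [h, h1, h2]) with h3 | h3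
        · right; exact h3.trans (by intro x; simp only [mem_union]; tauto)
        · exact Or.inl h3
      · right; exact (b.edge e h2).trans subset_union_right)
  have i3 := hc (P ∪ γ.V) (F ∪ γ'.V) (by rw [← s1]; exact r1.trans subset_union_right)
    (by rw [← s2]; exact r2.trans subset_union_right) (by
      intro e h
      by_cases h1 : e ∈ γ.T
      · left; exact (T1 e h1).trans subset_union_right
      by_cases h2 : e ∈ γ'.T
      · right; exact (T2 e h2).trans subset_union_right
      rcases he e (by simp [h, h1, h2]) with h3 | h3
      · exact Or.inl (h3.trans subset_union_left)
      · exact Or.inr (h3.trans subset_union_left))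
  simp only [Comp.W, Comp.e2]
  rw [card_three]
  have : γ.V ∪ c.W ∪ γ'.V = γ'.V ∪ c.W ∪ γ.V := by
    ext x; simp only [mem_union]; tauto
  rw [this, card_three F]
  omega

theorem InC.sepIneq {D i R : ℕ} {c : Comp n} (h : InC D i c) (hX : InX R i c) : SepIneq 0 c := by
  induction i generalizing c with
  | zero =>
    cases c with
    | ext _ _ _ => simp [InC] at h
    | mid μ =>
      intro P F hl hr he
      exact mid_ineq h.1 hl hr (fun e h => he e (by simp [Comp.cnt, h]))
  | succ i ih =>
    cases c with
    | mid _ => simp [InC] at h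
    | ext γ c γ' =>
      obtain ⟨hc, e⟩ := h
      obtain ⟨xc, t, -, -⟩ := hX
      exact ext_ineq (a := 0) (a' := 0) xc.basic t (ih hc xc)
        (fun P F h1 h2 h3 h4 => left_irr_ineq e.left e.irr h1 h2 h3 h4)
        (fun P F h1 h2 h3 h4 => left_irr_ineq e.left' e.irr' h1 h2 h3 h4)

/-! Facts about the two families -/

structure Fam (D R k E0 : ℕ) (c : Comp n) : Prop where
  inX : InX R c.depth c
  depth : c.depth ≤ 2 * D + 1
  card : c.l.card ≤ D
  card' : c.r.card ≤ D
  ineq : SepIneq k c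
  e0 : E0 ≤ c.e2

theorem e2_CN {D i : ℕ} {c : Comp n} (h : InC D i c) (ht : ¬ c.IsTriv) : 1 ≤ c.e2 := by
  cases c with
  | mid μ =>
    simp only [Comp.e2, Rib.e2]
    by_contra hc
    cases i with
    | succ i => simp [InC] at h
    | zero =>
    apply ht
    have h1 : μ.l = μ.V := eq_of_subset_of_card_le h.1.valid.l_sub (by omega)
    have h2 : μ.r = μ.V := eq_of_subset_of_card_le h.1.valid.r_sub (by omega)
    exact ⟨μ.V, μ.T, congrArg Comp.mid (Rib.ext' h1 h2 rfl rfl)⟩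
  | ext γ c γ' =>
    cases i with
    | zero => simp [InC] at h
    | succ i =>
    obtain ⟨hc, e⟩ := h
    simp only [Comp.e2, Rib.e2]
    by_contra hc
    apply e.nontriv
    have h1 := card_le_card e.left.valid.l_sub
    have h2 := card_le_card e.left'.valid.l_sub
    have h3 := card_le_card e.left.valid.r_sub
    have h4 := card_le_card e.left'.valid.r_sub
    exact ⟨e.left.eq_triv (by omega), e.left'.eq_triv (by omega)⟩

theorem CN_fam {D τ : ℕ} {c : Comp n} (h : c ∈ CN n D τ) : Fam D (τ + D) 0 1 c := by
  simp only [CN, CQ, mem_filter, mem_Call] at h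
  obtain ⟨⟨h1, h2⟩, h3⟩ := h
  have := h1.card
  exact ⟨h1.inX h2, by omega, this.2.1, this.2.2, h1.sepIneq (h1.inX h2), e2_CN h1 h3⟩

theorem e2_w {R i : ℕ} {c : Comp n} (h : InX R i c) : c.e2 + c.l.card + c.r.card = 2 * c.w := by
  induction i generalizing c with
  | zero =>
    cases c with
    | ext _ _ _ => simp [InX] at h
    | mid μ =>
      have h1 := card_le_card h.1.l_sub
      have h2 := card_le_card h.1.r_sub
      simp only [Comp.e2, Rib.e2, Comp.l, Comp.r, Comp.w]
      omega
  | succ i ih =>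
    cases c with
    | mid _ => simp [InX] at h
    | ext γ c γ' =>
      obtain ⟨hc, t, -, -⟩ := h
      have h0 := ih hc
      have h1 := card_le_card t.left.valid.l_sub
      have h2 := card_le_card t.left'.valid.l_sub
      have h3 := card_le_card t.left.valid.r_sub
      have h4 := card_le_card t.left'.valid.r_sub
      simp only [Comp.e2, Rib.e2, Comp.l, Comp.r, Comp.w, Rib.lw]
      rw [← t.side, ← t.side'] at h0
      omega

theorem CErr_fam {D τ : ℕ} {c : Comp n} (h : c ∈ CErr n D τ) :
    Fam D (τ + D) (2 * D) (2 * τ - 2 * D) c := by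
  rw [mem_CErr] at h
  obtain ⟨γ, c, γ', rfl, h1, h2⟩ := h
  rw [mem_Call] at h1
  have hx := h1.inX h2.w2
  have l1 := h2.tri.left.card_le
  have l2 := h2.tri.left'.card_le
  have d1 := h2.card
  have d2 := h2.card'
  have w1 := h2.w1
  have w3 := h2.w3
  simp only [Rib.lw] at w1 w3
  have hX : InX (τ + D) (c.depth + 1) (.ext γ c γ') := ⟨hx, h2.tri, by omega, by omega⟩
  have := h1.card
  refine ⟨hX, by simp only [Comp.depth]; omega, d1, d2, ?_, ?_⟩
  · have := ext_ineq (a := D) (a' := D) hx.basic h2.tri (h1.sepIneq hx)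
        (fun P F h1 h2' h3 h4 => left_ineq h2.tri.left d1 h1 h2' h4)
        (fun P F h1 h2' h3 h4 => left_ineq h2.tri.left' d2 h1 h2' h4)
    have e : D + 0 + D = 2 * D := by ring
    rwa [e] at this
  · have h5 := e2_w hX
    have := h2.tot
    simp only [Comp.l, Comp.r, Comp.w] at h5
    omega

/-! Sequences -/

def Chain' : Finset (Fin n) → List (Comp n) → Finset (Fin n) → Prop
  | A, [], B => A = B
  | A, c :: cs, B => c.l = A ∧ Chain' c.r cs B

noncomputable def Wl : List (Comp n) → Finset (Fin n)
  | [] => ∅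
  | c :: cs => c.W ∪ Wl cs

noncomputable def cntl (e : Edge n) : List (Comp n) → ℕ
  | [] => 0
  | c :: cs => c.cnt e + cntl e cs

def e2l : List (Comp n) → ℕ
  | [] => 0
  | c :: cs => c.e2 + e2l cs

theorem cntl_sub {e : Edge n} {cs : List (Comp n)} (hb : ∀ c ∈ cs, c.Basic) (h : cntl e cs ≠ 0) :
    supp e ⊆ Wl cs := by
  induction cs with
  | nil => simp [cntl] at h
  | cons c cs ih =>
    simp only [cntl] at h
    by_cases h1 : c.cnt e = 0
    · exact (ih (fun c hc => hb c (List.mem_cons_of_mem _ hc)) (by omega)).trans subset_union_right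
    · exact ((hb c List.mem_cons_self).edge e h1).trans subset_union_left

theorem seq_ineq {k : ℕ} {cs : List (Comp n)} (hb : ∀ c ∈ cs, c.Basic) (hs : ∀ c ∈ cs, SepIneq k c)
    {A B P F : Finset (Fin n)} (hch : Chain' A cs B) (hA : A ⊆ P) (hB : B ⊆ F)
    (he : ∀ e, cntl e cs = 1 → supp e ⊆ P ∨ supp e ⊆ F) :
    2 * ((Wl cs \ P).card + (Wl cs \ F).card) ≤ e2l cs + k * cs.length := by
  induction cs generalizing A P with
  | nil => simp [Wl]
  | cons c cs ih =>
    have hb' : ∀ c ∈ cs, c.Basic := fun c hc => hb c (List.mem_cons_of_mem _ hc)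
    have hs' : ∀ c ∈ cs, SepIneq k c := fun c hc => hs c (List.mem_cons_of_mem _ hc)
    have b := hb c List.mem_cons_self
    obtain ⟨h1, h2⟩ := hch
    have i1 := ih hb' hs' (P := P ∪ c.W) h2 (b.r_sub.trans subset_union_right) (by
      intro e h
      by_cases h3 : c.cnt e = 0
      · rcases he e (by simp [cntl, h, h3]) with h4 | h4
        · exact Or.inl (h4.trans subset_union_left)
        · exact Or.inr h4
      · exact Or.inl ((b.edge e h3).trans subset_union_right))
    have hr : c.r ⊆ F ∪ Wl cs := by
      cases cs with
      | nil => 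
        have : c.r = B := h2
        rw [this]; exact hB.trans subset_union_left
      | cons d ds =>
        rw [← h2.1]
        exact (hb' d List.mem_cons_self).l_sub.trans (subset_union_left.trans subset_union_right)
    have i2 := hs c List.mem_cons_self P (F ∪ Wl cs) (h1 ▸ hA) hr (by
      intro e h
      by_cases h3 : cntl e cs = 0
      · rcases he e (by simp [cntl, h, h3]) with h4 | h4
        · exact Or.inl h4
        · exact Or.inr (h4.trans subset_union_left)
      · exact Or.inr ((cntl_sub hb' h3).trans subset_union_right))
    have e1 := card_three P c.W (Wl cs) ∅
    have e2 := card_three F (Wl cs) c.W ∅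
    simp only [union_empty, empty_sdiff, card_empty, add_zero] at e1 e2
    simp only [Wl, e2l, List.length_cons]
    rw [e1, union_comm c.W, e2]
    nlinarith

end PlantedClique
end

section
namespace PlantedClique
variable {n : ℕ}

/-- edges inside `V` not inside `l` are few -/
theorem EE_card_le {l V : Finset (Fin n)} (h : l ⊆ V) :
    (EE V).card ≤ (EE l).card + V.card * (V.card - l.card) := by
  have h1 : ((EE V \ EE l).image (fun e => e.1)) ⊆
      ((V \ l) ×ˢ V).image (fun p : Fin n × Fin n => s(p.1, p.2)) := by
    intro z hz
    simp only [mem_image, mem_sdiff, EE, mem_filter, mem_univ, true_and] at hz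
    obtain ⟨⟨z', hd⟩, ⟨h2, h3⟩, rfl⟩ := hz
    rw [not_subset] at h3
    obtain ⟨v, hv, hvl⟩ := h3
    have hv' : v ∈ z' := by simpa [supp] using hv
    obtain ⟨w, rfl⟩ := Sym2.mem_iff_exists.1 hv'
    have hw : w ∈ supp (⟨s(v, w), hd⟩ : Edge n) := by simp [supp]
    simp only [mem_image, mem_product, mem_sdiff]
    exact ⟨(v, w), ⟨⟨h2 hv, hvl⟩, h2 hw⟩, rfl⟩
  have h2 := card_le_card h1
  rw [card_image_of_injective _ Subtype.val_injective] at h2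
  have h3 := card_image_le (s := (V \ l) ×ˢ V) (f := fun p : Fin n × Fin n => s(p.1, p.2))
  rw [card_product, card_sdiff_of_subset h] at h3
  have h4 := le_card_sdiff (EE l) (EE V)
  have h5 : (V.card - l.card) * V.card = V.card * (V.card - l.card) := mul_comm _ _
  omega

theorem EE_mono {l V : Finset (Fin n)} (h : l ⊆ V) : EE l ⊆ EE V := by
  intro e he
  simp only [EE, mem_filter, mem_univ, true_and] at *
  exact he.trans h

noncomputable def sig (t : ℝ) (A : Finset (Fin n)) : ℝ := t ^ A.card * √2 ^ (EE A).card

theorem sig_pos {t : ℝ} (ht : 0 < t) (A : Finset (Fin n)) : 0 < sig t A := by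
  unfold sig; positivity

theorem sig_sq (t : ℝ) (A : Finset (Fin n)) : sig t A ^ 2 = (t ^ 2) ^ A.card * 2 ^ (EE A).card := by
  unfold sig
  rw [mul_pow, ← pow_mul, ← pow_mul, ← pow_mul, mul_comm (EE A).card 2, pow_mul √2,
    Real.sq_sqrt (by norm_num)]
  ring

theorem one_le_sqrt2 : (1 : ℝ) ≤ √2 := by
  rw [show (1 : ℝ) = √1 by simp]; exact Real.sqrt_le_sqrt (by norm_num)

/-- Core pointwise computation, `a = |V|-|l|`, `b = |V|-|r|`. -/
theorem rib_core {t u y : ℝ} (ht : 0 < t) (hu : 0 < u) {R : ℕ} (hy : t * √2 ^ R * u ≤ y)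
    {l r V : Finset (Fin n)} (hl : l ⊆ V) (hr : r ⊆ V) (hV : V.card ≤ R) :
    t ^ (2 * V.card) / (sig t l * sig t r) * u ^ ((V.card - l.card) + (V.card - r.card)) *
      2 ^ (EE V).card ≤ y ^ ((V.card - l.card) + (V.card - r.card)) := by
  have e1 := card_le_card hl
  have e2 := card_le_card hr
  obtain ⟨a, ha⟩ := Nat.exists_eq_add_of_le e1
  obtain ⟨b, hb⟩ := Nat.exists_eq_add_of_le e2
  have f1 := EE_card_le hl
  have f2 := EE_card_le hr
  have ha' : V.card - l.card = a := by omega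
  have hb' : V.card - r.card = b := by omega
  rw [ha'] at f1 ⊢
  rw [hb'] at f2 ⊢
  have h2 : (2 : ℝ) ^ (EE V).card = √2 ^ (EE V).card * √2 ^ (EE V).card := by
    rw [← mul_pow, Real.mul_self_sqrt (by norm_num)]
  have hs : (0:ℝ) < √2 := by positivity
  have k1 : √2 ^ (EE V).card ≤ √2 ^ (EE l).card * (√2 ^ R) ^ a := by
    rw [← pow_mul, ← pow_add]
    apply pow_le_pow_right₀ one_le_sqrt2
    have := Nat.mul_le_mul_right a hV
    omega
  have k2 : √2 ^ (EE V).card ≤ √2 ^ (EE r).card * (√2 ^ R) ^ b := by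
    rw [← pow_mul, ← pow_add]
    apply pow_le_pow_right₀ one_le_sqrt2
    have := Nat.mul_le_mul_right b hV
    omega
  have h3 : t ^ (2 * V.card) = t ^ l.card * t ^ r.card * t ^ (a + b) := by
    rw [← pow_add, ← pow_add]; congr 1; omega
  calc _ = t ^ (a+b) * u ^ (a+b) * ((√2 ^ (EE V).card * √2 ^ (EE V).card) /
        (√2 ^ (EE l).card * √2 ^ (EE r).card)) := by
        rw [h2, h3]; unfold sig; field_simp
    _ ≤ t ^ (a+b) * u ^ (a+b) * ((√2 ^ R) ^ a * (√2 ^ R) ^ b) := by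
        gcongr
        rw [div_le_iff₀ (by positivity)]
        calc _ ≤ (√2 ^ (EE l).card * (√2 ^ R) ^ a) * (√2 ^ (EE r).card * (√2 ^ R) ^ b) := by gcongr
          _ = _ := by ring
    _ = (t * √2 ^ R * u) ^ (a + b) := by ring
    _ ≤ _ := by gcongr

noncomputable def phi (Λ : ℕ) (U V : Finset (Fin n)) : ℝ :=
  if (U ∪ V).card ≤ Λ then ((n : ℝ)⁻¹) ^ (V \ U).card else 0

theorem phi_nonneg (Λ : ℕ) (U V : Finset (Fin n)) : 0 ≤ phi Λ U V := by
  unfold phi; split_ifs <;> positivity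

theorem phi_union (Λ : ℕ) (U V₁ V₂ : Finset (Fin n)) :
    phi Λ U (V₁ ∪ V₂) ≤ phi Λ U V₁ * phi Λ (U ∪ V₁) V₂ := by
  by_cases h : (U ∪ (V₁ ∪ V₂)).card ≤ Λ
  · have h1 : (U ∪ V₁).card ≤ Λ := (card_le_card (by
      rw [← union_assoc]; exact subset_union_left)).trans h
    have h2 : (U ∪ V₁ ∪ V₂).card ≤ Λ := by rwa [union_assoc]
    simp only [phi, h, h1, h2, if_true]
    rw [← pow_add]
    apply le_of_eq
    congr 1
    rw [← card_union_of_disjoint]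
    · congr 1
      ext v; simp only [mem_sdiff, mem_union]; tauto
    · rw [disjoint_left]; intro v; simp only [mem_sdiff, mem_union]; tauto
  · have : phi Λ U (V₁ ∪ V₂) = 0 := by simp [phi, h]
    rw [this]
    exact mul_nonneg (phi_nonneg _ _ _) (phi_nonneg _ _ _)

theorem phi_le_one (Λ : ℕ) (U V : Finset (Fin n)) : phi Λ U V ≤ 1 := by
  unfold phi; split_ifs
  · apply pow_le_one₀ (by positivity)
    rcases Nat.eq_zero_or_pos n with h | h
    · simp [h]
    · exact inv_le_one_of_one_le₀ (by exact_mod_cast h)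
  · norm_num

theorem shape_sum {y : ℝ} (hy : 0 ≤ y) (Λ : ℕ) (hΛ : 1 ≤ Λ) (A U : Finset (Fin n)) :
    ∑ V ∈ univ.filter (fun V => A ⊆ V), ∑ r ∈ V.powerset,
      y ^ ((V.card - A.card) + (V.card - r.card)) * phi Λ U V ≤ Real.exp (3 * Λ * y) := by
  have exp1 : 1 + y ≤ Real.exp y := by linarith [Real.add_one_le_exp y]
  by_cases hU : U.card ≤ Λ
  swap
  · rw [sum_eq_zero]
    · positivity
    · intro V _
      apply sum_eq_zero
      intro r _
      have : ¬ (U ∪ V).card ≤ Λ := by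
        intro h; exact hU ((card_le_card subset_union_left).trans h)
      simp [phi, this]
  have s1 : ∀ V : Finset (Fin n), ∑ r ∈ V.powerset, y ^ (V.card - r.card) = (1 + y) ^ V.card := by
    intro V
    have := (Finset.sum_pow_mul_eq_add_pow (1:ℝ) y V)
    simpa using this
  have hn : (0:ℝ) ≤ (n:ℝ)⁻¹ := by positivity
  have hn1 : (n:ℝ)⁻¹ ≤ 1 := by
    rcases Nat.eq_zero_or_pos n with h | h
    · simp [h]
    · exact inv_le_one_of_one_le₀ (by exact_mod_cast h)
  set f : Fin n → ℝ := fun x => if x ∈ U then y else y * (n:ℝ)⁻¹ with hf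
  have hfn : ∀ x, 0 ≤ f x := by intro x; simp only [hf]; split_ifs <;> positivity
  have s2 : ∀ V ∈ univ.filter (fun V => A ⊆ V), ∑ r ∈ V.powerset,
      y ^ ((V.card - A.card) + (V.card - r.card)) * phi Λ U V ≤
      Real.exp (Λ * y) * ∏ x ∈ V \ A, f x := by
    intro V hV
    simp only [mem_filter, mem_univ, true_and] at hV
    have : ∑ r ∈ V.powerset, y ^ ((V.card - A.card) + (V.card - r.card)) * phi Λ U V =
        (1 + y) ^ V.card * (y ^ (V.card - A.card) * phi Λ U V) := by
      rw [← s1, sum_mul]; apply sum_congr rfl; intro r _; rw [pow_add]; ring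
    rw [this]
    by_cases hc : (U ∪ V).card ≤ Λ
    · have h1 : (1 + y) ^ V.card ≤ Real.exp (Λ * y) := by
        calc (1 + y) ^ V.card ≤ (Real.exp y) ^ V.card := by gcongr
          _ = Real.exp (V.card * y) := by rw [← Real.exp_nat_mul]
          _ ≤ _ := by
            have : V.card ≤ Λ := (card_le_card subset_union_right).trans hc
            gcongr
      have h2 : y ^ (V.card - A.card) * phi Λ U V ≤ ∏ x ∈ V \ A, f x := by
        have : ∏ x ∈ V \ A, f x = y ^ (V.card - A.card) * ((n:ℝ)⁻¹) ^ ((V \ A) \ U).card := by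
          have e : ∀ x ∈ V \ A, f x = y * (if x ∈ U then 1 else (n:ℝ)⁻¹) := by
            intro x _; simp only [hf]; split_ifs <;> simp
          rw [prod_congr rfl e, prod_mul_distrib, prod_const, card_sdiff_of_subset hV, prod_ite]
          simp only [prod_const, one_pow, one_mul]
          congr 3
          ext v; simp
        rw [this]
        simp only [phi, hc, if_true]
        gcongr 1
        apply pow_le_pow_of_le_one hn hn1
        exact card_le_card (sdiff_subset_sdiff sdiff_subset subset_rfl)
      exact mul_le_mul h1 h2 (mul_nonneg (by positivity) (phi_nonneg _ _ _)) (by positivity)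
    · simp only [phi, hc, if_false, mul_zero]
      exact mul_nonneg (by positivity) (prod_nonneg (fun x _ => hfn x))
  refine (sum_le_sum s2).trans ?_
  rw [← mul_sum]
  have s3 : ∑ V ∈ univ.filter (fun V => A ⊆ V), ∏ x ∈ V \ A, f x ≤ ∏ x, (1 + f x) := by
    rw [prod_one_add, powerset_univ]
    rw [← sum_image (s := univ.filter (fun V => A ⊆ V)) (g := fun V => V \ A)
      (f := fun X => ∏ x ∈ X, f x)]
    · exact sum_le_sum_of_subset_of_nonneg (subset_univ _) (fun X _ _ => prod_nonneg (fun x _ => hfn x))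
    · intro V hV V' hV' h
      simp only [coe_filter, mem_univ, true_and, Set.mem_ofPred_eq] at hV hV'
      rw [← sdiff_union_of_subset hV, ← sdiff_union_of_subset hV']
      simp only at h
      rw [h]
  have s4 : ∏ x, (1 + f x) ≤ Real.exp (∑ x, f x) := by
    rw [Real.exp_sum]
    exact prod_le_prod (fun x _ => by linarith [hfn x]) (fun x _ => by linarith [Real.add_one_le_exp (f x)])
  have s5 : ∑ x, f x ≤ Λ * y + y := by
    have : ∀ x, f x ≤ (if x ∈ U then y else 0) + y * (n:ℝ)⁻¹ := by
      intro x; simp only [hf]; split_ifs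
      · have : 0 ≤ y * (n:ℝ)⁻¹ := by positivity
        linarith
      · simp
    refine (sum_le_sum (fun x _ => this x)).trans ?_
    rw [sum_add_distrib, ← sum_filter, sum_const, sum_const]
    have e1 : ((univ.filter (fun x => x ∈ U)).card : ℝ) ≤ Λ := by
      have : univ.filter (fun x => x ∈ U) = U := by ext; simp
      rw [this]; exact_mod_cast hU
    simp only [nsmul_eq_mul, card_univ, Fintype.card_fin]
    have e2 : (n:ℝ) * (y * (n:ℝ)⁻¹) ≤ y := by
      rcases Nat.eq_zero_or_pos n with h | h
      · simp [h, hy]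
      · have : (n:ℝ) ≠ 0 := by positivity
        field_simp; exact le_refl _
    have := mul_le_mul_of_nonneg_right e1 hy
    linarith
  have h1Λ : (1:ℝ) ≤ Λ := by exact_mod_cast hΛ
  calc _ ≤ Real.exp (Λ * y) * Real.exp (Λ * y + y) := by
        gcongr
        exact s3.trans (s4.trans (Real.exp_le_exp.2 s5))
    _ = Real.exp (Λ * y + (Λ * y + y)) := by rw [← Real.exp_add]
    _ ≤ _ := by
      apply Real.exp_le_exp.2
      nlinarith

/-- Sum over a family of ribbons with one side fixed. -/
theorem rib_sum {S : Finset (Rib n)} (p : Rib n → Finset (Fin n)) {A U : Finset (Fin n)} {Λ : ℕ}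
    (hΛ : 1 ≤ Λ) {y : ℝ} (hy : 0 ≤ y)
    (Ed : Finset (Fin n) → Finset (Fin n) → Finset (Edge n)) (F : Rib n → ℝ)
    (hinj : ∀ γ ∈ S, ∀ γ' ∈ S, γ.V = γ'.V → p γ = p γ' → γ.T = γ'.T → γ = γ')
    (hA : ∀ γ ∈ S, A ⊆ γ.V) (hp : ∀ γ ∈ S, p γ ⊆ γ.V) (hT : ∀ γ ∈ S, γ.T ⊆ Ed γ.V (p γ))
    (hF : ∀ γ ∈ S, F γ * 2 ^ (Ed γ.V (p γ)).card ≤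
      y ^ ((γ.V.card - A.card) + (γ.V.card - (p γ).card))) :
    ∑ γ ∈ S, F γ * phi Λ U γ.V ≤ Real.exp (3 * Λ * y) := by
  refine le_trans ?_ (shape_sum hy Λ hΛ A U)
  rw [← sum_fiberwise_of_maps_to (s := S) (t := univ.filter (fun V => A ⊆ V)) (g := fun γ => γ.V)
    (fun γ hγ => by simpa using hA γ hγ)]
  apply sum_le_sum
  intro V hV
  rw [← sum_fiberwise_of_maps_to (s := S.filter (fun γ => γ.V = V)) (t := V.powerset) (g := p)
    (fun γ hγ => by
      simp only [mem_filter] at hγ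
      rw [mem_powerset, ← hγ.2]; exact hp γ hγ.1)]
  apply sum_le_sum
  intro r hr
  have key : ∀ γ ∈ (S.filter (fun γ => γ.V = V)).filter (fun γ => p γ = r),
      F γ * phi Λ U γ.V ≤ y ^ ((V.card - A.card) + (V.card - r.card)) * phi Λ U V /
        2 ^ (Ed V r).card := by
    intro γ hγ
    simp only [mem_filter] at hγ
    obtain ⟨⟨h1, rfl⟩, rfl⟩ := hγ
    rw [le_div_iff₀ (by positivity)]
    have := mul_le_mul_of_nonneg_right (hF γ h1) (phi_nonneg Λ U γ.V)
    linarith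
  refine (sum_le_card_nsmul _ _ _ key).trans ?_
  have hc : ((S.filter (fun γ => γ.V = V)).filter (fun γ => p γ = r)).card ≤ 2 ^ (Ed V r).card := by
    rw [← card_powerset]
    apply card_le_card_of_injOn (fun γ => γ.T)
    · intro γ hγ
      simp only [coe_filter, mem_filter, Set.mem_ofPred_eq] at hγ
      obtain ⟨⟨h1, rfl⟩, rfl⟩ := hγ
      simpa using hT γ h1
    · intro γ hγ γ' hγ' h
      simp only [coe_filter, mem_filter, Set.mem_ofPred_eq] at hγ hγ'
      exact hinj γ hγ.1.1 γ' hγ'.1.1 (hγ.1.2.trans hγ'.1.2.symm) (hγ.2.trans hγ'.2.symm) h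
  rw [nsmul_eq_mul]
  have hn : 0 ≤ y ^ ((V.card - A.card) + (V.card - r.card)) * phi Λ U V :=
    mul_nonneg (by positivity) (phi_nonneg _ _ _)
  calc _ ≤ (2:ℝ) ^ (Ed V r).card * (y ^ ((V.card - A.card) + (V.card - r.card)) * phi Λ U V /
        2 ^ (Ed V r).card) := by
        gcongr
        exact_mod_cast hc
    _ = _ := by field_simp

/-- weights -/
noncomputable def kL (t u : ℝ) (γ : Rib n) : ℝ := t ^ (2 * γ.lw) * sig t γ.r / sig t γ.l * u ^ γ.e2

noncomputable def kap (t u : ℝ) (c : Comp n) : ℝ := t ^ (2 * c.w) / (sig t c.l * sig t c.r) * u ^ c.e2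

theorem kap_ext {t u : ℝ} (ht : 0 < t) {γ γ' : Rib n} {c : Comp n} (h : Tri γ c γ') :
    kap t u (.ext γ c γ') = kL t u γ * kap t u c * kL t u γ' := by
  have h1 := (sig_pos ht c.l).ne'
  have h2 := (sig_pos ht c.r).ne'
  have h3 := (sig_pos ht γ.l).ne'
  have h4 := (sig_pos ht γ'.l).ne'
  have e1 : (Comp.ext γ c γ').l = γ.l := rfl
  have e2 : (Comp.ext γ c γ').r = γ'.l := rfl
  have e3 : (Comp.ext γ c γ').w = γ.lw + c.w + γ'.lw := rfl
  have e4 : (Comp.ext γ c γ').e2 = γ.e2 + c.e2 + γ'.e2 := rfl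
  simp only [kap, kL, e1, e2, e3, e4, h.side, h.side', mul_add, pow_add]
  field_simp

theorem kL_nonneg {t u : ℝ} (ht : 0 < t) (hu : 0 < u) (γ : Rib n) : 0 ≤ kL t u γ := by
  have h3 := (sig_pos ht γ.l)
  have h4 := (sig_pos ht γ.r)
  unfold kL; positivity

theorem kap_nonneg {t u : ℝ} (ht : 0 < t) (hu : 0 < u) (c : Comp n) : 0 ≤ kap t u c := by
  have h3 := (sig_pos ht c.l)
  have h4 := (sig_pos ht c.r)
  unfold kap; positivity

theorem kL_le {t u y : ℝ} (ht : 0 < t) (hu : 0 < u) {R : ℕ} (hy : t * √2 ^ R * u ≤ y)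
    {γ : Rib n} (h : γ.Valid) (hV : γ.V.card ≤ R) :
    kL t u γ * 2 ^ (EE γ.V \ EE γ.r).card ≤ y ^ γ.e2 := by
  refine le_trans (le_of_eq ?_) (rib_core ht hu hy h.l_sub h.r_sub hV)
  have h1 := card_le_card h.r_sub
  have h2 := card_le_card (EE_mono h.r_sub)
  have hp := sig_pos ht γ.r
  have hp' := sig_pos ht γ.l
  have e1 : t ^ (2 * γ.V.card) = t ^ (2 * γ.lw) * (t ^ 2) ^ γ.r.card := by
    rw [← pow_mul, ← pow_add]; congr 1; simp only [Rib.lw]; omega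
  have e2 : (2:ℝ) ^ (EE γ.V).card = 2 ^ (EE γ.V \ EE γ.r).card * 2 ^ (EE γ.r).card := by
    rw [← pow_add, card_sdiff_of_subset (EE_mono h.r_sub)]; congr 1; omega
  have e3 := sig_sq t γ.r
  have e4 : t ^ (2 * γ.V.card) * 2 ^ (EE γ.V).card =
      t ^ (2 * γ.lw) * 2 ^ (EE γ.V \ EE γ.r).card * sig t γ.r ^ 2 := by
    rw [e1, e2, e3]; ring
  calc kL t u γ * 2 ^ (EE γ.V \ EE γ.r).card
      = (t ^ (2 * γ.lw) * 2 ^ (EE γ.V \ EE γ.r).card * sig t γ.r ^ 2) / (sig t γ.l * sig t γ.r) * u ^ γ.e2 := by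
        unfold kL; field_simp
    _ = _ := by rw [← e4]; unfold Rib.e2; ring

theorem Left.T_sub' {γ : Rib n} (h : γ.Left) : γ.T ⊆ EE γ.V \ EE γ.r := by
  intro e he
  simp only [mem_sdiff, EE, mem_filter, mem_univ, true_and]
  exact ⟨h.valid.T_sub e he, h.noedge e he⟩

noncomputable def XX (n R : ℕ) : ℕ → Finset (Comp n)
  | 0 => (univ.filter (fun μ : Rib n => μ.Valid ∧ μ.V.card ≤ R)).image Comp.mid
  | i + 1 => ((univ ×ˢ XX n R i ×ˢ univ).filter
      (fun t : Rib n × Comp n × Rib n => Tri t.1 t.2.1 t.2.2 ∧ t.1.V.card ≤ R ∧ t.2.2.V.card ≤ R)).image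
      (fun t => Comp.ext t.1 t.2.1 t.2.2)

theorem mem_XX {R i : ℕ} {c : Comp n} : c ∈ XX n R i ↔ InX R i c := by
  induction i generalizing c with
  | zero => cases c <;> simp [XX, InX]
  | succ i ih => cases c <;> simp [XX, InX, ih]

theorem XX_sum {t u y : ℝ} (ht : 0 < t) (hu : 0 < u) {R : ℕ} (hy : t * √2 ^ R * u ≤ y)
    {Λ : ℕ} (hΛ : 1 ≤ Λ) (i : ℕ) (A U : Finset (Fin n)) :
    ∑ c ∈ (XX n R i).filter (fun c => c.l = A), kap t u c * phi Λ U c.W ≤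
      Real.exp (3 * Λ * y) ^ (2 * i + 1) := by
  have hy0 : 0 ≤ y := le_trans (by positivity) hy
  induction i generalizing A U with
  | zero =>
    have e : (XX n R 0).filter (fun c => c.l = A) =
        (univ.filter (fun μ : Rib n => (μ.Valid ∧ μ.V.card ≤ R) ∧ μ.l = A)).image Comp.mid := by
      ext c
      simp only [XX, mem_filter, mem_image, mem_univ, true_and]
      constructor
      · rintro ⟨⟨μ, h, rfl⟩, h2⟩; exact ⟨μ, ⟨h, h2⟩, rfl⟩
      · rintro ⟨μ, ⟨h, h2⟩, rfl⟩; exact ⟨⟨μ, h, rfl⟩, h2⟩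
    rw [e, sum_image (by intro a _ b _ h; exact Comp.mid.inj h)]
    simp only [mul_zero, zero_add, pow_one, Comp.W]
    apply rib_sum (p := fun μ => μ.r) (A := A) hΛ hy0 (fun V _ => EE V)
    · intro γ h γ' h' h1 h2 h3
      simp only [mem_filter, mem_univ, true_and] at h h'
      exact Rib.ext' (h.2.trans h'.2.symm) h2 h1 h3
    · intro γ h
      simp only [mem_filter, mem_univ, true_and] at h
      rw [← h.2]; exact h.1.1.l_sub
    · intro γ h
      simp only [mem_filter, mem_univ, true_and] at h
      exact h.1.1.r_sub
    · intro γ h e he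
      simp only [mem_filter, mem_univ, true_and] at h
      simpa [EE] using h.1.1.T_sub e he
    · intro γ h
      simp only [mem_filter, mem_univ, true_and] at h
      obtain ⟨⟨h1, h2⟩, rfl⟩ := h
      exact rib_core ht hu hy h1.l_sub h1.r_sub h2
  | succ i ih =>
    set B := Real.exp (3 * Λ * y) with hB
    have hB0 : 0 < B := Real.exp_pos _
    set SL := univ.filter (fun γ : Rib n => (γ.Left ∧ γ.V.card ≤ R) ∧ γ.l = A) with hSL
    set SR := fun C => univ.filter (fun γ : Rib n => (γ.Left ∧ γ.V.card ≤ R) ∧ γ.r = C) with hSR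
    have e : (XX n R (i+1)).filter (fun c => c.l = A) =
        (SL.sigma (fun γ => ((XX n R i).filter (fun c => c.l = γ.r)).sigma (fun c => SR c.r))).image
          (fun t => Comp.ext t.1 t.2.1 t.2.2) := by
      ext c
      simp only [XX, mem_filter, mem_image, mem_univ, true_and, mem_product, mem_sigma, hSL, hSR]
      constructor
      · rintro ⟨⟨⟨γ, c, γ'⟩, ⟨h1, h2, h3, h4⟩, rfl⟩, h5⟩
        exact ⟨⟨γ, c, γ'⟩, ⟨⟨⟨h2.left, h3⟩, h5⟩, ⟨h1.1, h2.side.symm⟩, ⟨h2.left', h4⟩, h2.side'⟩, rfl⟩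
      · rintro ⟨⟨γ, c, γ'⟩, ⟨⟨⟨h1, h2⟩, h3⟩, ⟨h4, h5⟩, ⟨h6, h7⟩, h8⟩, rfl⟩
        exact ⟨⟨⟨γ, c, γ'⟩, ⟨⟨h4, trivial⟩, ⟨h1, h6, h5.symm, h8⟩, h2, h7⟩, rfl⟩, h3⟩
    rw [e, sum_image (by
      rintro ⟨γ, c, γ'⟩ _ ⟨δ, d, δ'⟩ _ h
      simp only [Comp.ext.injEq] at h
      obtain ⟨rfl, rfl, rfl⟩ := h
      rfl)]
    rw [sum_sigma]
    simp only [sum_sigma]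
    have hR : ∀ C U, ∑ γ' ∈ SR C, kL t u γ' * phi Λ U γ'.V ≤ B := by
      intro C U
      apply rib_sum (p := fun μ => μ.l) (A := C) hΛ hy0 (fun V _ => EE V \ EE C)
      · intro γ h γ' h' h1 h2 h3
        simp only [hSR, mem_filter, mem_univ, true_and] at h h'
        exact Rib.ext' h2 (h.2.trans h'.2.symm) h1 h3
      · intro γ h
        simp only [hSR, mem_filter, mem_univ, true_and] at h
        rw [← h.2]; exact h.1.1.valid.r_sub
      · intro γ h
        simp only [hSR, mem_filter, mem_univ, true_and] at h
        exact h.1.1.valid.l_sub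
      · intro γ h
        simp only [hSR, mem_filter, mem_univ, true_and] at h
        rw [← h.2]
        exact Left.T_sub' h.1.1
      · intro γ h
        simp only [hSR, mem_filter, mem_univ, true_and] at h
        obtain ⟨⟨h1, h2⟩, rfl⟩ := h
        rw [add_comm]
        exact kL_le ht hu hy h1.valid h2
    have hL : ∑ γ ∈ SL, kL t u γ * phi Λ U γ.V ≤ B := by
      apply rib_sum (p := fun μ => μ.r) (A := A) hΛ hy0 (fun V r => EE V \ EE r)
      · intro γ h γ' h' h1 h2 h3
        simp only [hSL, mem_filter, mem_univ, true_and] at h h'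
        exact Rib.ext' (h.2.trans h'.2.symm) h2 h1 h3
      · intro γ h
        simp only [hSL, mem_filter, mem_univ, true_and] at h
        rw [← h.2]; exact h.1.1.valid.l_sub
      · intro γ h
        simp only [hSL, mem_filter, mem_univ, true_and] at h
        exact h.1.1.valid.r_sub
      · intro γ h
        simp only [hSL, mem_filter, mem_univ, true_and] at h
        exact Left.T_sub' h.1.1
      · intro γ h
        simp only [hSL, mem_filter, mem_univ, true_and] at h
        obtain ⟨⟨h1, h2⟩, rfl⟩ := h
        exact kL_le ht hu hy h1.valid h2
    have step : ∀ γ ∈ SL, ∑ c ∈ (XX n R i).filter (fun c => c.l = γ.r), ∑ γ' ∈ SR c.r,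
        kap t u (Comp.ext γ c γ') * phi Λ U (Comp.ext γ c γ').W ≤
        kL t u γ * phi Λ U γ.V * (B ^ (2 * i + 1) * B) := by
      intro γ hγ
      simp only [hSL, mem_filter, mem_univ, true_and] at hγ
      have s1 : ∀ c ∈ (XX n R i).filter (fun c => c.l = γ.r), ∑ γ' ∈ SR c.r,
          kap t u (Comp.ext γ c γ') * phi Λ U (Comp.ext γ c γ').W ≤
          kL t u γ * phi Λ U γ.V * ((kap t u c * phi Λ (U ∪ γ.V) c.W) * B) := by
        intro c hc
        simp only [mem_filter] at hc
        have s2 : ∀ γ' ∈ SR c.r, kap t u (Comp.ext γ c γ') * phi Λ U (Comp.ext γ c γ').W ≤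
            kL t u γ * phi Λ U γ.V * (kap t u c * phi Λ (U ∪ γ.V) c.W) *
              (kL t u γ' * phi Λ (U ∪ γ.V ∪ c.W) γ'.V) := by
          intro γ' hγ'
          simp only [hSR, mem_filter, mem_univ, true_and] at hγ'
          rw [kap_ext ht ⟨hγ.1.1, hγ'.1.1, hc.2.symm, hγ'.2⟩]
          have p1 : phi Λ U (Comp.ext γ c γ').W ≤
              phi Λ U γ.V * phi Λ (U ∪ γ.V) c.W * phi Λ (U ∪ γ.V ∪ c.W) γ'.V := by
            simp only [Comp.W]
            rw [union_assoc]
            refine (phi_union _ _ _ _).trans ?_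
            rw [mul_assoc]
            exact mul_le_mul_of_nonneg_left (phi_union _ _ _ _) (phi_nonneg _ _ _)
          have := mul_le_mul_of_nonneg_left p1 (mul_nonneg (mul_nonneg (kL_nonneg ht hu γ)
            (kap_nonneg ht hu c)) (kL_nonneg ht hu γ'))
          refine this.trans (le_of_eq (by ring))
        refine (sum_le_sum s2).trans ?_
        rw [← mul_sum, ← mul_assoc (kL t u γ * phi Λ U γ.V) _ B]
        exact mul_le_mul_of_nonneg_left (hR _ _) (mul_nonneg (mul_nonneg (kL_nonneg ht hu γ)
          (phi_nonneg _ _ _)) (mul_nonneg (kap_nonneg ht hu c) (phi_nonneg _ _ _)))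
      refine (sum_le_sum s1).trans ?_
      rw [← mul_sum, ← sum_mul]
      refine mul_le_mul_of_nonneg_left (mul_le_mul_of_nonneg_right (ih _ _) hB0.le)
        (mul_nonneg (kL_nonneg ht hu γ) (phi_nonneg _ _ _))
    refine (sum_le_sum step).trans ?_
    rw [← sum_mul]
    calc _ ≤ B * (B ^ (2 * i + 1) * B) := mul_le_mul_of_nonneg_right hL (by positivity)
      _ = _ := by ring

theorem sum_biUnion_le_sum {α : Type*} [DecidableEq α] (s : Finset ℕ) (f : ℕ → Finset α) {g : α → ℝ}
    (hg : ∀ a, 0 ≤ g a) : ∑ a ∈ s.biUnion f, g a ≤ ∑ i ∈ s, ∑ a ∈ f i, g a := by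
  induction s using Finset.induction_on with
  | empty => simp
  | insert i s hi ih =>
    rw [biUnion_insert, sum_insert hi]
    have := sum_union_inter (s₁ := f i) (s₂ := s.biUnion f) (f := g)
    have h2 : 0 ≤ ∑ a ∈ f i ∩ s.biUnion f, g a := sum_nonneg (fun a _ => hg a)
    linarith

theorem Fam_sum {t u y : ℝ} (ht : 0 < t) (hu : 0 < u) {D R k E0 : ℕ} (hy : t * √2 ^ R * u ≤ y)
    {Λ : ℕ} (hΛ : 1 ≤ Λ) {S : Finset (Comp n)} (hS : ∀ c ∈ S, Fam D R k E0 c)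
    (A U : Finset (Fin n)) :
    ∑ c ∈ S.filter (fun c => c.l = A), kap t u c * phi Λ U c.W ≤
      (2 * D + 2) * Real.exp (3 * Λ * y) ^ (4 * D + 3) := by
  have hy0 : 0 ≤ y := le_trans (by positivity) hy
  have h1 : S.filter (fun c => c.l = A) ⊆
      (range (2 * D + 2)).biUnion (fun i => (XX n R i).filter (fun c => c.l = A)) := by
    intro c hc
    simp only [mem_filter] at hc
    have := hS c hc.1
    simp only [mem_biUnion, mem_filter, mem_range, mem_XX]
    exact ⟨c.depth, by have := this.depth; omega, this.inX, hc.2⟩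
  have hnn : ∀ c : Comp n, 0 ≤ kap t u c * phi Λ U c.W := fun c =>
    mul_nonneg (kap_nonneg ht hu c) (phi_nonneg _ _ _)
  refine (sum_le_sum_of_subset_of_nonneg h1 (fun c _ _ => hnn c)).trans ?_
  refine (sum_biUnion_le_sum (range (2*D+2)) _ hnn).trans ?_
  have h2 : ∀ i ∈ range (2 * D + 2), ∑ c ∈ (XX n R i).filter (fun c => c.l = A),
      kap t u c * phi Λ U c.W ≤ Real.exp (3 * Λ * y) ^ (4 * D + 3) := by
    intro i hi
    refine (XX_sum ht hu hy hΛ i A U).trans ?_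
    apply pow_le_pow_right₀
    · rw [← Real.exp_zero]; apply Real.exp_le_exp.2; positivity
    · have := mem_range.1 hi; omega
  refine (sum_le_card_nsmul _ _ _ h2).trans ?_
  simp

end PlantedClique
end

section
namespace PlantedClique
variable {n : ℕ}

noncomputable def xs (G : Graph n) (e : Edge n) : ℝ := if G e then 1 else -1

theorem chi_eq_prod (G : Graph n) (T : Finset (Edge n)) :
    chi G T = ∏ e, xs G e ^ (if e ∈ T then 1 else 0) := by
  unfold chi xs
  rw [← prod_filter_mul_prod_filter_not univ (fun e => e ∈ T)]
  rw [prod_congr rfl (g := fun e => if G e = true then (1:ℝ) else -1) (s₂ := univ.filter (fun e => e ∈ T))]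
  · have : univ.filter (fun e => e ∈ T) = T := by ext; simp
    rw [this, prod_eq_one (s := univ.filter (fun e => e ∉ T)), mul_one]
    intro e he
    simp only [mem_filter, mem_univ, true_and] at he
    simp [he]
  · intro e he
    simp only [mem_filter, mem_univ, true_and] at he
    simp [he]

theorem ch_eq_prod (G : Graph n) (c : Comp n) : c.ch G = ∏ e, xs G e ^ c.cnt e := by
  induction c with
  | mid μ => simp only [Comp.ch, Comp.cnt, chi_eq_prod]
  | ext γ c γ' ih =>
    simp only [Comp.ch, Comp.cnt, chi_eq_prod, ih, pow_add, prod_mul_distrib]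

noncomputable def chl (G : Graph n) : List (Comp n) → ℝ
  | [] => 1
  | c :: cs => c.ch G * chl G cs

theorem chl_eq_prod (G : Graph n) (cs : List (Comp n)) : chl G cs = ∏ e, xs G e ^ cntl e cs := by
  induction cs with
  | nil => simp [chl, cntl]
  | cons c cs ih => simp only [chl, cntl, pow_add, prod_mul_distrib, ih, ch_eq_prod]

theorem sum_graph_prod (k : Edge n → ℕ) (e₀ : Edge n) (h : ¬ Even (k e₀)) :
    ∑ G : Graph n, ∏ e, xs G e ^ k e = 0 := by
  have := Finset.prod_univ_sum (fun _ : Edge n => (univ : Finset Bool))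
    (fun e b => ((if b then 1 else -1 : ℝ)) ^ k e)
  rw [Fintype.piFinset_univ] at this
  simp only [xs]
  rw [← this]
  apply prod_eq_zero (mem_univ e₀)
  simp [Odd.neg_one_pow (Nat.not_even_iff_odd.1 h)]

theorem xs_abs (G : Graph n) (e : Edge n) : |xs G e| = 1 := by
  unfold xs; split_ifs <;> simp

theorem sum_chl_le (cs : List (Comp n)) :
    |∑ G : Graph n, chl G cs| ≤ if (∀ e, Even (cntl e cs)) then (Fintype.card (Graph n) : ℝ) else 0 := by
  split_ifs with h
  · refine (abs_sum_le_sum_abs _ _).trans ?_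
    have : ∀ G ∈ (univ : Finset (Graph n)), |chl G cs| ≤ 1 := by
      intro G _
      rw [chl_eq_prod, abs_prod]
      apply le_of_eq
      apply prod_eq_one
      intro e _
      rw [abs_pow, xs_abs, one_pow]
    refine (sum_le_card_nsmul _ _ _ this).trans ?_
    simp
  · push Not at h
    obtain ⟨e, he⟩ := h
    simp only [chl_eq_prod]
    rw [sum_graph_prod _ e (by simpa using he)]
    simp

/-- Path sums. -/
noncomputable def psum (S : Finset (Comp n)) : ℕ → Finset (Fin n) → Finset (Fin n) →
    (List (Comp n) → ℝ) → ℝ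
  | 0, A, B, F => if A = B then F [] else 0
  | m + 1, A, B, F => ∑ c ∈ S.filter (fun c => c.l = A), psum S m c.r B (fun cs => F (c :: cs))

theorem psum_mul (S : Finset (Comp n)) (m : ℕ) (A B : Finset (Fin n)) (F : List (Comp n) → ℝ) (a : ℝ) :
    psum S m A B (fun cs => a * F cs) = a * psum S m A B F := by
  induction m generalizing A F with
  | zero => simp [psum]
  | succ m ih => simp only [psum, ih, mul_sum]

theorem psum_sum (S : Finset (Comp n)) (m : ℕ) (A B : Finset (Fin n)) {ι : Type*} (s : Finset ι)
    (F : ι → List (Comp n) → ℝ) :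
    ∑ i ∈ s, psum S m A B (F i) = psum S m A B (fun cs => ∑ i ∈ s, F i cs) := by
  induction m generalizing A F with
  | zero => by_cases h : A = B <;> simp [psum, h]
  | succ m ih =>
    simp only [psum]
    rw [sum_comm]
    exact sum_congr rfl (fun c _ => ih _ _)

theorem psum_mono (S : Finset (Comp n)) (m : ℕ) (A B : Finset (Fin n)) (F F' : List (Comp n) → ℝ)
    (h : ∀ cs, (∀ c ∈ cs, c ∈ S) → Chain' A cs B → cs.length = m → F cs ≤ F' cs) :
    psum S m A B F ≤ psum S m A B F' := by
  induction m generalizing A F F' with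
  | zero =>
    simp only [psum]
    split_ifs with hAB
    · exact h [] (by simp) hAB rfl
    · exact le_refl _
  | succ m ih =>
    simp only [psum]
    apply sum_le_sum
    intro c hc
    simp only [mem_filter] at hc
    apply ih
    intro cs h1 h2 h3
    apply h
    · intro d hd
      rcases List.mem_cons.1 hd with rfl | hd
      · exact hc.1
      · exact h1 d hd
    · exact ⟨hc.2, h2⟩
    · simp [h3]

noncomputable def wl (a : Comp n → ℝ) : List (Comp n) → ℝ
  | [] => 1
  | c :: cs => a c * wl a cs

/-- normalized kernel -/
noncomputable def KM (S : Finset (Comp n)) (t : ℝ) (G : Graph n) :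
    Matrix (Finset (Fin n)) (Finset (Fin n)) ℝ :=
  fun A B => Ker S (t ^ 2) G A B / (sig t A * sig t B)

noncomputable def ac (t : ℝ) (c : Comp n) : ℝ := c.sgn * (t ^ (2 * c.w) / (sig t c.l * sig t c.r))

theorem KM_apply (S : Finset (Comp n)) (t : ℝ) (G : Graph n) (A B : Finset (Fin n)) :
    KM S t G A B = ∑ c ∈ (S.filter (fun c => c.l = A)).filter (fun c => c.r = B), ac t c * c.ch G := by
  unfold KM Ker
  rw [sum_div, filter_filter]
  apply sum_congr rfl
  intro c hc
  simp only [mem_filter] at hc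
  rw [ac, hc.2.1, hc.2.2, ← pow_mul]
  ring

theorem KM_pow (S : Finset (Comp n)) (t : ℝ) (G : Graph n) (m : ℕ) (A B : Finset (Fin n)) :
    (KM S t G ^ m) A B = psum S m A B (fun cs => wl (ac t) cs * chl G cs) := by
  induction m generalizing A with
  | zero => simp [psum, wl, chl, Matrix.one_apply]
  | succ m ih =>
    rw [pow_succ', Matrix.mul_apply]
    simp only [psum]
    have h1 : ∀ c : Comp n, (fun cs => wl (ac t) (c :: cs) * chl G (c :: cs)) =
        (fun cs => (ac t c * c.ch G) * (wl (ac t) cs * chl G cs)) := by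
      intro c; funext cs; simp only [wl, chl]; ring
    simp only [h1, psum_mul, ← ih]
    rw [← sum_fiberwise (S.filter (fun c => c.l = A)) (fun c => c.r)]
    apply sum_congr rfl
    intro X _
    rw [KM_apply, sum_mul]
    apply sum_congr rfl
    intro c hc
    simp only [mem_filter] at hc
    rw [hc.2]

theorem wl_nonneg {a : Comp n → ℝ} (h : ∀ c, 0 ≤ a c) (cs : List (Comp n)) : 0 ≤ wl a cs := by
  induction cs with
  | nil => simp [wl]
  | cons d ds ih => exact mul_nonneg (h d) ih

theorem psum_bound {t u y : ℝ} (ht : 0 < t) (hu : 0 < u) {D R k E0 : ℕ} (hy : t * √2 ^ R * u ≤ y)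
    {Λ : ℕ} (hΛ : 1 ≤ Λ) {S : Finset (Comp n)} (hS : ∀ c ∈ S, Fam D R k E0 c) (m : ℕ)
    (A B U : Finset (Fin n)) :
    psum S m A B (fun cs => wl (kap t u) cs * phi Λ U (Wl cs)) ≤
      ((2 * D + 2) * Real.exp (3 * Λ * y) ^ (4 * D + 3)) ^ m := by
  induction m generalizing A U with
  | zero =>
    simp only [psum, wl, Wl, one_mul, pow_zero]
    split_ifs
    · exact phi_le_one _ _ _
    · norm_num
  | succ m ih =>
    simp only [psum, wl, Wl]
    set K := ((2 * D + 2) * Real.exp (3 * Λ * y) ^ (4 * D + 3) : ℝ) with hK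
    have hK0 : 0 < K := by positivity
    have h1 : ∀ c ∈ S.filter (fun c => c.l = A), psum S m c.r B
        (fun cs => kap t u c * wl (kap t u) cs * phi Λ U (c.W ∪ Wl cs)) ≤
        kap t u c * phi Λ U c.W * K ^ m := by
      intro c hc
      have h2 : psum S m c.r B
        (fun cs => kap t u c * wl (kap t u) cs * phi Λ U (c.W ∪ Wl cs)) ≤
        psum S m c.r B (fun cs => (kap t u c * phi Λ U c.W) * (wl (kap t u) cs * phi Λ (U ∪ c.W) (Wl cs))) := by
        apply psum_mono
        intro cs _ _ _
        have hw : 0 ≤ wl (kap t u) cs := wl_nonneg (kap_nonneg ht hu) cs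
        have := mul_le_mul_of_nonneg_left (phi_union Λ U c.W (Wl cs))
          (mul_nonneg (kap_nonneg ht hu c) hw)
        linarith
      refine h2.trans ?_
      rw [psum_mul]
      exact mul_le_mul_of_nonneg_left (ih _ _) (mul_nonneg (kap_nonneg ht hu c) (phi_nonneg _ _ _))
    refine (sum_le_sum h1).trans ?_
    rw [← sum_mul, pow_succ']
    exact mul_le_mul_of_nonneg_right (Fam_sum ht hu hy hΛ hS A U) (by positivity)

theorem Wl_card {R D : ℕ} {cs : List (Comp n)} (h : ∀ c ∈ cs, InX R c.depth c ∧ c.depth ≤ 2 * D + 1) :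
    (Wl cs).card ≤ cs.length * ((4 * D + 3) * R) := by
  induction cs with
  | nil => simp [Wl]
  | cons c cs ih =>
    have h1 := ih (fun c hc => h c (List.mem_cons_of_mem _ hc))
    obtain ⟨h2, h3⟩ := h c List.mem_cons_self
    have h4 := h2.card_W
    have h5 : (2 * c.depth + 1) * R ≤ (4 * D + 3) * R := Nat.mul_le_mul_right _ (by omega)
    have h6 := card_union_le c.W (Wl cs)
    simp only [Wl, List.length_cons]
    rw [Nat.add_mul]
    omega

theorem wl_ac_le {t ν y : ℝ} (ht : 0 < t) (hν : 0 < ν) (hy : 0 < y) (hy1 : y ≤ 1) {D R k E0 : ℕ}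
    {cs : List (Comp n)} (h : ∀ c ∈ cs, Fam D R k E0 c) :
    |wl (ac t) cs| * ν ^ e2l cs ≤ wl (kap t (ν / y)) cs * (y ^ E0) ^ cs.length := by
  induction cs with
  | nil => simp [wl, e2l]
  | cons c cs ih =>
    have h1 := ih (fun c hc => h c (List.mem_cons_of_mem _ hc))
    have h2 := (h c List.mem_cons_self).e0
    have p1 := sig_pos ht c.l
    have p2 := sig_pos ht c.r
    have h3 : |ac t c| * ν ^ c.e2 ≤ kap t (ν / y) c * y ^ E0 := by
      have e1 : |ac t c| = t ^ (2 * c.w) / (sig t c.l * sig t c.r) := by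
        rw [ac, abs_mul, Comp.sgn, abs_pow, abs_neg, abs_one, one_pow, one_mul, abs_of_pos (by positivity)]
      rw [e1, kap, div_pow, mul_assoc]
      gcongr
      rw [div_mul_eq_mul_div, le_div_iff₀ (by positivity)]
      gcongr ?_ * ?_
      exact pow_le_pow_of_le_one hy.le hy1 h2
    simp only [wl, e2l, List.length_cons, abs_mul, pow_add, pow_one]
    calc _ = (|ac t c| * ν ^ c.e2) * (|wl (ac t) cs| * ν ^ e2l cs) := by ring
      _ ≤ (kap t (ν / y) c * y ^ E0) * (wl (kap t (ν / y)) cs * (y ^ E0) ^ cs.length) := by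
        apply mul_le_mul h3 h1 (by positivity)
        exact mul_nonneg (kap_nonneg ht (by positivity) c) (by positivity)
      _ = _ := by ring

theorem card_small (D : ℕ) : ((univ.filter (fun A : Finset (Fin n) => A.card ≤ D)).card : ℝ) ≤ ((n : ℝ) + 1) ^ D := by
  have h1 : univ.filter (fun A : Finset (Fin n) => A.card ≤ D) ⊆
      (range (D + 1)).biUnion (fun i => powersetCard i univ) := by
    intro A hA
    simp only [mem_filter, mem_univ, true_and] at hA
    simp only [mem_biUnion, mem_range, mem_powersetCard, subset_univ, true_and]
    exact ⟨A.card, by omega, rfl⟩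
  have h2 := (card_le_card h1).trans card_biUnion_le
  simp only [card_powersetCard, card_univ, Fintype.card_fin] at h2
  have h3 : ∑ i ∈ range (D + 1), n.choose i ≤ (n + 1) ^ D := by
    rw [add_pow]
    apply sum_le_sum
    intro i hi
    have hi' := mem_range.1 hi
    calc n.choose i ≤ n ^ i := Nat.choose_le_pow n i
      _ = n ^ i * 1 ^ (D - i) * 1 := by simp
      _ ≤ n ^ i * 1 ^ (D - i) * D.choose i := by
        gcongr
        exact Nat.choose_pos (by omega)
  exact_mod_cast h2.trans h3

theorem moment {t ν y : ℝ} (ht : 0 < t) (hν : 1 ≤ ν) (hνn : ν ^ 4 = n) (hy0 : 0 < y) (hy1 : y ≤ 1)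
    {D R k E0 : ℕ} (hy : t * √2 ^ R * ν ≤ y ^ 2) {S : Finset (Comp n)}
    (hS : ∀ c ∈ S, Fam D R k E0 c) {m : ℕ} (hm : 1 ≤ m) {Λ : ℕ} (hΛ : 1 ≤ Λ)
    (hΛ' : m * ((4 * D + 3) * R) + D ≤ Λ) :
    ∑ G : Graph n, (KM S t G ^ m).trace ≤ Fintype.card (Graph n) * ((n : ℝ) + 1) ^ D *
      (ν ^ k * y ^ E0 * ((2 * D + 2) * Real.exp (3 * Λ * y) ^ (4 * D + 3))) ^ m := by
  have hν0 : 0 < ν := by linarith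
  set K := ((2 * D + 2) * Real.exp (3 * Λ * y) ^ (4 * D + 3) : ℝ) with hK
  have hK0 : 0 < K := by positivity
  set N := (Fintype.card (Graph n) : ℝ) with hN
  have hN0 : 0 ≤ N := by positivity
  have hu : 0 < ν / y := by positivity
  have hy' : t * √2 ^ R * (ν / y) ≤ y := by
    rw [← mul_div_assoc, div_le_iff₀ hy0]; linarith [sq y]
  have hn0 : (0:ℝ) < n := by rw [← hνn]; positivity
  simp only [Matrix.trace, Matrix.diag, KM_pow]
  rw [sum_comm]
  simp only [psum_sum]
  have key : ∀ A : Finset (Fin n), psum S m A A (fun cs => ∑ G : Graph n, wl (ac t) cs * chl G cs) ≤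
      if A.card ≤ D then N * (ν ^ k * y ^ E0 * K) ^ m else 0 := by
    intro A
    split_ifs with hA
    · have h1 : psum S m A A (fun cs => ∑ G : Graph n, wl (ac t) cs * chl G cs) ≤
        psum S m A A (fun cs => (N * (ν ^ k * y ^ E0) ^ m) *
          (wl (kap t (ν / y)) cs * phi Λ A (Wl cs))) := by
        apply psum_mono
        intro cs hcs hch hlen
        have hF : ∀ c ∈ cs, Fam D R k E0 c := fun c hc => hS c (hcs c hc)
        rw [← mul_sum]
        have hw : 0 ≤ wl (kap t (ν / y)) cs := wl_nonneg (kap_nonneg ht hu) cs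
        have hrhs : 0 ≤ (N * (ν ^ k * y ^ E0) ^ m) *
          (wl (kap t (ν / y)) cs * phi Λ A (Wl cs)) :=
          mul_nonneg (by positivity) (mul_nonneg hw (phi_nonneg _ _ _))
        have hle := sum_chl_le cs
        refine (le_abs_self _).trans ?_
        rw [abs_mul]
        by_cases hev : ∀ e, Even (cntl e cs)
        · rw [if_pos hev] at hle
          have s1 := seq_ineq (k := k) (cs := cs) (fun c hc => (hF c hc).inX.basic)
            (fun c hc => (hF c hc).ineq) hch (subset_refl A) (subset_refl A) (by
              intro e he
              have := hev e
              rw [he] at this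
              exact absurd this (by decide))
          have s2 : (A ∪ Wl cs).card ≤ Λ := by
            have a1 := card_union_le A (Wl cs)
            have a2 := Wl_card (D := D) (R := R) (cs := cs) (fun c hc => ⟨(hF c hc).inX, (hF c hc).depth⟩)
            rw [hlen] at a2
            omega
          have s3 : phi Λ A (Wl cs) = ((n:ℝ)⁻¹) ^ (Wl cs \ A).card := by simp [phi, s2]
          have s4 : (n:ℝ) ^ (Wl cs \ A).card ≤ ν ^ e2l cs * (ν ^ k) ^ m := by
            rw [← hνn, ← pow_mul, ← pow_mul, ← pow_add]
            apply pow_le_pow_right₀ hν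
            rw [hlen] at s1
            omega
          have s5 := wl_ac_le ht hν0 hy0 hy1 hF
          rw [hlen] at s5
          have s6 : 1 ≤ ν ^ e2l cs * (ν ^ k) ^ m * phi Λ A (Wl cs) := by
            rw [s3, inv_pow, ← div_eq_mul_inv, le_div_iff₀ (by positivity)]
            linarith
          calc |wl (ac t) cs| * |∑ G : Graph n, chl G cs| ≤ |wl (ac t) cs| * N := by gcongr
            _ ≤ |wl (ac t) cs| * N * (ν ^ e2l cs * (ν ^ k) ^ m * phi Λ A (Wl cs)) :=
              le_mul_of_one_le_right (by positivity) s6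
            _ = (|wl (ac t) cs| * ν ^ e2l cs) * (N * (ν ^ k) ^ m * phi Λ A (Wl cs)) := by ring
            _ ≤ (wl (kap t (ν / y)) cs * (y ^ E0) ^ m) * (N * (ν ^ k) ^ m * phi Λ A (Wl cs)) := by
              apply mul_le_mul_of_nonneg_right s5
              exact mul_nonneg (by positivity) (phi_nonneg _ _ _)
            _ = _ := by ring
        · rw [if_neg hev] at hle
          have : |∑ G : Graph n, chl G cs| = 0 := le_antisymm hle (abs_nonneg _)
          rw [this, mul_zero]
          exact hrhs
      refine h1.trans ?_
      rw [psum_mul, mul_pow _ K, ← mul_assoc]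
      exact mul_le_mul_of_nonneg_left (psum_bound ht hu hy' hΛ hS m A A A) (by positivity)
    · obtain ⟨m, rfl⟩ := Nat.exists_eq_add_of_le' hm
      simp only [psum]
      apply le_of_eq
      apply sum_eq_zero
      intro c hc
      simp only [mem_filter] at hc
      exact absurd ((hS c hc.1).card) (by rw [hc.2]; exact hA)
  refine (sum_le_sum (fun A _ => key A)).trans ?_
  rw [← sum_filter, sum_const, nsmul_eq_mul]
  have := mul_le_mul_of_nonneg_right (card_small (n := n) D) (show 0 ≤ N * (ν ^ k * y ^ E0 * K) ^ m by positivity)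
  linarith

end PlantedClique
end

section
namespace PlantedClique
variable {n : ℕ}

section linalg
variable {ι : Type*} [Fintype ι] [DecidableEq ι]
open Matrix

theorem dot_pow {K : Matrix ι ι ℝ} (hK : K.IsSymm) (j : ℕ) (u : ι → ℝ) :
    (K ^ j *ᵥ u) ⬝ᵥ (K ^ j *ᵥ u) = u ⬝ᵥ (K ^ (2 * j) *ᵥ u) := by
  have h : (K ^ j).IsSymm := hK.pow j
  rw [two_mul, pow_add, ← mulVec_mulVec, dotProduct_mulVec u, ← mulVec_transpose, h.eq]

theorem cs_dot (u v : ι → ℝ) : (u ⬝ᵥ v) ^ 2 ≤ (u ⬝ᵥ u) * (v ⬝ᵥ v) := by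
  have := Finset.sum_mul_sq_le_sq_mul_sq univ u v
  simpa [dotProduct, sq] using this

theorem pow_form {K : Matrix ι ι ℝ} (hK : K.IsSymm) (u : ι → ℝ) (s : ℕ) :
    |u ⬝ᵥ (K *ᵥ u)| ^ (2 ^ s) ≤ (u ⬝ᵥ u) ^ (2 ^ s - 1) * |u ⬝ᵥ (K ^ (2 ^ s) *ᵥ u)| := by
  have hN : 0 ≤ u ⬝ᵥ u := by simpa using dotProduct_star_self_nonneg u
  induction s with
  | zero => simp
  | succ s ih =>
    have h1 : (u ⬝ᵥ (K ^ (2 ^ s) *ᵥ u)) ^ 2 ≤ (u ⬝ᵥ u) * |u ⬝ᵥ (K ^ (2 ^ (s + 1)) *ᵥ u)| := by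
      refine (cs_dot _ _).trans ?_
      rw [dot_pow hK, pow_succ' 2 s]
      exact mul_le_mul_of_nonneg_left (le_abs_self _) hN
    have h2 : 1 ≤ 2 ^ s := Nat.one_le_two_pow
    calc |u ⬝ᵥ (K *ᵥ u)| ^ (2 ^ (s + 1)) = (|u ⬝ᵥ (K *ᵥ u)| ^ (2 ^ s)) ^ 2 := by
          rw [← pow_mul, pow_succ]
      _ ≤ ((u ⬝ᵥ u) ^ (2 ^ s - 1) * |u ⬝ᵥ (K ^ (2 ^ s) *ᵥ u)|) ^ 2 := by gcongr
      _ = (u ⬝ᵥ u) ^ (2 * (2 ^ s - 1)) * (u ⬝ᵥ (K ^ (2 ^ s) *ᵥ u)) ^ 2 := by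
          rw [mul_pow, sq_abs, ← pow_mul, mul_comm 2]
      _ ≤ (u ⬝ᵥ u) ^ (2 * (2 ^ s - 1)) * ((u ⬝ᵥ u) * |u ⬝ᵥ (K ^ (2 ^ (s + 1)) *ᵥ u)|) := by gcongr
      _ = _ := by
          rw [← mul_assoc, ← pow_succ]
          congr 2
          rw [pow_succ]; omega

theorem trace_sq {K : Matrix ι ι ℝ} (hK : K.IsSymm) (j : ℕ) :
    (K ^ (2 * j)).trace = ∑ a, ∑ b, (K ^ j) a b ^ 2 := by
  have h : (K ^ j).IsSymm := hK.pow j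
  rw [two_mul, pow_add, Matrix.trace]
  simp only [Matrix.diag, Matrix.mul_apply]
  refine sum_congr rfl (fun a _ => sum_congr rfl (fun b _ => ?_))
  rw [sq, h.apply a b]

theorem trace_nonneg {K : Matrix ι ι ℝ} (hK : K.IsSymm) (j : ℕ) : 0 ≤ (K ^ (2 * j)).trace := by
  rw [trace_sq hK]; positivity

theorem form_le_trace {K : Matrix ι ι ℝ} (hK : K.IsSymm) (u : ι → ℝ) (s : ℕ) :
    |u ⬝ᵥ (K *ᵥ u)| ^ (2 ^ (s+1)) ≤ (u ⬝ᵥ u) ^ (2 ^ (s+1)) * (K ^ (2 ^ (s+1))).trace := by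
  have hN : 0 ≤ u ⬝ᵥ u := by simpa using dotProduct_star_self_nonneg u
  refine (pow_form hK u (s+1)).trans ?_
  have h2 : 1 ≤ 2 ^ (s+1) := Nat.one_le_two_pow
  have h3 : |u ⬝ᵥ (K ^ (2 ^ (s+1)) *ᵥ u)| ≤ (u ⬝ᵥ u) * (K ^ (2 ^ (s+1))).trace := by
    rw [pow_succ' 2 s, ← dot_pow hK, trace_sq hK]
    rw [abs_of_nonneg (by simpa using dotProduct_star_self_nonneg (K ^ 2 ^ s *ᵥ u))]
    simp only [dotProduct, mulVec]
    rw [mul_sum]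
    apply sum_le_sum
    intro a _
    have := Finset.sum_mul_sq_le_sq_mul_sq univ u (fun b => (K ^ 2 ^ s) a b)
    simp only [sq] at this ⊢
    refine le_trans (le_of_eq ?_) this
    simp only [mul_comm]
  calc _ ≤ (u ⬝ᵥ u) ^ (2 ^ (s+1) - 1) * ((u ⬝ᵥ u) * (K ^ (2 ^ (s+1))).trace) := by gcongr
    _ = _ := by
      rw [← mul_assoc, ← pow_succ]
      congr 2
      omega

theorem form_bound {K : Matrix ι ι ℝ} (hK : K.IsSymm) {η : ℝ} (hη : 0 ≤ η) (s : ℕ)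
    (h : (K ^ (2 ^ (s+1))).trace ≤ η ^ (2 ^ (s+1))) (u : ι → ℝ) :
    |∑ a, ∑ b, u a * K a b * u b| ≤ η * ∑ a, u a ^ 2 := by
  have hN : 0 ≤ u ⬝ᵥ u := by simpa using dotProduct_star_self_nonneg u
  have h1 := form_le_trace hK u s
  have h2 : |u ⬝ᵥ (K *ᵥ u)| ^ (2 ^ (s+1)) ≤ (η * (u ⬝ᵥ u)) ^ (2 ^ (s+1)) := by
    rw [mul_pow, mul_comm]
    exact h1.trans (mul_le_mul_of_nonneg_left h (by positivity))
  have h3 := le_of_pow_le_pow_left₀ (by positivity) (by positivity) h2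
  have e1 : u ⬝ᵥ (K *ᵥ u) = ∑ a, ∑ b, u a * K a b * u b := by
    simp only [dotProduct, mulVec, mul_sum, mul_assoc]
  have e2 : u ⬝ᵥ u = ∑ a, u a ^ 2 := by simp only [dotProduct, sq]
  rwa [e1, e2] at h3
end linalg

theorem KM_symm {S : Finset (Comp n)} (hS : ∀ c ∈ S, c.tr ∈ S) (t : ℝ) (G : Graph n) :
    (KM S t G).IsSymm := by
  ext A B
  simp only [Matrix.transpose_apply, KM]
  rw [Ker_symm hS, mul_comm]

/-- Markov. -/
theorem markov {S : Finset (Comp n)} (hS : ∀ c ∈ S, c.tr ∈ S) (t : ℝ) (s : ℕ) {X Y η : ℝ} (hη : 0 < η)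
    (h : ∑ G : Graph n, (KM S t G ^ (2 ^ (s+1))).trace ≤ Fintype.card (Graph n) * X * Y ^ (2 ^ (s+1))) :
    probGraph n (fun G => ¬ (KM S t G ^ (2 ^ (s+1))).trace ≤ η ^ (2 ^ (s+1))) ≤ X * (Y / η) ^ (2 ^ (s+1)) := by
  have hc : (0:ℝ) < Fintype.card (Graph n) := by exact_mod_cast Fintype.card_pos
  unfold probGraph
  have e : ∀ (i1 : DecidablePred (fun G : Graph n => ¬ (KM S t G ^ (2 ^ (s+1))).trace ≤ η ^ (2 ^ (s+1)))),
      ((@Finset.filter _ (fun G : Graph n => ¬ (KM S t G ^ (2 ^ (s+1))).trace ≤ η ^ (2 ^ (s+1))) i1 univ).card : ℝ) *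
      η ^ (2 ^ (s+1)) ≤ ∑ G : Graph n, (KM S t G ^ (2 ^ (s+1))).trace := by
    intro i1
    rw [← nsmul_eq_mul]
    refine (card_nsmul_le_sum _ (fun G : Graph n => (KM S t G ^ (2 ^ (s+1))).trace) _ ?_).trans ?_
    · intro G hG
      simp only [mem_filter, mem_univ, true_and] at hG
      linarith
    · apply sum_le_sum_of_subset_of_nonneg (subset_univ _)
      intro G _ _
      rw [pow_succ']
      exact trace_nonneg (KM_symm hS t G) _
  rw [div_le_iff₀ hc, div_pow, ← mul_div_assoc, div_mul_eq_mul_div, le_div_iff₀ (by positivity)]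
  refine (e _).trans (h.trans (le_of_eq (by ring)))

end PlantedClique
end

section
namespace PlantedClique
variable {n : ℕ}

/-- linear functional from a set function -/
noncomputable def Lg (g : Finset (Fin n) → ℝ) : MvPolynomial (Fin n) ℝ →ₗ[ℝ] ℝ :=
  (MvPolynomial.basisMonomials (Fin n) ℝ).constr ℝ (fun m => g m.support)

theorem Lg_monomial (g : Finset (Fin n) → ℝ) (m : Fin n →₀ ℕ) (a : ℝ) :
    Lg g (MvPolynomial.monomial m a) = a * g m.support := by
  have h : MvPolynomial.monomial m a = a • (MvPolynomial.basisMonomials (Fin n) ℝ) m := by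
    rw [MvPolynomial.coe_basisMonomials, MvPolynomial.smul_monomial]; simp
  rw [h, map_smul, Lg, Module.Basis.constr_basis, smul_eq_mul]

theorem Lg_monomial_mul (g : Finset (Fin n) → ℝ) (m : Fin n →₀ ℕ) (p : MvPolynomial (Fin n) ℝ) :
    Lg g (MvPolynomial.monomial m 1 * p) = ∑ k ∈ p.support, p.coeff k * g (m.support ∪ k.support) := by
  conv_lhs => rw [p.as_sum, mul_sum, map_sum]
  apply sum_congr rfl
  intro k _
  rw [MvPolynomial.monomial_mul, Lg_monomial, one_mul]
  congr 2
  ext v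
  simp [Finsupp.mem_support_iff]
  tauto

theorem Lg_X (g : Finset (Fin n) → ℝ) (i : Fin n) : Lg g (MvPolynomial.X i) = g {i} := by
  rw [MvPolynomial.X, Lg_monomial, one_mul, Finsupp.support_single_ne_zero _ one_ne_zero]

theorem pd_of_g {d : ℕ} {G : Graph n} {g : Finset (Fin n) → ℝ} (h0 : g ∅ = 1)
    (hc : ∀ S, ¬ IsClique G S → g S = 0)
    (hp : ∀ P : Finset (Fin n) → ℝ, (∀ I, ¬ (IsClique G I ∧ I.card ≤ d / 2) → P I = 0) →
      0 ≤ ∑ I, ∑ J, P I * P J * g (I ∪ J)) :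
    IsCliquePseudoDist n d G (Lg g) := by
  refine ⟨?_, ?_, ?_, ?_⟩
  · rw [show (1 : MvPolynomial (Fin n) ℝ) = MvPolynomial.monomial 0 1 from rfl, Lg_monomial]
    simp [h0]
  · intro i p _
    rw [MvPolynomial.X_pow_eq_monomial, MvPolynomial.X, Lg_monomial_mul, Lg_monomial_mul,
      Finsupp.support_single_ne_zero _ two_ne_zero, Finsupp.support_single_ne_zero _ one_ne_zero]
  · intro i j hij he p _
    rw [MvPolynomial.X, MvPolynomial.X, MvPolynomial.monomial_mul, one_mul, Lg_monomial_mul]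
    apply sum_eq_zero
    intro k _
    rw [hc, mul_zero]
    intro hcl
    exact he (hcl i (by simp [hij]) j (by simp [hij]) hij)
  · intro p hdeg
    set P : Finset (Fin n) → ℝ := fun I => ∑ k ∈ p.support.filter (fun k => k.support = I), p.coeff k with hP
    have e1 : Lg g (p ^ 2) = ∑ I, ∑ J, P I * P J * g (I ∪ J) := by
      have : Lg g (p ^ 2) = ∑ k ∈ p.support, ∑ k' ∈ p.support,
          p.coeff k * p.coeff k' * g (k.support ∪ k'.support) := by
        rw [sq]
        conv_lhs => rw [p.as_sum]
        rw [sum_mul, map_sum]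
        apply sum_congr rfl
        intro k _
        rw [← p.as_sum]
        have : MvPolynomial.monomial k (p.coeff k) * p =
            p.coeff k • (MvPolynomial.monomial k (1:ℝ) * p) := by
          rw [← smul_mul_assoc, MvPolynomial.smul_monomial]; simp
        rw [this, map_smul, Lg_monomial_mul, smul_eq_mul, mul_sum]
        apply sum_congr rfl
        intro k' _
        ring
      rw [this, ← sum_fiberwise p.support (fun k => k.support)]
      apply sum_congr rfl
      intro I _
      rw [sum_comm, ← sum_fiberwise p.support (fun k => k.support)]
      apply sum_congr rfl
      intro J _
      simp only [hP]
      rw [sum_mul_sum, sum_mul, sum_comm]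
      apply sum_congr rfl
      intro k hk
      rw [sum_mul]
      apply sum_congr rfl
      intro k' hk'
      rw [(mem_filter.1 hk).2, (mem_filter.1 hk').2]
    rw [e1]
    have h2 := hp (fun I => if IsClique G I then P I else 0) (by
      intro I hI
      split_ifs with h
      · have hI' : ¬ I.card ≤ d / 2 := fun h' => hI ⟨h, h'⟩
        simp only [hP]
        apply sum_eq_zero
        intro k hk
        exfalso
        simp only [mem_filter] at hk
        apply hI'
        rw [← hk.2]
        refine le_trans ?_ ((MvPolynomial.le_totalDegree hk.1).trans hdeg)
        rw [Finsupp.sum, card_eq_sum_ones]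
        apply sum_le_sum
        intro v hv
        exact Nat.one_le_iff_ne_zero.2 (Finsupp.mem_support_iff.1 hv)
      · rfl)
    refine h2.trans (le_of_eq ?_)
    refine sum_congr rfl (fun I _ => sum_congr rfl (fun J _ => ?_))
    by_cases hI : IsClique G I
    · by_cases hJ : IsClique G J
      · simp [hI, hJ]
      · rw [hc (I ∪ J)]
        · simp
        · intro h; exact hJ (fun i hi j hj => h i (mem_union_right _ hi) j (mem_union_right _ hj))
    · rw [hc (I ∪ J)]
      · simp
      · intro h; exact hI (fun i hi j hj => h i (mem_union_left _ hi) j (mem_union_left _ hj))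

/-- Moebius inversion -/
theorem moebius (P : Finset (Fin n) → ℝ) (I : Finset (Fin n)) :
    ∑ W ∈ I.powerset, (-1 : ℝ) ^ W.card * ∑ J ∈ (I \ W).powerset, P J = P I := by
  simp only [mul_sum]
  rw [sum_comm' (t' := I.powerset) (s' := fun J => (I \ J).powerset)]
  · have h : ∀ J ∈ I.powerset, ∑ W ∈ (I \ J).powerset, (-1 : ℝ) ^ W.card * P J =
        if J = I then P I else 0 := by
      intro J hJ
      rw [mem_powerset] at hJ
      rw [← sum_mul]
      have := Finset.sum_powerset_neg_one_pow_card (x := I \ J)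
      have h2 : ∑ W ∈ (I \ J).powerset, (-1 : ℝ) ^ W.card = if I \ J = ∅ then 1 else 0 := by
        exact_mod_cast this
      rw [h2]
      by_cases hJI : J = I
      · simp [hJI]
      · have : ¬ I \ J = ∅ := by
          rw [sdiff_eq_empty_iff_subset]
          intro h; exact hJI (subset_antisymm hJ h)
        simp [hJI, this]
    rw [sum_congr rfl h, sum_ite_eq']
    simp
  · intro W J
    simp only [mem_powerset]
    constructor
    · rintro ⟨h1, h2⟩
      refine ⟨?_, h2.trans sdiff_subset⟩
      intro v hv
      rw [mem_sdiff]
      exact ⟨h1 hv, fun h => (mem_sdiff.1 (h2 h)).2 hv⟩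
    · rintro ⟨h1, h2⟩
      refine ⟨h1.trans sdiff_subset, ?_⟩
      intro v hv
      rw [mem_sdiff]
      exact ⟨h2 hv, fun h => (mem_sdiff.1 (h1 h)).2 hv⟩

noncomputable def cl (G : Graph n) (D : ℕ) : Finset (Finset (Fin n)) :=
  univ.filter (fun I => IsClique G I ∧ I.card ≤ D)

/-- average over small cliques -/
noncomputable def hS (G : Graph n) (D : ℕ) (S : Finset (Fin n)) : ℝ :=
  (∑ U ∈ cl G D, if S ⊆ U then 1 else 0) / (cl G D).card

theorem isClique_sub {G : Graph n} {S U : Finset (Fin n)} (h : IsClique G U) (hs : S ⊆ U) :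
    IsClique G S := fun i hi j hj => h i (hs hi) j (hs hj)

theorem cl_pos (G : Graph n) (D : ℕ) : 0 < (cl G D).card := by
  apply card_pos.2
  exact ⟨∅, mem_filter.2 ⟨mem_univ _, by simp [IsClique], by simp⟩⟩

theorem hS_empty (G : Graph n) (D : ℕ) : hS G D ∅ = 1 := by
  have := cl_pos G D
  have h2 : ((cl G D).card : ℝ) ≠ 0 := by positivity
  simp [hS, h2]

theorem hS_nonneg (G : Graph n) (D : ℕ) (S : Finset (Fin n)) : 0 ≤ hS G D S := by
  unfold hS
  apply div_nonneg
  · apply sum_nonneg; intro U _; split_ifs <;> norm_num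
  · positivity

theorem hS_zero {G : Graph n} {D : ℕ} {S : Finset (Fin n)} (h : ¬ IsClique G S) : hS G D S = 0 := by
  unfold hS
  rw [sum_eq_zero, zero_div]
  intro U hU
  simp only [cl, mem_filter] at hU
  rw [if_neg]
  intro hs
  exact h (isClique_sub hU.2.1 hs)

theorem hS_form {G : Graph n} {D : ℕ} {P : Finset (Fin n) → ℝ}
    (hP : ∀ I, ¬ (IsClique G I ∧ I.card ≤ D) → P I = 0) :
    ∑ I, P I ^ 2 ≤ (2 ^ D * (((n:ℝ) + 1) ^ D) ^ 2) * ∑ I, ∑ J, P I * P J * hS G D (I ∪ J) := by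
  set Z : Finset (Fin n) → ℝ := fun U => ∑ J ∈ U.powerset, P J with hZ
  set Nc := ((cl G D).card : ℝ) with hNc
  have hNc0 : 0 < Nc := Nat.cast_pos.2 (cl_pos G D)
  have e1 : ∑ I, ∑ J, P I * P J * hS G D (I ∪ J) = (∑ U ∈ cl G D, Z U ^ 2) / Nc := by
    have h1 : ∀ U, Z U = ∑ I, if I ⊆ U then P I else 0 := by
      intro U
      simp only [hZ]
      rw [← sum_filter]
      apply sum_congr _ (fun _ _ => rfl)
      ext J; simp
    have h2 : ∀ U, Z U ^ 2 = ∑ I, ∑ J, P I * P J * (if I ∪ J ⊆ U then 1 else 0) := by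
      intro U
      rw [h1, sq, sum_mul_sum]
      refine sum_congr rfl (fun I _ => sum_congr rfl (fun J _ => ?_))
      by_cases hI : I ⊆ U <;> by_cases hJ : J ⊆ U <;> simp [hI, hJ, union_subset_iff]
    rw [sum_congr rfl (fun U _ => h2 U), sum_comm (s := cl G D), sum_div]
    apply sum_congr rfl
    intro I _
    rw [sum_comm (s := cl G D), sum_div]
    apply sum_congr rfl
    intro J _
    rw [← mul_sum, mul_div_assoc]
    rfl
  have e2 : ∀ I ∈ cl G D, P I ^ 2 ≤ 2 ^ D * ∑ U ∈ cl G D, Z U ^ 2 := by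
    intro I hI
    simp only [cl, mem_filter, mem_univ, true_and] at hI
    rw [← moebius P I]
    have h1 := Finset.sum_mul_sq_le_sq_mul_sq I.powerset (fun W => (-1:ℝ) ^ W.card) (fun W => Z (I \ W))
    refine h1.trans ?_
    have h2 : ∑ W ∈ I.powerset, ((-1:ℝ) ^ W.card) ^ 2 ≤ 2 ^ D := by
      have : ∀ W ∈ I.powerset, ((-1:ℝ) ^ W.card) ^ 2 = 1 := by
        intro W _; rw [← pow_mul, mul_comm, pow_mul]; simp
      rw [sum_congr rfl this, sum_const, card_powerset]
      simp only [nsmul_eq_mul, mul_one, Nat.cast_pow, Nat.cast_ofNat]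
      exact pow_le_pow_right₀ (by norm_num) hI.2
    have h3 : ∑ W ∈ I.powerset, Z (I \ W) ^ 2 ≤ ∑ U ∈ cl G D, Z U ^ 2 := by
      rw [← sum_image (s := I.powerset) (g := fun W => I \ W) (f := fun U => Z U ^ 2)]
      · apply sum_le_sum_of_subset_of_nonneg
        · intro U hU
          simp only [mem_image, mem_powerset] at hU
          obtain ⟨W, _, rfl⟩ := hU
          simp only [cl, mem_filter, mem_univ, true_and]
          exact ⟨isClique_sub hI.1 sdiff_subset, (card_le_card sdiff_subset).trans hI.2⟩
        · intros; positivity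
      · intro W hW W' hW' h
        simp only [coe_powerset, Set.mem_preimage, Set.mem_powerset_iff, coe_subset] at hW hW'
        simp only at h
        rw [← Finset.sdiff_sdiff_eq_self hW, ← Finset.sdiff_sdiff_eq_self hW', h]
    exact mul_le_mul h2 h3 (by positivity) (by positivity)
  have e3 : ∑ I, P I ^ 2 = ∑ I ∈ cl G D, P I ^ 2 := by
    symm
    apply sum_subset (subset_univ _)
    intro I _ hI
    simp only [cl, mem_filter, mem_univ, true_and] at hI
    rw [hP I hI]; simp
  have e4 : Nc ≤ ((n:ℝ) + 1) ^ D := by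
    refine le_trans ?_ (card_small (n := n) D)
    rw [hNc]
    exact_mod_cast card_le_card (fun I hI => by
      simp only [cl, mem_filter, mem_univ, true_and] at hI ⊢; exact hI.2)
  rw [e1, e3]
  refine (sum_le_card_nsmul _ _ _ e2).trans ?_
  rw [nsmul_eq_mul, ← hNc, ← mul_div_assoc, le_div_iff₀ hNc0]
  have h5 : (0:ℝ) ≤ 2 ^ D * ∑ U ∈ cl G D, Z U ^ 2 := by positivity
  calc _ = Nc * Nc * (2 ^ D * ∑ U ∈ cl G D, Z U ^ 2) := by ring
    _ ≤ (((n:ℝ) + 1) ^ D * ((n:ℝ) + 1) ^ D) * (2 ^ D * ∑ U ∈ cl G D, Z U ^ 2) := by gcongr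
    _ = _ := by ring

end PlantedClique
end

section
namespace PlantedClique
variable {n : ℕ}

theorem EE_empty : EE (∅ : Finset (Fin n)) = ∅ := by
  apply card_eq_zero.1
  by_contra h
  obtain ⟨e, he⟩ := card_pos.1 (Nat.pos_of_ne_zero h)
  obtain ⟨e, hd⟩ := e
  induction e using Sym2.ind with
  | _ x y =>
    simp [EE, supp] at he
    exact (@he x).1 rfl

theorem sig_le_one {t : ℝ} (ht : 0 < t) {D : ℕ} (h : t * √2 ^ D ≤ 1) {A : Finset (Fin n)} (hA : A.card ≤ D) :
    sig t A ≤ 1 := by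
  have h1 : (EE A).card ≤ A.card * A.card := by
    have h2 := EE_card_le (empty_subset A)
    have h3 : EE (∅ : Finset (Fin n)) = ∅ := EE_empty
    rw [h3] at h2
    simpa using h2
  unfold sig
  calc t ^ A.card * √2 ^ (EE A).card ≤ t ^ A.card * √2 ^ (D * A.card) := by
        have := one_le_sqrt2
        gcongr
        exact h1.trans (Nat.mul_le_mul_right _ hA)
    _ = (t * √2 ^ D) ^ A.card := by rw [mul_pow, pow_mul]
    _ ≤ 1 := pow_le_one₀ (by positivity) h

theorem KM_form (S : Finset (Comp n)) {t : ℝ} (ht : 0 < t) (G : Graph n) (P : Finset (Fin n) → ℝ) :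
    ∑ A, ∑ B, P A * Ker S (t ^ 2) G A B * P B =
      ∑ A, ∑ B, (sig t A * P A) * KM S t G A B * (sig t B * P B) := by
  refine sum_congr rfl (fun A _ => sum_congr rfl (fun B _ => ?_))
  have h1 := (sig_pos ht A).ne'
  have h2 := (sig_pos ht B).ne'
  show _ = (sig t A * P A) * (Ker S (t ^ 2) G A B / (sig t A * sig t B)) * (sig t B * P B)
  field_simp

theorem quad_decomp {τ D : ℕ} {t : ℝ} (ht : 0 < t) (hDτ : D ≤ τ) (G : Graph n)
    (P : Finset (Fin n) → ℝ) (hP : ∀ I, ¬ I.card ≤ D → P I = 0)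
    (u : Finset (Fin n) → ℝ)
    (hu : ∀ A, u A = if IsClique G A then sig t A * ∑ I, P I * Lm τ (t ^ 2) G I A else 0) :
    ∑ I, ∑ J, P I * P J * fS τ (t ^ 2) G (I ∪ J) =
      ∑ A, u A ^ 2 + ∑ A, ∑ B, u A * KM (CN n D τ) t G A B * u B +
      ∑ A, ∑ B, (sig t A * P A) * KM (CErr n D τ) t G A B * (sig t B * P B) := by
  set q := t ^ 2 with hq
  set v : Finset (Fin n) → ℝ := fun A => ∑ I, P I * Lm τ q G I A with hv
  have hv0 : ∀ A, ¬ A.card ≤ D → v A = 0 := by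
    intro A hA
    apply sum_eq_zero
    intro I _
    by_cases hI : I.card ≤ D
    · rw [Lm_of_card_le (by omega), if_neg, mul_zero]
      rintro rfl; exact hA hI
    · rw [hP I hI, zero_mul]
  have e1 : ∑ I, ∑ J, P I * P J * fS τ q G (I ∪ J) =
      ∑ A, ∑ B, v A * Ker (CQ n D τ) q G A B * v B + ∑ A, ∑ B, P A * Ker (CErr n D τ) q G A B * P B := by
    have h1 : ∀ I J, P I * P J * fS τ q G (I ∪ J) =
        ∑ A, ∑ B, (P I * Lm τ q G I A) * Ker (CQ n D τ) q G A B * (P J * Lm τ q G J B)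
          + P I * Ker (CErr n D τ) q G I J * P J := by
      intro I J
      by_cases hI : I.card ≤ D
      · by_cases hJ : J.card ≤ D
        · rw [← Mf_eq_fS, decomp D τ q G hI hJ, mul_add, mul_sum]
          congr 1
          · refine sum_congr rfl (fun A _ => ?_)
            rw [mul_sum]
            refine sum_congr rfl (fun B _ => ?_)
            ring
          · ring
        · simp [hP J hJ]
      · simp [hP I hI]
    simp_rw [h1, sum_add_distrib]
    congr 1
    simp only [hv]
    calc _ = ∑ I, ∑ A, ∑ J, ∑ B, (P I * Lm τ q G I A) * Ker (CQ n D τ) q G A B * (P J * Lm τ q G J B) :=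
          sum_congr rfl (fun I _ => sum_comm)
      _ = ∑ A, ∑ I, ∑ B, ∑ J, (P I * Lm τ q G I A) * Ker (CQ n D τ) q G A B * (P J * Lm τ q G J B) := by
          rw [sum_comm]
          exact sum_congr rfl (fun A _ => sum_congr rfl (fun I _ => sum_comm))
      _ = _ := by
          refine sum_congr rfl (fun A _ => ?_)
          rw [sum_comm]
          refine sum_congr rfl (fun B _ => ?_)
          rw [sum_mul, sum_mul]
          refine sum_congr rfl (fun I _ => ?_)
          rw [mul_sum]
  rw [e1, hq, KM_form _ ht G P]
  congr 1
  have h2 : ∀ A B, v A * Ker (CQ n D τ) q G A B * v B =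
      (if A = B then u A ^ 2 else 0) + u A * KM (CN n D τ) t G A B * u B := by
    intro A B
    have hA' := (sig_pos ht A).ne'
    have hB' := (sig_pos ht B).ne'
    rw [Ker_CQ_split, mul_add, add_mul]
    congr 1
    · by_cases hAB : A = B
      · subst hAB
        rw [if_pos rfl, hu]
        by_cases hc : IsClique G A
        · by_cases hD : A.card ≤ D
          · rw [if_pos ⟨rfl, hD, hD.trans hDτ, hc⟩, if_pos hc, mul_pow, sig_sq]
            ring
          · have := hv0 A hD
            simp only [hv] at this
            rw [this]
            simp [hv0 A hD]
        · simp [hc]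
      · simp [hAB]
    · rw [hu, hu]
      show _ = _ * (Ker (CN n D τ) (t ^ 2) G A B / (sig t A * sig t B)) * _
      by_cases hA : IsClique G A
      · by_cases hB : IsClique G B
        · simp only [hA, hB, and_self, if_true]
          rw [← hq]
          field_simp
          simp only [hv]; ring
        · simp [hB]
      · simp [hA]
  rw [← hq]
  simp_rw [h2, sum_add_distrib]
  simp

/-- the two-sided bound -/
theorem quad_bound {τ D : ℕ} {t η : ℝ} (ht : 0 < t) (htD : t * √2 ^ D ≤ 1) (hη : 0 ≤ η) (hDτ : D ≤ τ) (G : Graph n)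
    (hN : ∀ u : Finset (Fin n) → ℝ, |∑ A, ∑ B, u A * KM (CN n D τ) t G A B * u B| ≤ (1/2) * ∑ A, u A ^ 2)
    (hE : ∀ u : Finset (Fin n) → ℝ, |∑ A, ∑ B, u A * KM (CErr n D τ) t G A B * u B| ≤ η * ∑ A, u A ^ 2)
    (P : Finset (Fin n) → ℝ) (hP : ∀ I, ¬ I.card ≤ D → P I = 0)
    (u : Finset (Fin n) → ℝ)
    (hu : ∀ A, u A = if IsClique G A then sig t A * ∑ I, P I * Lm τ (t ^ 2) G I A else 0) :
    |∑ I, ∑ J, P I * P J * fS τ (t ^ 2) G (I ∪ J) - ∑ A, u A ^ 2| ≤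
      (1/2) * ∑ A, u A ^ 2 + η * ∑ I, P I ^ 2 := by
  rw [quad_decomp ht hDτ G P hP u hu]
  have h1 := hN u
  have h2 := hE (fun A => sig t A * P A)
  have h3 : ∑ A, (sig t A * P A) ^ 2 ≤ ∑ I, P I ^ 2 := by
    apply sum_le_sum
    intro A _
    by_cases hA : A.card ≤ D
    · rw [mul_pow]
      have h4 := sig_le_one ht htD hA
      have h5 := sig_pos ht A
      have : sig t A ^ 2 ≤ 1 := pow_le_one₀ h5.le h4
      exact mul_le_of_le_one_left (sq_nonneg _) this
    · simp [hP A hA]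
  have h4 := mul_le_mul_of_nonneg_left h3 hη
  rw [abs_le] at *
  constructor <;> linarith

theorem quad_single (g : Finset (Fin n) → ℝ) (S : Finset (Fin n)) :
    ∑ I, ∑ J, (if I = S then (1:ℝ) else 0) * (if J = S then 1 else 0) * g (I ∪ J) = g S := by
  rw [sum_eq_single S]
  · rw [sum_eq_single S]
    · simp
    · intro J _ h; simp [h]
    · simp
  · intro J _ h; simp [h]
  · simp

theorem det_part {τ d : ℕ} {t η : ℝ} (ht : 0 < t) (hd : 1 ≤ d / 2) (htD : t * √2 ^ (d/2) ≤ 1) (hη : 0 ≤ η)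
    (hη4 : η ≤ 1/4) (hηt : η ≤ t ^ 2 / 2) (hη' : η * (2 ^ (d/2) * (((n:ℝ) + 1) ^ (d/2)) ^ 2) ≤ 1/4) (hDτ : d/2 ≤ τ) (G : Graph n)
    (hN : ∀ u : Finset (Fin n) → ℝ, |∑ A, ∑ B, u A * KM (CN n (d/2) τ) t G A B * u B| ≤ (1/2) * ∑ A, u A ^ 2)
    (hE : ∀ u : Finset (Fin n) → ℝ, |∑ A, ∑ B, u A * KM (CErr n (d/2) τ) t G A B * u B| ≤ η * ∑ A, u A ^ 2) :
    ∃ L : MvPolynomial (Fin n) ℝ →ₗ[ℝ] ℝ, IsCliquePseudoDist n d G L ∧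
      n * (t ^ 2 / 2 - η) / 4 ≤ L (∑ i : Fin n, MvPolynomial.X i) := by
  set D := d / 2 with hD
  set f := fS τ (t ^ 2) G with hf
  have hQ : ∀ P : Finset (Fin n) → ℝ, (∀ I, ¬ I.card ≤ D → P I = 0) →
      ∀ u : Finset (Fin n) → ℝ, (∀ A, u A = if IsClique G A then sig t A * ∑ I, P I * Lm τ (t ^ 2) G I A else 0) →
      |∑ I, ∑ J, P I * P J * f (I ∪ J) - ∑ A, u A ^ 2| ≤ (1/2) * ∑ A, u A ^ 2 + η * ∑ I, P I ^ 2 :=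
    fun P hP u hu => quad_bound ht htD hη hDτ G hN hE P hP u hu
  have hclE : IsClique G ∅ := by simp [IsClique]
  have hsum1 : ∀ S : Finset (Fin n), ∑ I : Finset (Fin n), (if I = S then (1:ℝ) else 0) ^ 2 = 1 := by
    intro S; simp
  -- the empty set
  have f0 : |f ∅ - 1| ≤ 1/2 + η := by
    have := hQ (fun I => if I = ∅ then 1 else 0) (by
      intro I hI; rw [if_neg]; rintro rfl; simp at hI) (fun A => if A = ∅ then 1 else 0) (by
      intro A
      by_cases hA : A = ∅
      · subst hA
        have h1 := sig_sq t (∅ : Finset (Fin n))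
        simp [hclE]
        rw [Lm_of_card_le le_rfl]
        simp [sig, EE_empty]
      · have hA' : ¬ ∅ = A := fun h => hA h.symm
        have h5 := Lm_of_card_le (τ := τ) (q := t ^ 2) (G := G) (I := ∅) (A := A) (by simp)
        simp [hA, h5])
    simp only [hsum1, quad_single] at this
    linarith
  have f0' := abs_le.1 f0
  have fpos : 0 < f ∅ := by linarith
  have fi : ∀ i : Fin n, t ^ 2 / 2 - η ≤ f {i} := by
    intro i
    set P : Finset (Fin n) → ℝ := fun I => if I = {i} then 1 else 0 with hP
    set u : Finset (Fin n) → ℝ := fun A => if IsClique G A then sig t A * ∑ I, P I * Lm τ (t ^ 2) G I A else 0 with hu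
    have h1 := hQ P (by
      intro I hI; simp only [hP]; rw [if_neg]; rintro rfl; simp at hI; omega) u (fun A => rfl)
    have h2 : t ^ 2 ≤ ∑ A, u A ^ 2 := by
      refine le_trans ?_ (single_le_sum (f := fun A => u A ^ 2) (fun A _ => sq_nonneg _) (mem_univ {i}))
      have hc : IsClique G {i} := by
        intro a ha b hb hab
        simp at ha hb; exact absurd (ha.trans hb.symm) hab
      simp only [hu, hP, if_pos hc]
      simp only [ite_mul, one_mul, zero_mul, sum_ite_eq', mem_univ, if_true]
      rw [Lm_of_card_le le_rfl, if_pos rfl, mul_one, sig_sq]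
      simp only [card_singleton, pow_one]
      exact le_mul_of_one_le_right (sq_nonneg _) (one_le_pow₀ (by norm_num))
    simp only [hP, hsum1, quad_single] at h1
    have h3 := (abs_le.1 h1).1
    linarith
  set g : Finset (Fin n) → ℝ := fun S => (1/2) * (f S / f ∅) + (1/2) * hS G D S with hg
  refine ⟨Lg g, pd_of_g ?_ ?_ ?_, ?_⟩
  · simp only [hg, hS_empty, div_self fpos.ne']; norm_num
  · intro S h
    simp only [hg, hf, fS_zero h, hS_zero h]; simp
  · intro P hP
    have hform := hS_form hP
    set Q := ∑ I, ∑ J, P I * P J * hS G D (I ∪ J) with hQdef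
    have h1 : ∑ I, ∑ J, P I * P J * g (I ∪ J) =
        (1/2) * ((∑ I, ∑ J, P I * P J * f (I ∪ J)) / f ∅ + Q) := by
      rw [hQdef, sum_div, ← sum_add_distrib, mul_sum]
      refine sum_congr rfl (fun I _ => ?_)
      rw [sum_div, ← sum_add_distrib, mul_sum]
      refine sum_congr rfl (fun J _ => ?_)
      simp only [hg]
      ring
    rw [h1]
    have h2 := (abs_le.1 (hQ P (fun I hI => hP I (fun h => hI h.2)) _ (fun A => rfl))).1
    set U := ∑ A, (if IsClique G A then sig t A * ∑ I, P I * Lm τ (t ^ 2) G I A else 0) ^ 2 with hU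
    have hU0 : 0 ≤ U := sum_nonneg (fun _ _ => sq_nonneg _)
    have hQ0 : 0 ≤ ∑ I, P I ^ 2 := sum_nonneg (fun _ _ => sq_nonneg _)
    set W := ∑ I, ∑ J, P I * P J * f (I ∪ J)
    set Y := ∑ I, P I ^ 2
    have hpos : (0:ℝ) < 2 ^ D * (((n:ℝ) + 1) ^ D) ^ 2 := by positivity
    have hQnn : 0 ≤ Q := by
      by_contra hneg
      push Not at hneg
      have := mul_neg_of_pos_of_neg hpos hneg
      linarith
    have h4 : η * Y ≤ (1/4) * Q := by
      calc η * Y ≤ η * ((2 ^ D * (((n:ℝ) + 1) ^ D) ^ 2) * Q) := mul_le_mul_of_nonneg_left hform hη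
        _ = (η * (2 ^ D * (((n:ℝ) + 1) ^ D) ^ 2)) * Q := by ring
        _ ≤ (1/4) * Q := mul_le_mul_of_nonneg_right hη' hQnn
    have h5 : -((1/4) * Q) ≤ W := by linarith
    have h6 : -Q ≤ W / f ∅ := by
      rw [le_div_iff₀ fpos]
      have : (1/4) * Q ≤ Q * f ∅ := by nlinarith
      linarith
    linarith
  · rw [map_sum]
    have h1 : ∀ i : Fin n, (t ^ 2 / 2 - η) / 4 ≤ Lg g (MvPolynomial.X i) := by
      intro i
      rw [Lg_X]
      have h2 := hS_nonneg G D {i}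
      have h3 := fi i
      have h4 : (t ^ 2 / 2 - η) / 2 ≤ f {i} / f ∅ := by
        rw [le_div_iff₀ fpos]
        have : (t ^ 2 / 2 - η) / 2 * f ∅ ≤ (t ^ 2 / 2 - η) / 2 * 2 :=
          mul_le_mul_of_nonneg_left (by linarith) (by linarith)
        linarith
      simp only [hg]
      linarith
    have h2 := sum_le_sum (fun i (_ : i ∈ univ) => h1 i)
    refine le_trans (le_of_eq ?_) h2
    simp
    ring

end PlantedClique
end

section
namespace PlantedClique
variable {n : ℕ}

theorem prob_union (P A B : Graph n → Prop) (h : ∀ G, ¬ A G → ¬ B G → P G) :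
    1 - (probGraph n A + probGraph n B) ≤ probGraph n P := by
  unfold probGraph
  have hc : (0:ℝ) < Fintype.card (Graph n) := by exact_mod_cast Fintype.card_pos
  rw [← add_div, sub_le_iff_le_add, ← add_div, le_div_iff₀ hc, one_mul]
  have h1 : (univ : Finset (Graph n)) ⊆ univ.filter P ∪ (univ.filter A ∪ univ.filter B) := by
    intro G _
    simp only [mem_union, mem_filter, mem_univ, true_and]
    by_contra hh
    push Not at hh
    exact hh.1 (h G hh.2.1 hh.2.2)
  have h2 := (card_le_card h1).trans ((card_union_le _ _).trans (Nat.add_le_add_left (card_union_le _ _) _))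
  rw [card_univ] at h2
  exact_mod_cast h2

theorem prob_one (P : Graph n → Prop) (h : ∀ G, P G) : probGraph n P = 1 := by
  unfold probGraph
  have hc : (0:ℝ) < Fintype.card (Graph n) := by exact_mod_cast Fintype.card_pos
  rw [filter_true_of_mem (fun G _ => h G), card_univ, div_self hc.ne']

theorem triv_a {d : ℕ} (hd : d / 2 = 0) (G : Graph n) :
    ∃ L : MvPolynomial (Fin n) ℝ →ₗ[ℝ] ℝ, IsCliquePseudoDist n d G L ∧
      (n : ℝ) ≤ L (∑ i : Fin n, MvPolynomial.X i) := by
  refine ⟨Lg (fun S => if S.card ≤ 1 then 1 else 0), pd_of_g (by simp) ?_ ?_, ?_⟩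
  · intro S h
    rw [if_neg]
    intro hS
    apply h
    intro i hi j hj hij
    exact absurd (card_le_one.1 hS i hi j hj) hij
  · intro P hP
    have h0 : ∀ I, I ≠ ∅ → P I = 0 := by
      intro I hI
      apply hP
      rintro ⟨_, h⟩
      rw [hd] at h
      exact hI (card_eq_zero.1 (Nat.le_zero.1 h))
    rw [sum_eq_single ∅, sum_eq_single ∅]
    · simp [mul_self_nonneg]
    · intro J _ h; simp [h0 J h]
    · simp
    · intro J _ h; simp [h0 J h]
    · simp
  · rw [map_sum]
    simp [Lg_X]

theorem triv_b {d : ℕ} (v : Fin n) (G : Graph n) :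
    ∃ L : MvPolynomial (Fin n) ℝ →ₗ[ℝ] ℝ, IsCliquePseudoDist n d G L ∧
      (1 : ℝ) ≤ L (∑ i : Fin n, MvPolynomial.X i) := by
  refine ⟨Lg (fun S => if S ⊆ {v} then 1 else 0), pd_of_g (by simp) ?_ ?_, ?_⟩
  · intro S h
    rw [if_neg]
    intro hS
    apply h
    intro i hi j hj hij
    have h1 := hS hi
    have h2 := hS hj
    rw [mem_singleton] at h1 h2
    exact absurd (h1.trans h2.symm) hij
  · intro P _
    have : ∑ I, ∑ J, P I * P J * (if I ∪ J ⊆ {v} then (1:ℝ) else 0) =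
        (∑ I : Finset (Fin n), if I ⊆ {v} then P I else 0) ^ 2 := by
      rw [sq, sum_mul_sum]
      refine sum_congr rfl (fun I _ => sum_congr rfl (fun J _ => ?_))
      by_cases hI : I ⊆ {v} <;> by_cases hJ : J ⊆ {v} <;> simp only [union_subset_iff, hI, hJ] <;> simp
    rw [this]
    positivity
  · rw [map_sum]
    simp [Lg_X]

theorem prob_part {d τ s Λ : ℕ} {t ν y η : ℝ} (V : ℝ) (ht : 0 < t) (hd : 1 ≤ d / 2) (htD : t * √2 ^ (d/2) ≤ 1)
    (hη : 0 < η) (hη4 : η ≤ 1/4) (hηt : η ≤ t ^ 2 / 2)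
    (hη' : η * (2 ^ (d/2) * (((n:ℝ) + 1) ^ (d/2)) ^ 2) ≤ 1/4) (hDτ : d/2 ≤ τ)
    (hν : 1 ≤ ν) (hνn : ν ^ 4 = n) (hy0 : 0 < y) (hy1 : y ≤ 1)
    (hy : t * √2 ^ (τ + d/2) * ν ≤ y ^ 2) (hΛ : 1 ≤ Λ)
    (hΛ' : 2 ^ (s+1) * ((4 * (d/2) + 3) * (τ + d/2)) + d/2 ≤ Λ)
    (hV : V ≤ n * (t ^ 2 / 2 - η) / 4) :
    1 - (((n:ℝ) + 1) ^ (d/2) * ((y * ((2 * (d/2:ℕ) + 2) * Real.exp (3 * Λ * y) ^ (4 * (d/2) + 3))) / (1/2)) ^ (2 ^ (s+1))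
      + ((n:ℝ) + 1) ^ (d/2) * ((ν ^ (2 * (d/2)) * y ^ (2 * τ - 2 * (d/2)) *
        ((2 * (d/2:ℕ) + 2) * Real.exp (3 * Λ * y) ^ (4 * (d/2) + 3))) / η) ^ (2 ^ (s+1))) ≤
      probGraph n (fun G => ∃ L : MvPolynomial (Fin n) ℝ →ₗ[ℝ] ℝ, IsCliquePseudoDist n d G L ∧
        V ≤ L (∑ i : Fin n, MvPolynomial.X i)) := by
  have hm : 1 ≤ 2 ^ (s+1) := Nat.one_le_two_pow
  have m1 := moment (n := n) ht hν hνn hy0 hy1 hy (fun c hc => CN_fam (D := d/2) (τ := τ) hc) hm hΛ hΛ'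
  have m2 := moment (n := n) ht hν hνn hy0 hy1 hy (fun c hc => CErr_fam (D := d/2) (τ := τ) hc) hm hΛ hΛ'
  have p1 := markov (fun c hc => CN_tr hc) t s (η := 1/2) (by norm_num) m1
  have p2 := markov (fun c hc => CErr_tr hc) t s hη m2
  rw [pow_zero, one_mul, pow_one] at p1
  refine le_trans ?_ (prob_union _
    (fun G => ¬ (KM (CN n (d/2) τ) t G ^ (2^(s+1))).trace ≤ (1/2) ^ (2^(s+1)))
    (fun G => ¬ (KM (CErr n (d/2) τ) t G ^ (2^(s+1))).trace ≤ η ^ (2^(s+1))) ?_)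
  · linarith
  · intro G h1 h2
    simp only [not_not] at h1 h2
    obtain ⟨L, hL, hv⟩ := det_part (n := n) ht hd htD hη.le hη4 hηt hη' hDτ G
      (fun u => form_bound (KM_symm (fun c hc => CN_tr hc) t G) (by norm_num) s h1 u)
      (fun u => form_bound (KM_symm (fun c hc => CErr_tr hc) t G) hη.le s h2 u)
    exact ⟨L, hL, hV.trans hv⟩

end PlantedClique
end

section
namespace PlantedClique

/-- choice of a power of two -/
theorem exists_pow2 {x : ℝ} (hx : 1 ≤ x) : ∃ s : ℕ, x ≤ (2:ℝ) ^ (s+1) ∧ (2:ℝ) ^ (s+1) ≤ 2 * x := by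
  obtain ⟨s, h1, h2⟩ := exists_nat_pow_near hx (by norm_num : (1:ℝ) < 2)
  exact ⟨s, h2.le, by rw [pow_succ]; linarith⟩

theorem large_facts : ∃ N : ℕ, ∀ n : ℕ, N ≤ n → 100000 ≤ Real.log n ∧
    10500 * 100 * Real.log n ^ 5 ≤ Real.exp (√(Real.log n)) := by
  have h1 : Filter.Tendsto (fun n : ℕ => Real.log n) Filter.atTop Filter.atTop :=
    Real.tendsto_log_atTop.comp tendsto_natCast_atTop_atTop
  have h2 := (h1.eventually_ge_atTop 100000)
  have h3 : Filter.Tendsto (fun x : ℝ => Real.exp x / x ^ 10) Filter.atTop Filter.atTop :=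
    Real.tendsto_exp_div_pow_atTop 10
  have h4 : Filter.Tendsto (fun n : ℕ => √(Real.log n)) Filter.atTop Filter.atTop :=
    Real.tendsto_sqrt_atTop.comp h1
  have h5 := (h3.comp h4).eventually_ge_atTop (10500 * 100)
  obtain ⟨N, hN⟩ := Filter.eventually_atTop.1 (h2.and h5)
  refine ⟨N, fun n hn => ⟨(hN n hn).1, ?_⟩⟩
  have h6 := (hN n hn).2
  have hL := (hN n hn).1
  simp only [Function.comp] at h6
  have h7 : √(Real.log n) ^ 10 = Real.log n ^ 5 := by
    rw [show (10:ℕ) = 2 * 5 from rfl, pow_mul, Real.sq_sqrt (by linarith)]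
  rw [h7, le_div_iff₀ (by positivity)] at h6
  exact h6

set_option maxHeartbeats 2000000 in
theorem main_case {n d : ℕ} {L w : ℝ} (hL : L = Real.log n) (hL0 : 100000 ≤ L)
    (hbig : 10500 * 100 * L ^ 5 ≤ Real.exp (√L)) (hd : 1 ≤ d / 2) (hw0 : 0 ≤ w) (hw : w ^ 2 = d * L)
    (hwL : 200 * w ≤ L) :
    1 - 2 * Real.exp (-(10 * L ^ 2)) ≤
      probGraph n (fun G => ∃ L' : MvPolynomial (Fin n) ℝ →ₗ[ℝ] ℝ, IsCliquePseudoDist n d G L' ∧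
        Real.exp (L / 2 - 100 * w) ≤ L' (∑ i : Fin n, MvPolynomial.X i)) := by
  have hn0 : (n : ℝ) ≠ 0 := by
    intro h; rw [h, Real.log_zero] at hL; linarith
  have hnpos : (0:ℝ) < n := lt_of_le_of_ne (by positivity) (Ne.symm hn0)
  have hn : (n : ℝ) = Real.exp L := by rw [hL, Real.exp_log hnpos]
  set D := d / 2 with hD
  have hD1 : (1:ℝ) ≤ D := by exact_mod_cast hd
  have hdD : 2 * (D:ℝ) ≤ d := by exact_mod_cast (by omega : 2 * D ≤ d)
  have hLpos : 0 < L := by linarith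
  have hw2 : 2 * D * L ≤ w ^ 2 := by rw [hw]; gcongr
  have hwL2 : √L ≤ w := by
    rw [Real.sqrt_le_left hw0]
    nlinarith
  have hw300 : 300 ≤ w := by
    refine le_trans ?_ hwL2
    rw [Real.le_sqrt (by norm_num) hLpos.le]; linarith
  have hDw : 400 * (D:ℝ) ≤ w := by
    have : 2 * D * L ≤ w * (L / 200) := by nlinarith
    have : (2 * D) * L ≤ (w / 200) * L := by linarith
    have := le_of_mul_le_mul_right this hLpos
    linarith
  have hexpw : 10500 * 100 * L ^ 5 ≤ Real.exp w := hbig.trans (Real.exp_le_exp.2 hwL2)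
  have hsq : √2 ≤ Real.exp 1 := by
    have h1 : √2 ≤ 2 := by rw [Real.sqrt_le_left (by norm_num)]; norm_num
    have := Real.add_one_le_exp (1:ℝ)
    linarith
  have hsqp : ∀ k : ℕ, √2 ^ k ≤ Real.exp k := by
    intro k
    rw [← Real.exp_one_pow]
    exact pow_le_pow_left₀ (by positivity) hsq k
  obtain ⟨s, hs1, hs2⟩ := exists_pow2 (x := 11 * L ^ 2) (by nlinarith)
  set τ := ⌈w⌉₊ with hτ
  have hτ1 : w ≤ τ := Nat.le_ceil w
  have hτ2 : (τ:ℝ) ≤ w + 1 := (Nat.ceil_lt_add_one hw0).le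
  have hDτ : D ≤ τ := by
    have : (D:ℝ) ≤ τ := by linarith
    exact_mod_cast this
  set t := Real.exp (-(L/4) - 25 * w) with ht
  set ν := Real.exp (L/4) with hν
  set y := Real.exp (-(2 * w)) with hy
  set η := Real.exp (-(4 * D * L)) with hη
  set m := 2 ^ (s+1) with hm
  have hmR : ((m:ℕ):ℝ) = (2:ℝ) ^ (s+1) := by rw [hm]; push_cast; rfl
  set Λ := m * ((4 * D + 3) * (τ + D)) + D with hΛ
  have hΛR : (Λ:ℝ) ≤ 500 * L ^ 4 := by
    rw [hΛ]; push_cast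
    rw [hmR]
    have a1 : (4 * (D:ℝ) + 3) * (τ + D) ≤ 7 * L * (3 * L) := by
      apply mul_le_mul <;> first | positivity | nlinarith
    have a2 : (2:ℝ) ^ (s+1) * ((4 * (D:ℝ) + 3) * (τ + D)) ≤ (2 * (11 * L ^ 2)) * (7 * L * (3 * L)) := by
      gcongr
    have a3 : (D:ℝ) ≤ L ^ 4 := by
      have : (D:ℝ) ≤ L := by linarith
      have : L ≤ L ^ 4 := le_self_pow₀ (by linarith) (by norm_num)
      linarith
    have a4 : (2 * (11 * L ^ 2)) * (7 * L * (3 * L)) = 462 * L ^ 4 := by ring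
    have : 0 ≤ L ^ 4 := by positivity
    linarith
  have hexp1 : Real.exp (3 * Λ * y) ^ (4 * D + 3) ≤ Real.exp 1 := by
    rw [← Real.exp_nat_mul]
    apply Real.exp_le_exp.2
    push_cast
    have a1 : (4 * (D:ℝ) + 3) ≤ 7 * L := by linarith
    have a2 : (4 * (D:ℝ) + 3) * (3 * Λ * y) ≤ (7 * L) * (3 * (500 * L ^ 4) * y) := by gcongr
    have a3 : y ≤ Real.exp (-w) := by
      apply Real.exp_le_exp.2; linarith
    have a4 : (7 * L) * (3 * (500 * L ^ 4) * y) ≤ Real.exp w * Real.exp (-w) := by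
      calc _ = (10500 * L ^ 5) * y := by ring
        _ ≤ Real.exp w * Real.exp (-w) := by
          apply mul_le_mul _ a3 (by positivity) (by positivity)
          have : 0 ≤ L ^ 5 := by positivity
          linarith
    rw [← Real.exp_add] at a4
    simp at a4
    linarith
  have hDexp : (2 * (D:ℝ) + 2) * Real.exp (3 * Λ * y) ^ (4 * D + 3) ≤ Real.exp w / 2 := by
    have a1 : Real.exp 1 ≤ 3 := by have := Real.exp_one_lt_d9; linarith
    have a2 : (2 * (D:ℝ) + 2) * Real.exp (3 * Λ * y) ^ (4 * D + 3) ≤ (2 * L) * 3 := by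
      apply mul_le_mul _ (hexp1.trans a1) (by positivity) (by positivity)
      linarith
    have a3 : L ≤ L ^ 5 := le_self_pow₀ (by linarith) (by norm_num)
    linarith
  set K := (2 * (D:ℝ) + 2) * Real.exp (3 * Λ * y) ^ (4 * D + 3) with hK
  have hK0 : 0 < K := by positivity
  have hn1 : (n:ℝ) + 1 ≤ Real.exp (L + 1) := by
    rw [Real.exp_add, ← hn]
    have := Real.add_one_le_exp (1:ℝ)
    have : (1:ℝ) ≤ n := by
      rw [hn]; exact Real.one_le_exp hLpos.le
    nlinarith
  have hX : ((n:ℝ) + 1) ^ D ≤ Real.exp (w ^ 2) := by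
    calc ((n:ℝ) + 1) ^ D ≤ Real.exp (L + 1) ^ D := by gcongr
      _ = Real.exp (D * (L + 1)) := by rw [← Real.exp_nat_mul]
      _ ≤ _ := Real.exp_le_exp.2 (by nlinarith)
  have hfin : ∀ Z : ℝ, 0 ≤ Z → Z ≤ Real.exp (-w) → ((n:ℝ) + 1) ^ D * Z ^ m ≤ Real.exp (-(10 * L ^ 2)) := by
    intro Z hZ0 hZ
    calc ((n:ℝ) + 1) ^ D * Z ^ m ≤ Real.exp (w ^ 2) * Real.exp (-w) ^ m := by gcongr
      _ = Real.exp (w ^ 2 + m * (-w)) := by rw [← Real.exp_nat_mul, ← Real.exp_add]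
      _ ≤ _ := by
        apply Real.exp_le_exp.2
        rw [hmR]
        have b1 : (11 * L ^ 2) * w ≤ (2:ℝ) ^ (s+1) * w := by gcongr
        have b2 : 11 * L ^ 2 ≤ 11 * L ^ 2 * w := le_mul_of_one_le_right (by positivity) (by linarith)
        have b3 : w ^ 2 ≤ L ^ 2 := by gcongr; linarith
        linarith
  have hvt : t ^ 2 = Real.exp (-(L/2) - 50 * w) := by
    rw [ht, ← Real.exp_nat_mul]; congr 1; push_cast; ring
  have hηt4 : η ≤ t ^ 2 / 4 := by
    rw [hvt, hη]
    have : Real.exp (-(4 * D * L)) ≤ Real.exp (-(L/2) - 50 * w) * Real.exp (-3) := by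
      rw [← Real.exp_add]
      apply Real.exp_le_exp.2
      have hDL : L ≤ D * L := le_mul_of_one_le_left hLpos.le hD1
      linarith
    have h3 : Real.exp (-3) ≤ 1/4 := by
      rw [Real.exp_neg, inv_le_comm₀ (Real.exp_pos _) (by norm_num)]
      have := Real.add_one_le_exp (3:ℝ)
      norm_num; linarith
    have := mul_le_mul_of_nonneg_left h3 (Real.exp_pos (-(L/2) - 50 * w)).le
    linarith
  have ht1 : t ≤ 1 := by rw [ht]; apply Real.exp_le_one_iff.2; linarith
  have htpos : 0 < t := Real.exp_pos _
  have ht21 : t ^ 2 ≤ 1 := pow_le_one₀ htpos.le ht1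
  have main := prob_part (n := n) (d := d) (τ := τ) (s := s) (Λ := Λ) (t := t) (ν := ν) (y := y) (η := η)
    (Real.exp (L / 2 - 100 * w)) htpos hd ?_ (Real.exp_pos _) (by linarith) (by linarith [sq_nonneg t]) ?_ hDτ
    (Real.one_le_exp (by linarith)) ?_ (Real.exp_pos _) ?_ ?_ ?_ (le_of_eq hΛ.symm) ?_
  · refine le_trans ?_ main
    have f1 := hfin (y * K / (1/2)) (by positivity) (by
      have : y * K ≤ y * (Real.exp w / 2) := by gcongr
      have e : y * (Real.exp w / 2) = Real.exp (-w) / 2 := by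
        rw [hy, ← mul_div_assoc, ← Real.exp_add]; congr 2; ring
      linarith)
    have f2 := hfin (ν ^ (2 * D) * y ^ (2 * τ - 2 * D) * K / η) (by positivity) (by
      have g1 : ν ^ (2 * D) = Real.exp (D * L / 2) := by
        rw [hν, ← Real.exp_nat_mul]; congr 1; push_cast; ring
      have g2 : y ^ (2 * τ - 2 * D) ≤ Real.exp (-(4 * w ^ 2) + 4 * w * D) := by
        rw [hy, ← Real.exp_nat_mul]
        apply Real.exp_le_exp.2
        rw [Nat.cast_sub (by omega)]
        push_cast
        nlinarith
      have g3 : K ≤ Real.exp w := by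
        have := Real.exp_pos w
        linarith
      rw [g1, div_le_iff₀ (Real.exp_pos _), ← Real.exp_add]
      calc _ ≤ Real.exp (D * L / 2) * Real.exp (-(4 * w ^ 2) + 4 * w * D) * Real.exp w := by gcongr
        _ = Real.exp (D * L / 2 + (-(4 * w ^ 2) + 4 * w * D) + w) := by rw [← Real.exp_add, ← Real.exp_add]
        _ ≤ _ := by
          apply Real.exp_le_exp.2
          have k1 : w * D ≤ L * D / 200 := by nlinarith
          have k2 : w ≤ L * D / 200 := by
            have : L * 1 ≤ L * D := by gcongr
            linarith
          have k3 : 0 ≤ L * D := by positivity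
          linarith)
    linarith
  · calc t * √2 ^ D ≤ t * Real.exp D := by gcongr; exact hsqp D
      _ ≤ 1 := by
        rw [ht, ← Real.exp_add]; apply Real.exp_le_one_iff.2; linarith
  · have a1 : (2:ℝ) ^ D ≤ Real.exp D := by
      rw [← Real.exp_one_pow]
      have := Real.add_one_le_exp (1:ℝ)
      exact pow_le_pow_left₀ (by norm_num) (by linarith) D
    have a2 : ((n:ℝ) + 1) ^ D ≤ Real.exp (D * (L + 1)) := by
      calc ((n:ℝ) + 1) ^ D ≤ Real.exp (L + 1) ^ D := by gcongr
        _ = Real.exp (D * (L + 1)) := by rw [← Real.exp_nat_mul]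
    calc η * (2 ^ D * (((n:ℝ) + 1) ^ D) ^ 2) ≤ η * (Real.exp D * Real.exp (D * (L + 1)) ^ 2) := by gcongr
      _ = Real.exp (-(4 * D * L) + (D + 2 * (D * (L + 1)))) := by
        rw [hη, ← Real.exp_nat_mul, ← Real.exp_add, ← Real.exp_add]; push_cast; rfl
      _ ≤ Real.exp (-3) := Real.exp_le_exp.2 (by nlinarith)
      _ ≤ 1/4 := by
        rw [Real.exp_neg, inv_le_comm₀ (Real.exp_pos _) (by norm_num)]
        have := Real.add_one_le_exp (3:ℝ)
        norm_num; linarith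
  · rw [hν, ← Real.exp_nat_mul, hn]; congr 1; push_cast; ring
  · rw [hy]; apply Real.exp_le_one_iff.2; linarith
  · calc t * √2 ^ (τ + D) * ν ≤ t * Real.exp ((τ + D : ℕ)) * ν := by gcongr; exact hsqp _
      _ ≤ y ^ 2 := by
        rw [ht, hν, hy, ← Real.exp_add, ← Real.exp_add, ← Real.exp_nat_mul]
        apply Real.exp_le_exp.2
        push_cast
        linarith
  · rw [hΛ]; omega
  · have a1 : n * (t ^ 2 / 4) / 4 ≤ n * (t ^ 2 / 2 - η) / 4 := by
      gcongr; linarith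
    refine le_trans ?_ a1
    have a2 : n * (t ^ 2 / 4) / 4 = Real.exp (L / 2 - 50 * w) / 16 := by
      rw [hvt, hn, ← mul_div_assoc, ← Real.exp_add, div_div,
        show L + (-(L/2) - 50 * w) = L / 2 - 50 * w from by ring]
      norm_num
    rw [a2]
    have a3 : Real.exp (L / 2 - 50 * w) = Real.exp (L / 2 - 100 * w) * Real.exp (50 * w) := by
      rw [← Real.exp_add]; congr 1; ring
    have a4 := Real.add_one_le_exp (50 * w)
    have a5 := Real.exp_pos (L / 2 - 100 * w)
    rw [a3, le_div_iff₀ (by norm_num)]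
    gcongr
    linarith

end PlantedClique
end

end

section
attribute [local instance] Classical.propDecidable
namespace PlantedClique

theorem sos_planted_clique_lower_bound :
    ∃ c : ℝ, 0 < c ∧ ∃ C : ℝ, 0 < C ∧ ∀ d : ℕ → ℕ, ∃ N : ℕ, ∀ n : ℕ, N ≤ n →
      1 - C / (n : ℝ) ^ (10 * Real.log n) ≤
        probGraph n (fun G => ∃ L : MvPolynomial (Fin n) ℝ →ₗ[ℝ] ℝ,
          IsCliquePseudoDist n (d n) G L ∧
          (n : ℝ) ^ ((1 : ℝ) / 2 - c * Real.sqrt ((d n : ℝ) / Real.log n)) ≤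
            L (∑ i : Fin n, MvPolynomial.X i)) := by
  refine ⟨100, by norm_num, 2, by norm_num, fun d => ?_⟩
  obtain ⟨N, hN⟩ := large_facts
  refine ⟨N, fun n hn => ?_⟩
  obtain ⟨hL0, hbig⟩ := hN n hn
  set L := Real.log n with hL
  have hn0 : (n : ℝ) ≠ 0 := by
    intro h; rw [h, Real.log_zero] at hL; linarith
  have hnpos : (0:ℝ) < n := lt_of_le_of_ne (by positivity) (Ne.symm hn0)
  have hn1 : (1:ℝ) ≤ n := by
    have : 0 < n := by exact_mod_cast hnpos
    exact_mod_cast this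
  have hLpos : 0 < L := by linarith
  have hle1 : 1 - 2 / (n : ℝ) ^ (10 * L) ≤ 1 := by
    have : 0 ≤ 2 / (n : ℝ) ^ (10 * L) := by positivity
    linarith
  have hs0 : 0 ≤ √((d n : ℝ) / L) := Real.sqrt_nonneg _
  by_cases h1 : d n / 2 = 0
  · rw [prob_one]
    · exact hle1
    · intro G
      obtain ⟨L', hL', hv⟩ := triv_a h1 G
      refine ⟨L', hL', le_trans ?_ hv⟩
      calc (n : ℝ) ^ ((1 : ℝ) / 2 - 100 * √((d n : ℝ) / L)) ≤ (n : ℝ) ^ (1 : ℝ) :=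
            Real.rpow_le_rpow_of_exponent_le hn1 (by linarith)
        _ = n := Real.rpow_one _
  by_cases h2 : 1 / 2 ≤ 100 * √((d n : ℝ) / L)
  · rw [prob_one]
    · exact hle1
    · intro G
      obtain ⟨L', hL', hv⟩ := triv_b (d := d n) (⟨0, by exact_mod_cast hnpos⟩ : Fin n) G
      refine ⟨L', hL', le_trans ?_ hv⟩
      exact Real.rpow_le_one_of_one_le_of_nonpos hn1 (by linarith)
  push Not at h2
  have key := main_case (n := n) (d := d n) (L := L) (w := L * √((d n : ℝ) / L)) hL hL0 hbig
    (Nat.one_le_iff_ne_zero.2 h1) (by positivity)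
    (by rw [mul_pow, Real.sq_sqrt (by positivity)]; field_simp) (by nlinarith)
  have e1 : (n : ℝ) ^ ((1 : ℝ) / 2 - 100 * √((d n : ℝ) / L)) =
      Real.exp (L / 2 - 100 * (L * √((d n : ℝ) / L))) := by
    rw [Real.rpow_def_of_pos hnpos, ← hL]; congr 1; ring
  have e2 : 2 / (n : ℝ) ^ (10 * L) = 2 * Real.exp (-(10 * L ^ 2)) := by
    rw [Real.rpow_def_of_pos hnpos, ← hL, Real.exp_neg, div_eq_mul_inv]; congr 3; ring
  rw [e1, e2]
  exact key

end PlantedClique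
end
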